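/- arXiv:1306.6347 — 5 statements merged into one kernel-verified Lean document; each statement's English description precedes it below -/
import Mathlib

section
/- For N = 1, 2, …, let ξ(N) = (ξ(N)^1 ≺ ξ(N)^2 ≺ … ≺ ξ(N)^N) be the uniformly random element of 𝔾𝕋^{(N)}_{(1,2,…,N)}. Then for any fixed k ≥ 1 the family of laws of the ℝ^k-valued random vectors N^{−1/2} · ( ξ(N)^k_1 − N/2, ξ(N)^k_2 − N/2, …, ξ(N)^k_k − N/2 ), N ≥ k, is tight: for every ε > 0 there is a compact set K ⊂ ℝ^k such that each of these vectors lies in K with probability at least 1 − ε. -/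
/-- `μ ≺ lam`: interlacing, `lam_1 ≤ μ_1 ≤ lam_2 ≤ μ_2 ≤ … ≤ μ_n ≤ lam_{n+1}`. -/
def Interlaces {n : ℕ} (μ : Fin n → ℤ) (lam : Fin (n + 1) → ℤ) : Prop :=
  ∀ i : Fin n, lam i.castSucc ≤ μ i ∧ μ i ≤ lam i.succ

/-- A half-strict Gelfand–Tsetlin pattern of depth `N`: rows `μ^1, …, μ^N` with `μ^k` a
strictly increasing `k`-tuple of integers, consecutive rows interlacing. -/
def IsGTPattern {N : ℕ} (μ : ∀ k : Fin N, Fin ((k : ℕ) + 1) → ℤ) : Prop :=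
  (∀ k, StrictMono (μ k)) ∧
  ∀ k : Fin N, ∀ h : (k : ℕ) + 1 < N, Interlaces (μ k) (μ ⟨(k : ℕ) + 1, h⟩)

open Polynomial in
theorem coeff_one_sub_X_pow {R : Type*} [CommRing R] (m a : ℕ) :
    ((1 - X : R[X]) ^ m).coeff a = (-1) ^ a * (m.choose a : R) := by
  have h : (1 - X : R[X]) ^ m = ((1 + X) ^ m).comp (-X) := by simp [sub_eq_add_neg]
  rw [h, show (-X : R[X]) = C (-1) * X by simp, comp_C_mul_X_coeff, coeff_one_add_X_pow]
  ring

open Polynomial in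
theorem coeff_comp_one_sub_mul {R : Type*} [CommRing R] {f : R[X]} {d : ℕ}
    (h : ∀ j : ℕ, ((1 - X) ^ j * f).coeff d = 0) (q : R[X]) :
    (q.comp (1 - X) * f).coeff d = 0 := by
  induction q using Polynomial.induction_on' with
  | add p q hp hq => rw [add_comp, add_mul, coeff_add, hp, hq, add_zero]
  | monomial n a =>
    rw [monomial_comp, mul_assoc, coeff_C_mul, h, mul_zero]

open Polynomial in
theorem coeff_eq_zero_of_one_sub_pow_mul {R : Type*} [CommRing R] {f : R[X]} {d : ℕ}
    (h : ∀ j : ℕ, ((1 - X) ^ j * f).coeff d = 0) {s : ℕ} (hs : s ≤ d) : f.coeff s = 0 := by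
  have := coeff_comp_one_sub_mul h ((1 - X) ^ (d - s))
  rw [pow_comp, sub_comp, one_comp, X_comp, sub_sub_cancel, coeff_X_pow_mul', if_pos (by omega)]
    at this
  rwa [Nat.sub_sub_self hs] at this

/-- The homogenised generating polynomial of `α 0, …, α d`. -/
def homGen {R : Type*} [CommRing R] (d : ℕ) (α : ℕ → R) (y w : R) : R :=
  ∑ a ∈ Finset.range (d + 1), α a * y ^ a * (-w) ^ (d - a)

theorem homGen_swap {R : Type*} [CommRing R] {d : ℕ} {α : ℕ → R}
    (hα : ∀ a ≤ d, α (d - a) = α a) (y w : R) :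
    homGen d α y w = (-1) ^ d * homGen d α w y := by
  unfold homGen
  rw [Finset.mul_sum, ← Finset.sum_range_reflect]
  refine Finset.sum_congr rfl fun a ha => ?_
  have ha' : a ≤ d := by simp at ha; omega
  obtain ⟨b, rfl⟩ := Nat.exists_eq_add_of_le ha'
  have e1 : a + b + 1 - 1 - a = b := by omega
  have e2 : a + b - b = a := by omega
  have := hα a ha'
  have e3 : a + b - a = b := by omega
  rw [e3] at this
  rw [e1, e2, e3, this, neg_pow w, neg_pow y, pow_add]
  have : ((-1 : R) ^ b * (-1) ^ b) = 1 := by rw [← mul_pow]; simp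
  linear_combination (- α a * y ^ b * w ^ a * (-1) ^ a) * this

theorem homGen_smul {R : Type*} [CommRing R] (d : ℕ) (α : ℕ → R) (c y w : R) :
    homGen d α (c * y) (c * w) = c ^ d * homGen d α y w := by
  unfold homGen
  rw [Finset.mul_sum]
  refine Finset.sum_congr rfl fun a ha => ?_
  have ha' : a ≤ d := by simp at ha; omega
  obtain ⟨b, rfl⟩ := Nat.exists_eq_add_of_le ha'
  have e3 : a + b - a = b := by omega
  rw [e3]
  ring

/-- The cyclic sum whose vanishing on `x + y + w = 0` expresses the three-term relation. -/
def cyclicSum {R : Type*} [CommRing R] (d : ℕ) (α : ℕ → R) (x y w : R) : R :=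
  x ^ (2 * d + 1) * homGen d α y w + y ^ (2 * d + 1) * homGen d α w x
    + w ^ (2 * d + 1) * homGen d α x y

theorem cyclicSum_smul {R : Type*} [CommRing R] (d : ℕ) (α : ℕ → R) (c x y w : R) :
    cyclicSum d α (c * x) (c * y) (c * w) = c ^ (3 * d + 1) * cyclicSum d α x y w := by
  unfold cyclicSum
  rw [homGen_smul, homGen_smul, homGen_smul]
  ring

theorem cyclicSum_rotate {R : Type*} [CommRing R] (d : ℕ) (α : ℕ → R) (x y w : R) :
    cyclicSum d α y w x = cyclicSum d α x y w := by
  unfold cyclicSum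
  ring

theorem cyclicSum_swap {R : Type*} [CommRing R] {d : ℕ} {α : ℕ → R}
    (hα : ∀ a ≤ d, α (d - a) = α a) (x y w : R) :
    cyclicSum d α x w y = (-1) ^ d * cyclicSum d α x y w := by
  unfold cyclicSum
  rw [homGen_swap hα w y, homGen_swap hα y x, homGen_swap hα x w]
  ring

theorem map_cyclicSum {R S : Type*} [CommRing R] [CommRing S] (f : R →+* S) (d : ℕ) (α : ℕ → R)
    (x y w : R) : f (cyclicSum d α x y w) = cyclicSum d (fun a => f (α a)) (f x) (f y) (f w) := by
  simp [cyclicSum, homGen]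

open Polynomial in
theorem coeff_cyclicSum_eq_zero {R : Type*} [CommRing R] {d : ℕ} {α : ℕ → R}
    (hα : ∀ a ≤ d, α (d - a) = α a)
    (hpar : ∀ x : ℕ, 1 ≤ x →
      ∑ a ∈ Finset.range (d + 1), α a * (-1) ^ a * ((2 * d + x).choose a : R) =
        (-1) ^ d * ∑ a ∈ Finset.range (d + 1), α a * ((x + a - 1).choose a : R))
    {s : ℕ} (hs : s ≤ d) :
    (cyclicSum d (fun a => C (α a)) (-1) (1 - X) (X : R[X])).coeff s = 0 := by
  have hz : (X ^ (2 * d + 1) * homGen d (fun a => C (α a)) (-1) (1 - X) : R[X]).coeff s = 0 := by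
    rw [coeff_X_pow_mul', if_neg (by omega)]
  unfold cyclicSum
  rw [coeff_add, hz, add_zero]
  refine coeff_eq_zero_of_one_sub_pow_mul (d := d) (fun j => ?_) hs
  have h1 := hpar (j + 1) (by omega)
  rw [mul_add, coeff_add]
  have e1 : ((1 - X) ^ j * ((1 - X) ^ (2 * d + 1) * homGen d (fun a => C (α a)) (X : R[X]) (-1))).coeff
      d
      = ∑ a ∈ Finset.range (d + 1), α a * (-1) ^ a * ((2 * d + (j + 1)).choose a : R) := by
    rw [← mul_assoc, ← pow_add]
    unfold homGen
    rw [Finset.mul_sum, finsetSum_coeff, ← Finset.sum_range_reflect]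
    refine Finset.sum_congr rfl fun a ha => ?_
    have ha' : a ≤ d := by simp at ha; omega
    simp only [show d + 1 - 1 - a = d - a by omega, hα a ha']
    rw [neg_neg, one_pow, mul_one,
      mul_left_comm, coeff_C_mul, coeff_mul_X_pow', if_pos (by omega),
      show d - (d - a) = a by omega, coeff_one_sub_X_pow]
    rw [show j + (2 * d + 1) = 2 * d + (j + 1) by ring]
    ring
  have e2 : ((1 - X) ^ j * ((-1) ^ (2 * d + 1) * homGen d (fun a => C (α a)) (1 - X : R[X]) X)).coeff
      d
      = - ((-1) ^ d * ∑ a ∈ Finset.range (d + 1), α a * ((j + 1 + a - 1).choose a : R)) := by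
    unfold homGen
    rw [Odd.neg_one_pow ⟨d, rfl⟩, Finset.mul_sum, Finset.mul_sum, finsetSum_coeff, Finset.mul_sum,
      ← Finset.sum_neg_distrib]
    refine Finset.sum_congr rfl fun a ha => ?_
    have ha' : a ≤ d := by simp at ha; omega
    have : (1 - X) ^ j * (-1 * (C (α a) * (1 - X) ^ a * (-X : R[X]) ^ (d - a)))
        = C (-α a * (-1) ^ (d - a)) * ((1 - X) ^ (j + a) * X ^ (d - a)) := by
      rw [neg_pow (X : R[X])]
      simp only [map_mul, map_neg, map_pow, map_one]
      ring
    rw [this, coeff_C_mul, coeff_mul_X_pow', if_pos (by omega),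
      show d - (d - a) = a by omega, coeff_one_sub_X_pow, show j + 1 + a - 1 = j + a by omega]
    obtain ⟨b, rfl⟩ := Nat.exists_eq_add_of_le ha'
    rw [show a + b - a = b by omega]
    ring
  rw [e1, e2, h1]
  ring


open Polynomial in
theorem natDegree_homGen_le {R : Type*} [CommRing R] (d : ℕ) (α : ℕ → R) {y w : R[X]}
    (hy : y.natDegree ≤ 1) (hw : w.natDegree ≤ 1) :
    (homGen d (fun a => C (α a)) y w).natDegree ≤ d := by
  refine natDegree_sum_le_of_forall_le _ _ fun a ha => ?_
  have ha' : a ≤ d := by simp at ha; omega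
  refine natDegree_mul_le_of_le (m := a) (n := d - a) ?_ ?_ |>.trans (by omega)
  · refine (natDegree_C_mul_le _ _).trans ((natDegree_pow_le_of_le a hy).trans (by omega))
  · refine (natDegree_pow_le_of_le (d - a) (m := 1) (by rwa [natDegree_neg])).trans (by omega)

open Polynomial in
theorem natDegree_cyclicSum_le {R : Type*} [CommRing R] (d : ℕ) (α : ℕ → R) {x y w : R[X]}
    (hx : x.natDegree ≤ 1) (hy : y.natDegree ≤ 1) (hw : w.natDegree ≤ 1) :
    (cyclicSum d (fun a => C (α a)) x y w).natDegree ≤ 3 * d + 1 := by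
  have key : ∀ {x y w : R[X]}, x.natDegree ≤ 1 → y.natDegree ≤ 1 → w.natDegree ≤ 1 →
      (x ^ (2 * d + 1) * homGen d (fun a => C (α a)) y w).natDegree ≤ 3 * d + 1 := by
    intro x y w hx hy hw
    refine (natDegree_mul_le_of_le (natDegree_pow_le_of_le _ hx)
      (natDegree_homGen_le d α hy hw)).trans (by omega)
  exact natDegree_add_le_of_degree_le (natDegree_add_le_of_degree_le (key hx hy hw) (key hy hw hx))
    (key hw hx hy)

open Polynomial in
theorem eval_cyclicSum {R : Type*} [CommRing R] (d : ℕ) (α : ℕ → R) (z : R) :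
    (cyclicSum d (fun a => C (α a)) (-1) (1 - X) (X : R[X])).eval z =
      cyclicSum d α (-1) (1 - z) z := by
  have := map_cyclicSum (evalRingHom z) d (fun a => C (α a)) (-1) (1 - X) (X : R[X])
  simpa using this

open Polynomial in
theorem cyclicSum_poly_eq_zero {K : Type*} [Field K] [Infinite K] {d : ℕ} {α : ℕ → K}
    (hα : ∀ a ≤ d, α (d - a) = α a)
    (hpar : ∀ x : ℕ, 1 ≤ x →
      ∑ a ∈ Finset.range (d + 1), α a * (-1) ^ a * ((2 * d + x).choose a : K) =
        (-1) ^ d * ∑ a ∈ Finset.range (d + 1), α a * ((x + a - 1).choose a : K)) :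
    cyclicSum d (fun a => C (α a)) (-1) (1 - X) (X : K[X]) = 0 := by
  set Φ := cyclicSum d (fun a => C (α a)) (-1) (1 - X) (X : K[X]) with hΦ
  have hX1 : (1 - X : K[X]).natDegree ≤ 1 := (natDegree_sub_le _ _).trans (by simp)
  have hdeg : Φ.natDegree ≤ 3 * d + 1 :=
    natDegree_cyclicSum_le d α (by simp) hX1 natDegree_X_le
  have hlow : X ^ (d + 1) ∣ Φ := X_pow_dvd_iff.2 fun s hs =>
    coeff_cyclicSum_eq_zero hα hpar (by omega)
  have hsymm : Φ.comp (1 - X) = (-1) ^ d * Φ := by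
    have h := map_cyclicSum (compRingHom (1 - X : K[X])) d (fun a => C (α a)) (-1) (1 - X) X
    simp only [coe_compRingHom_apply, sub_comp, one_comp, X_comp, neg_comp, C_comp,
      sub_sub_cancel] at h
    rw [hΦ, h]
    exact cyclicSum_swap (fun a ha => by rw [hα a ha]) _ _ _
  have hlow' : (1 - X) ^ (d + 1) ∣ Φ := by
    have h1 : (X ^ (d + 1) : K[X]).comp (1 - X) ∣ Φ.comp (1 - X) := by
      obtain ⟨q, hq⟩ := hlow
      exact ⟨q.comp (1 - X), by rw [hq, mul_comp]⟩
    rw [hsymm, X_pow_comp] at h1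
    have h2 : IsUnit ((-1 : K[X]) ^ d) := (isUnit_neg_one).pow d
    exact (h2.dvd_mul_left).1 h1
  have hcop : IsCoprime (X ^ (d + 1) : K[X]) ((1 - X) ^ (d + 1)) :=
    IsCoprime.pow ⟨1, 1, by ring⟩
  have hdvd := hcop.mul_dvd hlow hlow'
  have hrefl : Φ.reflect (3 * d + 1) = -Φ := by
    refine eq_of_infinite_eval_eq _ _ ?_
    refine Set.Infinite.mono (s := {z : K | z ≠ 0}) ?_ ?_
    · intro z hz
      have hz : z ≠ 0 := hz
      let inv : Invertible z⁻¹ := invertibleOfNonzero (inv_ne_zero hz)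
      have h := eval₂_reflect_mul_pow (RingHom.id K) z⁻¹ (3 * d + 1) Φ hdeg
      rw [invOf_eq_inv, inv_inv] at h
      simp only [eval₂_id] at h
      have h' : eval z (reflect (3 * d + 1) Φ) =
          z ^ (3 * d + 1) * cyclicSum d α (-1) (1 - z⁻¹) z⁻¹ := by
        rw [← eval_cyclicSum, ← hΦ, ← h, mul_left_comm, ← mul_pow, mul_inv_cancel₀ hz, one_pow,
          mul_one]
      show eval z (reflect (3 * d + 1) Φ) = eval z (-Φ)
      rw [h', ← cyclicSum_smul, eval_neg, hΦ, eval_cyclicSum]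
      have e1 : z * (1 - z⁻¹) = (-1) * (1 - z) := by field_simp; ring
      have e2 : z * z⁻¹ = (-1) * (-1) := by field_simp
      have e3 : z * (-1) = (-1) * z := by ring
      rw [e1, e2, e3, cyclicSum_smul, cyclicSum_swap hα z (-1) (1 - z),
        cyclicSum_rotate d α z (-1) (1 - z), ← mul_assoc, ← pow_add,
        Odd.neg_one_pow ⟨2 * d, by ring⟩, neg_one_mul]
    · exact (Set.finite_singleton (0 : K)).infinite_compl
  by_contra hne
  have hle : (X ^ (d + 1) * (1 - X) ^ (d + 1) : K[X]).natDegree ≤ Φ.natDegree :=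
    natDegree_le_of_dvd hdvd hne
  have hX1' : (1 - X : K[X]).natDegree = 1 := by
    rw [← neg_sub, natDegree_neg]
    simpa using natDegree_X_sub_C (1 : K)
  have hX1ne : (1 - X : K[X]) ≠ 0 := by
    intro h; rw [h] at hX1'; simp at hX1'
  rw [natDegree_mul (pow_ne_zero _ X_ne_zero) (pow_ne_zero _ hX1ne), natDegree_pow, natDegree_pow,
    natDegree_X, hX1'] at hle
  have hlead : Φ.coeff Φ.natDegree = 0 := by
    have h1 := congrArg (fun p => coeff p (3 * d + 1 - Φ.natDegree)) hrefl
    simp only [coeff_reflect, coeff_neg] at h1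
    rw [revAt_le (by omega), Nat.sub_sub_self hdeg] at h1
    rw [h1, coeff_cyclicSum_eq_zero hα hpar (by omega), neg_zero]
  exact hne (leadingCoeff_eq_zero.1 hlead)

theorem cyclicSum_eq_zero {K : Type*} [Field K] [Infinite K] {d : ℕ} {α : ℕ → K}
    (hα : ∀ a ≤ d, α (d - a) = α a)
    (hpar : ∀ x : ℕ, 1 ≤ x →
      ∑ a ∈ Finset.range (d + 1), α a * (-1) ^ a * ((2 * d + x).choose a : K) =
        (-1) ^ d * ∑ a ∈ Finset.range (d + 1), α a * ((x + a - 1).choose a : K))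
    {x y w : K} (h : x + y + w = 0) : cyclicSum d α x y w = 0 := by
  have main : ∀ x y w : K, x ≠ 0 → x + y + w = 0 → cyclicSum d α x y w = 0 := by
    intro x y w hx h
    have h0 : cyclicSum d α (-1) (1 - w / -x) (w / -x) = 0 := by
      rw [← eval_cyclicSum, cyclicSum_poly_eq_zero hα hpar, Polynomial.eval_zero]
    have e1 : (-x) * (-1) = x := by ring
    have e2 : (-x) * (w / -x) = w := by field_simp
    have e3 : (-x) * (1 - w / -x) = y := by
      rw [mul_sub, e2]; linear_combination -h
    have h1 := cyclicSum_smul d α (-x) (-1) (1 - w / -x) (w / -x)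
    rwa [h0, mul_zero, e1, e2, e3] at h1
  by_cases hx : x = 0
  · by_cases hy : y = 0
    · have hw : w = 0 := by rw [hx, hy] at h; simpa using h
      subst hx hy hw
      simp [cyclicSum]
    · rw [← cyclicSum_rotate]
      exact main y w x hy (by linear_combination h)
  · exact main x y w hx h

open Polynomial in
/-- The three-term relation, restricted to a line through a primitive cube root of unity `ω`,
kills every third coefficient. -/
theorem coeff_eq_zero_of_mod_three {d : ℕ} {α : ℕ → ℂ}
    (hcyc : ∀ x y w : ℂ, x + y + w = 0 → cyclicSum d α x y w = 0)
    {ω : ℂ} (hω : ω ^ 2 + ω + 1 = 0) {a : ℕ} (ha : a % 3 = 2) :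
    ((X - 1) ^ (2 * d + 1) * homGen d (fun a => C (α a)) (C ω * X - C (ω ^ 2))
      (C (ω ^ 2) * X - C ω) : ℂ[X]).coeff a = 0 := by
  have hω3 : ω ^ 3 = 1 := by linear_combination (ω - 1) * hω
  set K : ℂ[X] := (X - 1) ^ (2 * d + 1) * homGen d (fun a => C (α a)) (C ω * X - C (ω ^ 2))
      (C (ω ^ 2) * X - C ω) with hK
  have heval : ∀ y : ℂ, K.eval y =
      (y - 1) ^ (2 * d + 1) * homGen d α (ω * y - ω ^ 2) (ω ^ 2 * y - ω) := by
    intro y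
    simp [hK, homGen, eval_finsetSum]
  have hpow : ω ^ (3 * d + 1) = ω := by rw [pow_succ, pow_mul, hω3, one_pow, one_mul]
  have hrel : K + C (ω ^ 2) * K.comp (C (ω ^ 2) * X) + C ω * K.comp (C ω * X) = 0 := by
    refine Polynomial.funext fun y => ?_
    simp only [eval_add, eval_mul, eval_C, eval_comp, eval_X, eval_zero]
    rw [heval, heval, heval]
    have h := hcyc (y - 1) (ω * y - ω ^ 2) (ω ^ 2 * y - ω) (by linear_combination (y - 1) * hω)
    have e1 : ω ^ 2 * y - 1 = ω * (ω * y - ω ^ 2) := by linear_combination hω3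
    have e2 : ω * (ω ^ 2 * y) - ω ^ 2 = ω * (ω ^ 2 * y - ω) := by ring
    have e3 : ω ^ 2 * (ω ^ 2 * y) - ω = ω * (y - 1) := by linear_combination ω * y * hω3
    have f1 : ω * y - 1 = ω ^ 2 * (ω ^ 2 * y - ω) := by linear_combination (1 - ω * y) * hω3
    have f2 : ω * (ω * y) - ω ^ 2 = ω ^ 2 * (y - 1) := by ring
    have f3 : ω ^ 2 * (ω * y) - ω = ω ^ 2 * (ω * y - ω ^ 2) := by linear_combination ω * hω3
    rw [e1, e2, e3, f1, f2, f3, homGen_smul, homGen_smul]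
    have g1 : ω ^ 2 * ((ω * (ω * y - ω ^ 2)) ^ (2 * d + 1) *
        (ω ^ d * homGen d α (ω ^ 2 * y - ω) (y - 1))) =
        (ω * y - ω ^ 2) ^ (2 * d + 1) * homGen d α (ω ^ 2 * y - ω) (y - 1) := by
      rw [mul_pow]
      have : ω ^ (2 * d + 1) * ω ^ d * ω ^ 2 = 1 := by
        rw [← pow_add, show 2 * d + 1 + d = 3 * d + 1 by ring, hpow, ← hω3]; ring
      linear_combination ((ω * y - ω ^ 2) ^ (2 * d + 1) * homGen d α (ω ^ 2 * y - ω) (y - 1)) * this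
    have g2 : ω * ((ω ^ 2 * (ω ^ 2 * y - ω)) ^ (2 * d + 1) *
        ((ω ^ 2) ^ d * homGen d α (y - 1) (ω * y - ω ^ 2))) =
        (ω ^ 2 * y - ω) ^ (2 * d + 1) * homGen d α (y - 1) (ω * y - ω ^ 2) := by
      rw [mul_pow]
      have : (ω ^ 2) ^ (2 * d + 1) * (ω ^ 2) ^ d * ω = 1 := by
        rw [← pow_add, show 2 * d + 1 + d = 3 * d + 1 by ring, ← pow_mul, mul_comm 2, pow_mul, hpow,
          ← hω3]; ring
      linear_combination ((ω ^ 2 * y - ω) ^ (2 * d + 1) * homGen d α (y - 1) (ω * y - ω ^ 2)) * this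
    rw [g1, g2]
    exact h
  have hc := congrArg (fun p => coeff p a) hrel
  simp only [coeff_add, coeff_C_mul, comp_C_mul_X_coeff, coeff_zero] at hc
  obtain ⟨b, rfl⟩ : ∃ b, a = 3 * b + 2 := ⟨a / 3, by omega⟩
  have h1 : ω ^ (3 * b + 2) = ω ^ 2 := by rw [pow_add, pow_mul, hω3, one_pow, one_mul]
  have h2 : (ω ^ 2) ^ (3 * b + 2) = ω := by
    rw [← pow_mul, mul_comm, pow_mul, h1]; linear_combination ω * hω3
  rw [h1, h2] at hc
  have : (3 : ℂ) * K.coeff (3 * b + 2) = 0 := by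
    linear_combination hc - 2 * K.coeff (3 * b + 2) * hω3
  simpa using this

namespace PowerSeries

theorem coeff_one_mul' {R : Type*} [CommRing R] (f g : R⟦X⟧) :
    coeff 1 (f * g) = coeff 0 f * coeff 1 g + coeff 1 f * coeff 0 g := by
  rw [coeff_mul, Finset.Nat.sum_antidiagonal_eq_sum_range_succ_mk]
  simp [Finset.sum_range_succ]

theorem coeff_two_mul {R : Type*} [CommRing R] (f g : R⟦X⟧) :
    coeff 2 (f * g) = coeff 0 f * coeff 2 g + coeff 1 f * coeff 1 g + coeff 2 f * coeff 0 g := by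
  rw [coeff_mul, Finset.Nat.sum_antidiagonal_eq_sum_range_succ_mk]
  simp [Finset.sum_range_succ]

theorem coeff_zero_pow' {R : Type*} [CommRing R] {g : R⟦X⟧} {v : R} (h0 : coeff 0 g = v) (m : ℕ) :
    coeff 0 (g ^ m) = v ^ m := by
  rw [coeff_zero_eq_constantCoeff_apply, map_pow, ← coeff_zero_eq_constantCoeff_apply, h0]

theorem coeff_one_pow' {R : Type*} [CommRing R] {g : R⟦X⟧} {v b : R} (h0 : coeff 0 g = v)
    (h1 : coeff 1 g = v * b) (m : ℕ) : coeff 1 (g ^ m) = v ^ m * (m * b) := by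
  induction m with
  | zero => simp
  | succ m ih =>
    rw [pow_succ, coeff_one_mul', coeff_zero_pow' h0, ih, h0, h1]
    push_cast; ring

theorem coeff_two_pow {R : Type*} [Field R] [CharZero R] {g : R⟦X⟧} {v b c : R} (h0 : coeff 0 g = v)
    (h1 : coeff 1 g = v * b) (h2 : coeff 2 g = v * c) (m : ℕ) :
    coeff 2 (g ^ m) = v ^ m * (m * c + m * (m - 1) / 2 * b ^ 2) := by
  induction m with
  | zero => simp [coeff_one]
  | succ m ih =>
    rw [pow_succ, coeff_two_mul, coeff_zero_pow' h0, coeff_one_pow' h0 h1, ih, h0, h1, h2]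
    push_cast; ring

end PowerSeries

open Polynomial in
theorem sum_moments_eq {K : Type*} [Field K] (c t : ℕ → K) (L d : ℕ)
    (y : ℕ → K)
    (hzero : ∀ k < 2 * d + 1, ∑ a ∈ Finset.range L, c a * t a ^ k = 0)
    (hsupp : ∀ a < L, c a = 0 ∨ ∃ j ≤ d, t a ^ 2 = y j) :
    ∑ a ∈ Finset.range L, c a * t a ^ (2 * d + 3) =
      (∑ j ∈ Finset.range (d + 1), y j) * ∑ a ∈ Finset.range L, c a * t a ^ (2 * d + 1) := by
  set R : K[X] := ∏ j ∈ Finset.range (d + 1), (X - C (y j)) with hR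
  have hRdeg : R.natDegree = d + 1 := by simp [hR]
  have hRmonic : R.Monic := monic_prod_X_sub_C _ _
  have hRnext : R.coeff d = - ∑ j ∈ Finset.range (d + 1), y j := by
    have := prod_X_sub_C_coeff_card_pred (Finset.range (d + 1)) y (by simp)
    simpa using this
  set Q : K[X] := X * expand K 2 R with hQ
  have hQdeg : Q.natDegree < 2 * d + 4 := by
    rw [hQ, natDegree_X_mul (by
      rw [Ne, expand_eq_zero (by norm_num)]; exact hRmonic.ne_zero), natDegree_expand, hRdeg]
    omega
  have hQ3 : Q.coeff (2 * d + 3) = 1 := by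
    rw [hQ, coeff_X_mul, show 2 * d + 2 = (d + 1) * 2 by ring, coeff_expand_mul (by norm_num)]
    rw [← hRdeg]; exact hRmonic
  have hQ1 : Q.coeff (2 * d + 1) = - ∑ j ∈ Finset.range (d + 1), y j := by
    rw [hQ, coeff_X_mul, mul_comm, coeff_expand_mul (by norm_num), hRnext]
  have hQ2 : Q.coeff (2 * d + 2) = 0 := by
    rw [hQ, coeff_X_mul, coeff_expand (by norm_num), if_neg (by omega)]
  have hev : ∑ a ∈ Finset.range L, c a * Q.eval (t a) = 0 := by
    refine Finset.sum_eq_zero fun a ha => ?_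
    rcases hsupp a (Finset.mem_range.1 ha) with h | ⟨j, hj, h⟩
    · rw [h, zero_mul]
    · have : R.eval (t a ^ 2) = 0 := by
        rw [hR, eval_prod]
        exact Finset.prod_eq_zero (Finset.mem_range.2 (Nat.lt_succ_of_le hj)) (by simp [h])
      rw [hQ, eval_mul, expand_eval, this, mul_zero, mul_zero]
  have hswap : ∑ a ∈ Finset.range L, c a * Q.eval (t a) =
      ∑ k ∈ Finset.range (2 * d + 4), Q.coeff k * ∑ a ∈ Finset.range L, c a * t a ^ k := by
    simp_rw [eval_eq_sum_range' hQdeg, Finset.mul_sum]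
    rw [Finset.sum_comm]
    exact Finset.sum_congr rfl fun _ _ => Finset.sum_congr rfl fun _ _ => by ring
  rw [hev, Finset.sum_range_succ, Finset.sum_range_succ, Finset.sum_range_succ,
    Finset.sum_eq_zero (fun k hk => by rw [hzero k (Finset.mem_range.1 hk), mul_zero]),
    hQ1, hQ2, hQ3] at hswap
  linear_combination -hswap

namespace PowerSeries

theorem coeff_zero_mul_eq {R : Type*} [CommRing R] (f g : R⟦X⟧) :
    coeff 0 (f * g) = coeff 0 f * coeff 0 g := by
  simp only [coeff_zero_eq_constantCoeff_apply, map_mul]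

theorem coeff_exp_neg_pow_mul_exp_pow (m n k : ℕ) :
    coeff k ((evalNegHom (exp ℂ)) ^ m * exp ℂ ^ n) = ((n : ℂ) - m) ^ k / (k.factorial : ℂ) := by
  have h1 : evalNegHom (exp ℂ) ^ m = rescale (-(m : ℂ)) (exp ℂ) := by
    rw [← map_pow, exp_pow_eq_rescale_exp, evalNegHom, rescale_rescale]
    congr 2; ring
  rw [h1, exp_pow_eq_rescale_exp, exp_mul_exp_eq_exp_add, coeff_rescale, coeff_exp]
  simp only [one_div, map_inv₀, map_natCast]
  rw [neg_add_eq_sub, div_eq_mul_inv]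

theorem coeff_zero_homGen (d : ℕ) (α : ℕ → ℂ) {Y W : ℂ⟦X⟧} {s : ℂ}
    (hY0 : coeff 0 Y = s) (hW0 : coeff 0 (-W) = s) :
    coeff 0 (homGen d (fun a => C (α a)) Y W) = s ^ d * ∑ a ∈ Finset.range (d + 1), α a := by
  unfold homGen
  rw [map_sum, Finset.mul_sum]
  refine Finset.sum_congr rfl fun a ha => ?_
  obtain ⟨b, rfl⟩ := Nat.exists_eq_add_of_le (show a ≤ d by simp at ha; omega)
  rw [mul_assoc, coeff_C_mul, coeff_zero_mul_eq, coeff_zero_pow' hY0, coeff_zero_pow' hW0,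
    show a + b - a = b by omega]
  ring

theorem coeff_two_homGen (d : ℕ) (α : ℕ → ℂ) {Y W : ℂ⟦X⟧} {s : ℂ} (hs : s ^ 2 = -3)
    (hY0 : coeff 0 Y = s) (hW0 : coeff 0 (-W) = s)
    (hY1 : coeff 1 Y = s * (s / 3)) (hW1 : coeff 1 (-W) = s * (-s / 3))
    (hY2 : coeff 2 Y = s * (1 / 2)) (hW2 : coeff 2 (-W) = s * (1 / 2)) :
    coeff 2 (homGen d (fun a => C (α a)) Y W) =
      s ^ d * ∑ a ∈ Finset.range (d + 1), α a * (2 * d / 3 - (2 * a - d) ^ 2 / 6) := by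
  unfold homGen
  rw [map_sum, Finset.mul_sum]
  refine Finset.sum_congr rfl fun a ha => ?_
  obtain ⟨b, rfl⟩ := Nat.exists_eq_add_of_le (show a ≤ d by simp at ha; omega)
  rw [mul_assoc, coeff_C_mul, coeff_two_mul, coeff_zero_pow' hY0, coeff_zero_pow' hW0,
    coeff_one_pow' hY0 hY1, coeff_one_pow' hW0 hW1,
    coeff_two_pow hY0 hY1 hY2, coeff_two_pow hW0 hW1 hW2, show a + b - a = b by omega]
  push_cast
  rw [pow_add]
  linear_combination (α a * s ^ a * s ^ b * ((b * (b - 1) + a * (a - 1)) / 18 - a * b / 9)) * hs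

end PowerSeries

open PowerSeries in
theorem moment_identity {d : ℕ} {α : ℕ → ℂ}
    (hcyc : ∀ x y w : ℂ, x + y + w = 0 → cyclicSum d α x y w = 0) :
    (2 * d + 3 : ℂ) * (2 * d + 2) * (∑ a ∈ Finset.range (d + 1),
        α a * (2 * d / 3 - (2 * a - d) ^ 2 / 6) + (2 * d + 1) / 6 * ∑ a ∈ Finset.range (d + 1), α a)
      = (∑ j ∈ Finset.range (d + 1), ((6 * j - (3 * d + 1) : ℂ)) ^ 2)
        * ∑ a ∈ Finset.range (d + 1), α a := by
  obtain ⟨s, hs⟩ : ∃ s : ℂ, s ^ 2 = -3 := IsAlgClosed.exists_pow_nat_eq _ (by norm_num)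
  have hs0 : s ≠ 0 := by rintro rfl; norm_num at hs
  set ω : ℂ := (-1 + s) / 2 with hωd
  have hω2 : ω ^ 2 = (-1 - s) / 2 := by rw [hωd]; linear_combination hs / 4
  have hω : ω ^ 2 + ω + 1 = 0 := by rw [hω2, hωd]; ring
  set K : Polynomial ℂ := (Polynomial.X - 1) ^ (2 * d + 1) *
    homGen d (fun a => Polynomial.C (α a)) (Polynomial.C ω * Polynomial.X - Polynomial.C (ω ^ 2))
      (Polynomial.C (ω ^ 2) * Polynomial.X - Polynomial.C ω) with hK
  have hdeg : K.natDegree < 3 * d + 2 := by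
    have h1 : ∀ a b : ℂ, (Polynomial.C a * Polynomial.X - Polynomial.C b).natDegree ≤ 1 := by
      intro a b
      compute_degree
    have h2 : (Polynomial.X - 1 : Polynomial ℂ).natDegree ≤ 1 := by compute_degree
    have := Polynomial.natDegree_mul_le_of_le (Polynomial.natDegree_pow_le_of_le (2 * d + 1) h2)
      (natDegree_homGen_le d α (h1 ω (ω ^ 2)) (h1 (ω ^ 2) ω))
    rw [← hK] at this
    omega
  set e := exp ℂ with he
  set e' := evalNegHom (exp ℂ) with he'
  have hee : e' * e = 1 := by rw [mul_comm]; exact exp_mul_exp_neg_eq_one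
  set Y : ℂ⟦X⟧ := C ω * e - C (ω ^ 2) * e' with hY
  set W : ℂ⟦X⟧ := C (ω ^ 2) * e - C ω * e' with hW
  set f : ℂ⟦X⟧ := (e - e') ^ (2 * d + 1) * homGen d (fun a => C (α a)) Y W with hf
  have hfK : f = e' ^ (3 * d + 1) * K.eval₂ C (e ^ 2) := by
    have h1 : K.eval₂ C (e ^ 2) = (e ^ 2 - 1) ^ (2 * d + 1) *
        homGen d (fun a => C (α a)) (C ω * e ^ 2 - C (ω ^ 2)) (C (ω ^ 2) * e ^ 2 - C ω) := by
      simp only [hK, homGen, Polynomial.eval₂_mul, Polynomial.eval₂_pow, Polynomial.eval₂_sub,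
        Polynomial.eval₂_X, Polynomial.eval₂_one, Polynomial.eval₂_finsetSum, Polynomial.eval₂_C,
        Polynomial.eval₂_neg]
    have h2 : e - e' = e' * (e ^ 2 - 1) := by linear_combination -e * hee
    have h3 : Y = e' * (C ω * e ^ 2 - C (ω ^ 2)) := by
      rw [hY]; linear_combination -C ω * e * hee
    have h4 : W = e' * (C (ω ^ 2) * e ^ 2 - C ω) := by
      rw [hW]; linear_combination -C (ω ^ 2) * e * hee
    rw [hf, h1, h2, h3, h4, homGen_smul, mul_pow]
    ring
  set t : ℕ → ℂ := fun a => 2 * a - (3 * d + 1) with ht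
  have hcoeff : ∀ k, (k.factorial : ℂ) * coeff k f =
      ∑ a ∈ Finset.range (3 * d + 2), K.coeff a * t a ^ k := by
    intro k
    rw [hfK, Polynomial.eval₂_eq_sum_range' C hdeg, Finset.mul_sum, map_sum, Finset.mul_sum]
    refine Finset.sum_congr rfl fun a _ => ?_
    rw [mul_left_comm, coeff_C_mul, ← pow_mul, coeff_exp_neg_pow_mul_exp_pow, ht]
    have := Nat.cast_ne_zero (R := ℂ).2 k.factorial_ne_zero
    field_simp
    push_cast
    ring
  have c0 : coeff 0 e = 1 := by simp [he]
  have c1 : coeff 1 e = 1 := by simp [he, coeff_exp]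
  have c2 : coeff 2 e = 1 / 2 := by simp [he, coeff_exp]
  have c3 : coeff 3 e = 1 / 6 := by simp [he, coeff_exp, Nat.factorial]
  have c' : ∀ k, coeff k e' = (-1) ^ k * coeff k e := fun k => by
    rw [he', evalNegHom, coeff_rescale]
  set u : ℂ⟦X⟧ := PowerSeries.mk fun p => coeff (p + 1) (e - e') with hu
  have hXu : e - e' = X * u := by
    have := sub_const_eq_X_mul_shift (e - e')
    rwa [show constantCoeff (e - e') = 0 by
      rw [← coeff_zero_eq_constantCoeff_apply, map_sub, c', c0]; norm_num, map_zero,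
        sub_zero] at this
  have u0 : coeff 0 u = 2 := by
    rw [hu, coeff_mk, map_sub, c', c1]; norm_num
  have u1 : coeff 1 u = 2 * 0 := by
    rw [hu, coeff_mk, map_sub, c', c2]; norm_num
  have u2 : coeff 2 u = 2 * (1 / 6) := by
    rw [hu, coeff_mk, map_sub, c', c3]; norm_num
  have hfX : f = X ^ (2 * d + 1) * (u ^ (2 * d + 1) * homGen d (fun a => C (α a)) Y W) := by
    rw [hf, hXu]; ring
  have hY0 : coeff 0 Y = s := by
    rw [hY, map_sub, coeff_C_mul, coeff_C_mul, c', c0, hω2, hωd]; ring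
  have hY1 : coeff 1 Y = s * (s / 3) := by
    rw [hY, map_sub, coeff_C_mul, coeff_C_mul, c', c1, hω2, hωd]; linear_combination -hs / 3
  have hY2 : coeff 2 Y = s * (1 / 2) := by
    rw [hY, map_sub, coeff_C_mul, coeff_C_mul, c', c2, hω2, hωd]; ring
  have hW0 : coeff 0 (-W) = s := by
    rw [hW, map_neg, map_sub, coeff_C_mul, coeff_C_mul, c', c0, hω2, hωd]; ring
  have hW1 : coeff 1 (-W) = s * (-s / 3) := by
    rw [hW, map_neg, map_sub, coeff_C_mul, coeff_C_mul, c', c1, hω2, hωd]; linear_combination hs / 3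
  have hW2 : coeff 2 (-W) = s * (1 / 2) := by
    rw [hW, map_neg, map_sub, coeff_C_mul, coeff_C_mul, c', c2, hω2, hωd]; ring
  have hlow : ∀ k < 2 * d + 1, ∑ a ∈ Finset.range (3 * d + 2), K.coeff a * t a ^ k = 0 := by
    intro k hk
    rw [← hcoeff, hfX, coeff_X_pow_mul', if_neg (by omega), mul_zero]
  have hsupp : ∀ a < 3 * d + 2, K.coeff a = 0 ∨
      ∃ j ≤ d, t a ^ 2 = ((6 * (j : ℕ) - (3 * d + 1) : ℂ)) ^ 2 := by
    intro a ha
    obtain ⟨q, h | h | h⟩ : ∃ q, a = 3 * q ∨ a = 3 * q + 1 ∨ a = 3 * q + 2 :=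
      ⟨a / 3, by omega⟩
    · refine Or.inr ⟨q, by omega, ?_⟩
      simp only [ht, h]; push_cast; ring
    · refine Or.inr ⟨d - q, by omega, ?_⟩
      simp only [ht, h]
      rw [Nat.cast_sub (by omega)]
      push_cast; ring
    · exact Or.inl (coeff_eq_zero_of_mod_three hcyc hω (by omega))
  have hmom := sum_moments_eq K.coeff t (3 * d + 2) d _ hlow hsupp
  rw [← hcoeff, ← hcoeff, hfX, coeff_X_pow_mul', if_pos (by omega), coeff_X_pow_mul',
    if_pos le_rfl, Nat.sub_self, show 2 * d + 3 - (2 * d + 1) = 2 by omega, coeff_two_mul,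
    coeff_zero_mul_eq, coeff_zero_pow' u0, coeff_one_pow' u0 u1, coeff_two_pow u0 u1 u2,
    coeff_zero_homGen d α hY0 hW0, coeff_two_homGen d α hs hY0 hW0 hY1 hW1 hY2 hW2,
    Nat.factorial_succ (2 * d + 2), Nat.factorial_succ (2 * d + 1)] at hmom
  have hne : ((2 * d + 1).factorial : ℂ) * 2 ^ (2 * d + 1) * s ^ d ≠ 0 := by
    exact mul_ne_zero (mul_ne_zero (Nat.cast_ne_zero.2 (Nat.factorial_ne_zero _))
      (pow_ne_zero _ two_ne_zero)) (pow_ne_zero _ hs0)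
  refine mul_left_cancel₀ hne ?_
  push_cast at hmom
  linear_combination hmom

theorem second_moment_le {d : ℕ} {α : ℕ → ℝ} (hpos : ∀ a, 0 ≤ α a)
    (hα : ∀ a ≤ d, α (d - a) = α a)
    (hpar : ∀ x : ℕ, 1 ≤ x →
      ∑ a ∈ Finset.range (d + 1), α a * (-1) ^ a * ((2 * d + x).choose a : ℝ) =
        (-1) ^ d * ∑ a ∈ Finset.range (d + 1), α a * ((x + a - 1).choose a : ℝ)) :
    ∑ a ∈ Finset.range (d + 1), α a * (2 * a - d) ^ 2 ≤
      (6 * d + 1) * ∑ a ∈ Finset.range (d + 1), α a := by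
  have h := moment_identity (d := d) (α := fun a => (α a : ℂ)) fun x y w hxyw =>
    cyclicSum_eq_zero (fun a ha => by rw [hα a ha]) (fun x hx => by exact_mod_cast hpar x hx) hxyw
  have h' : (2 * d + 3 : ℝ) * (2 * d + 2) * (∑ a ∈ Finset.range (d + 1),
        α a * (2 * d / 3 - (2 * a - d) ^ 2 / 6) + (2 * d + 1) / 6 * ∑ a ∈ Finset.range (d + 1), α a)
      = (∑ j ∈ Finset.range (d + 1), ((6 * j - (3 * d + 1) : ℝ)) ^ 2)
        * ∑ a ∈ Finset.range (d + 1), α a := by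
    apply Complex.ofReal_injective
    push_cast
    exact h
  have hS : ∑ a ∈ Finset.range (d + 1), α a * (2 * d / 3 - (2 * a - d) ^ 2 / 6) =
      2 * d / 3 * ∑ a ∈ Finset.range (d + 1), α a
        - (∑ a ∈ Finset.range (d + 1), α a * (2 * a - d) ^ 2) / 6 := by
    rw [Finset.mul_sum, Finset.sum_div, ← Finset.sum_sub_distrib]
    exact Finset.sum_congr rfl fun _ _ => by ring
  have hnn : 0 ≤ (2 * d + 3 : ℝ) * (2 * d + 2) * (∑ a ∈ Finset.range (d + 1),
        α a * (2 * d / 3 - (2 * a - d) ^ 2 / 6) +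
          (2 * d + 1) / 6 * ∑ a ∈ Finset.range (d + 1), α a) := by
    rw [h']
    exact mul_nonneg (Finset.sum_nonneg fun _ _ => sq_nonneg _)
      (Finset.sum_nonneg fun a _ => hpos a)
  have := nonneg_of_mul_nonneg_right hnn (by positivity)
  rw [hS] at this
  linarith

namespace AltCoeff

open MvPowerSeries Equiv

/-- The exponent with coordinates `b`. -/
noncomputable abbrev expo {n : ℕ} (b : Fin n → ℕ) : Fin n →₀ ℕ := Finsupp.equivFunOnFinite.symm b

theorem coeff_renameEquiv {n : ℕ} (τ : Perm (Fin n)) (b : Fin n → ℕ)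
    (f : MvPowerSeries (Fin n) ℤ) :
    coeff (expo b) (renameEquiv ℤ τ f) = coeff (expo (b ∘ τ)) f := by
  have h : expo b = Finsupp.embDomain τ.toEmbedding (expo (b ∘ τ)) := by
    ext i
    obtain ⟨j, rfl⟩ := τ.surjective i
    have := Finsupp.embDomain_apply_self τ.toEmbedding (expo (b ∘ τ)) j
    rw [Equiv.coe_toEmbedding] at this
    rw [this]
    rfl
  rw [h]
  exact coeff_embDomain_rename τ.toEmbedding f _

/-- The alternating sum of the coefficients of `f` at the exponents `i ↦ σ i + s`. -/
noncomputable def altCoeff (n s : ℕ) : MvPowerSeries (Fin n) ℤ →+ ℤ :=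
  AddMonoidHom.mk' (fun f => ∑ σ : Perm (Fin n),
    (Perm.sign σ : ℤ) * coeff (expo fun i => (σ i : ℕ) + s) f) fun f g => by
      simp [mul_add, Finset.sum_add_distrib]

theorem altCoeff_apply {n s : ℕ} (f : MvPowerSeries (Fin n) ℤ) :
    altCoeff n s f = ∑ σ : Perm (Fin n),
      (Perm.sign σ : ℤ) * coeff (expo fun i => (σ i : ℕ) + s) f := rfl

theorem altCoeff_zero_one : altCoeff 0 0 1 = 1 := by
  rw [altCoeff_apply]
  simp only [Finset.univ_unique, Finset.sum_singleton]
  rw [show (expo fun i : Fin 0 => ((default : Perm (Fin 0)) i : ℕ) + 0) = 0 from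
    Finsupp.ext fun i => i.elim0]
  simp [Subsingleton.elim (default : Perm (Fin 0)) 1]

theorem altCoeff_succ_prod_X_mul {n s : ℕ} (f : MvPowerSeries (Fin n) ℤ) :
    altCoeff n (s + 1) ((∏ i, X i) * f) = altCoeff n s f := by
  rw [altCoeff_apply, altCoeff_apply]
  refine Finset.sum_congr rfl fun σ _ => ?_
  have h1 : (∏ i : Fin n, X i : MvPowerSeries (Fin n) ℤ) = monomial (expo fun _ => 1) 1 := by
    have := monomial_eq (R := ℤ) (expo fun _ : Fin n => 1) (fun _ => 1)
    rw [Finsupp.prod_fintype _ _ (by simp), Finsupp.prod_fintype _ _ (by simp)] at this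
    simp only [one_pow, Finset.prod_const_one] at this
    rw [this]
    refine Finset.prod_congr rfl fun i _ => ?_
    rw [show (expo fun _ : Fin n => 1) i = 1 from rfl, pow_one]
    exact (one_smul ℤ _).symm
  have h2 : (expo fun i => (σ i : ℕ) + (s + 1)) =
      expo (fun _ => 1) + expo fun i => (σ i : ℕ) + s := by
    ext i
    simp; ring
  rw [h1, h2, coeff_add_monomial_mul, one_mul]

theorem altCoeff_renameEquiv {n s : ℕ} (τ : Perm (Fin n)) (f : MvPowerSeries (Fin n) ℤ) :
    altCoeff n s (renameEquiv ℤ τ f) = Perm.sign τ * altCoeff n s f := by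
  rw [altCoeff_apply, altCoeff_apply, Finset.mul_sum]
  refine Fintype.sum_equiv (Equiv.mulRight τ) _ _ fun σ => ?_
  rw [coeff_renameEquiv, Equiv.coe_mulRight, Perm.sign_mul, ← mul_assoc, Units.val_mul,
    mul_left_comm, ← mul_assoc]
  rw [mul_assoc ((Perm.sign σ : ℤˣ) : ℤ), ← Units.val_mul, Int.units_mul_self, Units.val_one,
    mul_one]
  rfl

theorem altCoeff_eq_zero_of_swap {n s : ℕ} {i j : Fin n} (hij : i ≠ j)
    {f : MvPowerSeries (Fin n) ℤ} (h : renameEquiv ℤ (swap i j) f = f) : altCoeff n s f = 0 := by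
  have := altCoeff_renameEquiv (s := s) (swap i j) f
  rw [h, Perm.sign_swap hij] at this
  simp at this
  omega

theorem expo_eq_of_le {n : ℕ} {b : Fin n → ℕ} (hinj : Function.Injective b)
    (hle : ∀ i, b i ≤ i) : ∀ i, b i = i := by
  have key : ∀ m, ∀ i : Fin n, (i : ℕ) = m → b i = i := by
    intro m
    induction m using Nat.strong_induction_on with
    | _ m ih =>
      intro i hi
      by_contra hne
      have hlt : b i < i := lt_of_le_of_ne (hle i) hne
      have := ih (b i) (hi ▸ hlt) ⟨b i, hlt.trans i.2⟩ rfl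
      have := congrArg Fin.val (hinj this)
      simp at this
      omega
  exact fun i => key i i rfl

/-- Symmetric series act on `altCoeff n 0` through their constant coefficient. -/
theorem altCoeff_symm_mul {n : ℕ} {h : MvPowerSeries (Fin n) ℤ}
    (hh : ∀ τ : Perm (Fin n), renameEquiv ℤ τ h = h) (f : MvPowerSeries (Fin n) ℤ) :
    altCoeff n 0 (h * f) = constantCoeff h * altCoeff n 0 f := by
  set A : MvPowerSeries (Fin n) ℤ → MvPowerSeries (Fin n) ℤ := fun f =>
    ∑ σ : Perm (Fin n), (Perm.sign σ : ℤ) • renameEquiv ℤ σ f with hA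
  set ρ : Fin n →₀ ℕ := expo fun i => (i : ℕ) with hρ
  have hcoeff : ∀ f, altCoeff n 0 f = coeff ρ (A f) := by
    intro f
    rw [altCoeff_apply, hA, map_sum]
    refine Finset.sum_congr rfl fun σ _ => ?_
    rw [map_zsmul, hρ, coeff_renameEquiv, smul_eq_mul]
    rfl
  have hmul : A (h * f) = h * A f := by
    simp only [hA, Finset.mul_sum, map_mul, hh, mul_smul_comm]
  have hanti : ∀ τ : Perm (Fin n), renameEquiv ℤ τ (A f) = (Perm.sign τ : ℤ) • A f := by
    intro τ
    simp only [hA, map_sum, map_zsmul, Finset.smul_sum]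
    refine Fintype.sum_equiv (Equiv.mulLeft τ) _ _ fun σ => ?_
    rw [Equiv.coe_mulLeft, Perm.sign_mul, smul_smul, Units.val_mul, ← mul_assoc, ← Units.val_mul,
      Int.units_mul_self, Units.val_one, one_mul]
    congr 1
    exact rename_rename (σ : Fin n → Fin n) (τ : Fin n → Fin n) f
  have hinj : ∀ b : Fin n → ℕ, ¬ Function.Injective b → coeff (expo b) (A f) = 0 := by
    intro b hb
    simp only [Function.Injective, not_forall] at hb
    obtain ⟨i, j, hbij, hij⟩ := hb
    have h1 := congrArg (coeff (expo b)) (hanti (swap i j))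
    have h2 : b ∘ swap i j = b := by
      funext t
      rw [Function.comp_apply, swap_apply_def]
      split_ifs with h h
      · rw [h, hbij]
      · rw [h, hbij]
      · rfl
    rw [coeff_renameEquiv, h2, Perm.sign_swap hij] at h1
    simp at h1
    omega
  rw [hcoeff, hcoeff, hmul, coeff_mul, Finset.sum_eq_single (0, ρ)]
  · simp
  · rintro ⟨a, b⟩ hab hne
    have hab : a + b = ρ := Finset.HasAntidiagonal.mem_antidiagonal.1 hab
    simp only
    by_cases hb : Function.Injective (b : Fin n → ℕ)
    · have hle : ∀ i, b i ≤ i := fun i => by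
        have := DFunLike.congr_fun hab i
        simp [hρ] at this
        omega
      have hbρ : b = ρ := Finsupp.ext fun i => expo_eq_of_le hb hle i
      have ha : a = 0 := by
        rw [hbρ] at hab
        exact add_eq_right.1 hab
      exact absurd (by rw [ha, hbρ]) hne
    · have : b = expo (b : Fin n → ℕ) := by ext; rfl
      rw [this, hinj _ hb, mul_zero]
  · intro hn
    exact absurd (by simp) hn

theorem altCoeff_X_pow_mul {n : ℕ} (i : Fin n) (f : MvPowerSeries (Fin n) ℤ) :
    altCoeff n 0 (X i ^ n * f) = 0 := by
  rw [altCoeff_apply]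
  refine Finset.sum_eq_zero fun σ _ => ?_
  rw [X_pow_dvd_iff.1 (Dvd.intro f rfl) _ (by simp), mul_zero]

/-- Expansion of `altCoeff` along the variable whose exponent is `0`. -/
theorem altCoeff_succ_expand {n : ℕ} (f : MvPowerSeries (Fin (n + 1)) ℤ) :
    altCoeff (n + 1) 0 f = ∑ m : Fin (n + 1),
      (-1) ^ (m : ℕ) * altCoeff n 1 (killCompl m.succAboveEmb f) := by
  rw [altCoeff_apply]
  simp_rw [altCoeff_apply, Finset.mul_sum]
  rw [← Fintype.sum_prod_type']
  symm
  have hinj : Function.Injective (fun p : Fin (n + 1) × Perm (Fin n) =>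
      Perm.decomposeFin.symm (0, p.2) * Fin.cycleRange p.1) := by
    rintro ⟨m, e⟩ ⟨m', e'⟩ h
    simp only at h
    have hm : m = m' := by
      have h1 := DFunLike.congr_fun h m
      rw [Perm.mul_apply, Perm.mul_apply, Fin.cycleRange_self,
        Perm.decomposeFin_symm_apply_zero] at h1
      have h2 : (0 : Fin (n + 1)) = Perm.decomposeFin.symm (0, e') 0 := by
        rw [Perm.decomposeFin_symm_apply_zero]
      rw [h2] at h1
      have h3 := (Perm.decomposeFin.symm (0, e')).injective h1
      rw [← Fin.cycleRange_self m'] at h3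
      exact ((Fin.cycleRange m').injective h3).symm
    subst hm
    have := Perm.decomposeFin.symm.injective (mul_right_cancel h)
    simp at this
    rw [this]
  refine Fintype.sum_bijective _ ((Fintype.bijective_iff_injective_and_card _).2 ⟨hinj, ?_⟩) _ _ ?_
  · simp [Fintype.card_perm, Nat.factorial_succ]
  · rintro ⟨m, e⟩
    have h1 : (Perm.sign (Perm.decomposeFin.symm (0, e) * Fin.cycleRange m) : ℤ) =
        (-1) ^ (m : ℕ) * Perm.sign e := by
      rw [Perm.sign_mul, Perm.decomposeFin.symm_sign, Fin.sign_cycleRange]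
      simp [mul_comm]
    rw [h1, mul_assoc, coeff_killCompl]
    congr 2
    refine congrArg (fun b => coeff b f) ?_
    ext t
    rcases Fin.eq_self_or_eq_succAbove m t with rfl | ⟨j, rfl⟩
    · rw [Finsupp.embDomain_of_notMem_range _ _ _ (by simp)]
      simp
    · have := Finsupp.embDomain_apply_self m.succAboveEmb (expo fun i => (e i : ℕ) + 1) j
      rw [show m.succAbove j = m.succAboveEmb j from rfl, this]
      simp [Fin.cycleRange_succAbove]

end AltCoeff

/-- The product of `1 - x p + x p * x q` over `p < q`. -/
def pairProd {R : Type*} [CommRing R] : ∀ {n : ℕ}, (Fin n → R) → R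
  | 0, _ => 1
  | n + 1, x => (∏ q : Fin n, (1 - x 0 + x 0 * x q.succ)) * pairProd fun i : Fin n => x i.succ

theorem map_pairProd {R S : Type*} [CommRing R] [CommRing S] (φ : R →+* S) {n : ℕ}
    (x : Fin n → R) : φ (pairProd x) = pairProd fun i => φ (x i) := by
  induction n with
  | zero => exact map_one φ
  | succ n ih =>
    simp only [pairProd, map_mul, map_prod, map_add, map_sub, map_one, ih]

theorem pairProd_snoc {R : Type*} [CommRing R] {n : ℕ} (x : Fin (n + 1) → R) :
    pairProd x = (pairProd fun i : Fin n => x i.castSucc) *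
      ∏ p : Fin n, (1 - x p.castSucc + x p.castSucc * x (Fin.last n)) := by
  induction n with
  | zero => simp [pairProd]
  | succ n ih =>
    rw [pairProd, ih]
    conv_rhs => rw [pairProd]
    rw [Fin.prod_univ_castSucc, Fin.prod_univ_succ]
    simp only [Fin.succ_last, Fin.castSucc_zero, ← Fin.succ_castSucc]
    ring

theorem pairProd_of_eq_one {R : Type*} [CommRing R] {n : ℕ} (m : Fin (n + 1))
    (x : Fin (n + 1) → R) (hx : x m = 1) :
    pairProd x = (∏ j : Fin n, if j.castSucc < m then 1 else x (m.succAbove j)) *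
      pairProd fun j => x (m.succAbove j) := by
  induction n with
  | zero => simp [pairProd]
  | succ n ih =>
    refine Fin.cases (fun hx => ?_) (fun m hx => ?_) m hx
    · rw [pairProd, hx]
      simp
    · rw [pairProd, ih m _ hx, Fin.prod_univ_succAbove _ m, hx]
      conv_rhs => rw [Fin.prod_univ_succ, pairProd]
      simp only [Fin.castSucc_zero, Fin.succ_pos, if_true, Fin.succ_succAbove_zero,
        Fin.succ_succAbove_succ, ← Fin.succ_castSucc, Fin.succ_lt_succ_iff]
      ring

theorem pairProd_swap {R : Type*} [CommRing R] {n : ℕ} (i : Fin n) (x : Fin (n + 1) → R) :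
    pairProd x * (1 - x i.succ + x i.succ * x i.castSucc) =
      (pairProd fun j => x (Equiv.swap i.castSucc i.succ j)) *
        (1 - x i.castSucc + x i.castSucc * x i.succ) := by
  induction n with
  | zero => exact i.elim0
  | succ n ih =>
    refine Fin.cases ?_ (fun i => ?_) i
    · have h : ∀ j : Fin n, Equiv.swap (0 : Fin (n + 2)) 1 j.succ.succ = j.succ.succ := fun j =>
        Equiv.swap_apply_of_ne_of_ne (Fin.succ_ne_zero _) (by
          rw [← Fin.succ_zero_eq_one, Ne, Fin.succ_inj]; exact Fin.succ_ne_zero _)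
      simp only [pairProd, Fin.prod_univ_succ (n := n), Fin.castSucc_zero, Fin.succ_zero_eq_one,
        Equiv.swap_apply_left, Equiv.swap_apply_right, h]
      ring
    · have h0 : Equiv.swap i.succ.castSucc i.succ.succ 0 = 0 :=
        Equiv.swap_apply_of_ne_of_ne (by rw [← Fin.succ_castSucc]; exact (Fin.succ_ne_zero _).symm)
          (Fin.succ_ne_zero _).symm
      have h1 : ∀ j : Fin (n + 1), Equiv.swap i.succ.castSucc i.succ.succ j.succ =
          (Equiv.swap i.castSucc i.succ j).succ := fun j => by
        rw [← Fin.succ_castSucc]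
        exact ((Fin.succ_injective _).map_swap _ _ j).symm
      have hprod : ∏ q : Fin (n + 1), (1 - x 0 + x 0 * x (Equiv.swap i.castSucc i.succ q).succ) =
          ∏ q : Fin (n + 1), (1 - x 0 + x 0 * x q.succ) :=
        Equiv.prod_comp (Equiv.swap i.castSucc i.succ) fun q => 1 - x 0 + x 0 * x q.succ
      have := ih i fun j => x j.succ
      rw [pairProd, mul_assoc, ← Fin.succ_castSucc, this]
      conv_rhs => rw [pairProd]
      rw [← Fin.succ_castSucc] at h0 h1
      simp only [h0, h1, hprod]
      rw [mul_assoc]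

open Classical in
/-- The strictly increasing rows interlacing with `k`. -/
noncomputable def rowsBelow {n : ℕ} (k : Fin (n + 1) → ℤ) : Finset (Fin n → ℤ) :=
  (Fintype.piFinset fun i => Finset.Icc (k i.castSucc) (k i.succ)).filter StrictMono

theorem mem_rowsBelow {n : ℕ} {k : Fin (n + 1) → ℤ} {l : Fin n → ℤ} :
    l ∈ rowsBelow k ↔ StrictMono l ∧ Interlaces l k := by
  simp [rowsBelow, Interlaces, and_comm]

theorem strictMono_cons {n : ℕ} (a : ℤ) (l : Fin (n + 1) → ℤ) :
    StrictMono (Fin.cons a l : Fin (n + 2) → ℤ) ↔ a < l 0 ∧ StrictMono l := by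
  rw [Fin.strictMono_iff_lt_succ, Fin.strictMono_iff_lt_succ, Fin.forall_fin_succ]
  simp

theorem interlaces_cons {n : ℕ} (a b : ℤ) (l : Fin n → ℤ) (k : Fin (n + 1) → ℤ) :
    Interlaces (Fin.cons a l : Fin (n + 1) → ℤ) (Fin.cons b k : Fin (n + 2) → ℤ) ↔
      (b ≤ a ∧ a ≤ k 0) ∧ Interlaces l k := by
  unfold Interlaces
  rw [Fin.forall_fin_succ]
  simp

theorem sum_rowsBelow_cons_cons {n : ℕ} {b c : ℤ} {k : Fin (n + 1) → ℤ}
    (hk : StrictMono (Fin.cons b (Fin.cons c k : Fin (n + 2) → ℤ) : Fin (n + 3) → ℤ))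
    (F : (Fin (n + 2) → ℤ) → ℤ) :
    ∑ l ∈ rowsBelow (Fin.cons b (Fin.cons c k : Fin (n + 2) → ℤ) : Fin (n + 3) → ℤ), F l =
      ∑ l ∈ rowsBelow (Fin.cons c k : Fin (n + 2) → ℤ), ∑ a ∈ Finset.Icc b c, F (Fin.cons a l) -
      ∑ l ∈ rowsBelow k, F (Fin.cons c (Fin.cons c l : Fin (n + 1) → ℤ)) := by
  classical
  rw [eq_sub_iff_add_eq, Finset.sum_sigma', ← Finset.sum_filter_add_sum_filter_not
    ((rowsBelow (Fin.cons c k : Fin (n + 2) → ℤ)).sigma fun _ => Finset.Icc b c)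
    (fun p => p.2 < p.1 0)]
  obtain ⟨hbc, hk'⟩ := (strictMono_cons _ _).1 hk
  obtain ⟨hck, hk''⟩ := (strictMono_cons _ _).1 hk'
  simp only [Fin.cons_zero] at hbc
  congr 1
  · refine Finset.sum_bij' (fun l _ => ⟨fun i => l i.succ, l 0⟩) (fun p _ => Fin.cons p.2 p.1)
      ?_ ?_ ?_ ?_ ?_
    · intro l hl
      obtain ⟨a, l, rfl⟩ : ∃ a l', l = Fin.cons a l' := ⟨l 0, fun i => l i.succ,
        (Fin.cons_self_tail l).symm⟩
      rw [mem_rowsBelow, strictMono_cons, interlaces_cons] at hl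
      simp [mem_rowsBelow, hl]
      simpa using hl.2.1.2
    · rintro ⟨l, a⟩ hp
      simp [mem_rowsBelow] at hp
      rw [mem_rowsBelow, strictMono_cons, interlaces_cons]
      simp [hp]
    · intro l _
      exact Fin.cons_self_tail l
    · intro p _
      simp
    · intro l _
      simp only
      congr 1
      exact (Fin.cons_self_tail l).symm
  · refine Finset.sum_bij' (fun l _ => ⟨Fin.cons c l, c⟩) (fun p _ => fun i => p.1 i.succ)
      ?_ ?_ ?_ ?_ ?_
    · intro l hl
      rw [mem_rowsBelow] at hl
      simp only [Finset.mem_filter, Finset.mem_sigma, mem_rowsBelow, interlaces_cons,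
        Finset.mem_Icc, Fin.cons_zero, lt_irrefl, not_false_iff, and_true]
      refine ⟨⟨Fin.strictMono_cons.2 ⟨fun j => ?_, hl.1⟩, ⟨le_rfl, hck.le⟩, hl.2⟩, hbc.le, le_rfl⟩
      exact hck.trans_le ((hk''.monotone (Fin.zero_le _)).trans (hl.2 j).1)
    · rintro ⟨l, a⟩ hp
      obtain ⟨e, l, rfl⟩ : ∃ a l', l = Fin.cons a l' := ⟨l 0, fun i => l i.succ,
        (Fin.cons_self_tail l).symm⟩
      simp only [Finset.mem_filter, Finset.mem_sigma, mem_rowsBelow, interlaces_cons] at hp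
      simp only [Fin.cons_succ, mem_rowsBelow]
      exact ⟨(Fin.strictMono_cons.1 hp.1.1.1).2, hp.1.1.2.2⟩
    · intro l _
      simp
    · rintro ⟨l, a⟩ hp
      obtain ⟨e, l, rfl⟩ : ∃ a l', l = Fin.cons a l' := ⟨l 0, fun i => l i.succ,
        (Fin.cons_self_tail l).symm⟩
      simp only [Finset.mem_filter, Finset.mem_sigma, mem_rowsBelow, interlaces_cons,
        Finset.mem_Icc, Fin.cons_zero, not_lt] at hp
      obtain ⟨⟨⟨-, ⟨h1, -⟩, -⟩, -, h2⟩, h3⟩ := hp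
      obtain rfl : a = c := le_antisymm h2 (h1.trans h3)
      obtain rfl : e = a := le_antisymm h3 h1
      simp
    · intro l _
      rfl

/-- The mixed forward difference in all variables. -/
def mixedDiff : ∀ n : ℕ, ((Fin n → ℤ) → ℤ) → (Fin n → ℤ) → ℤ
  | 0, G, l => G l
  | n + 1, G, l => mixedDiff n (fun x => G (Fin.cons (l 0 + 1) x)) (fun i => l i.succ) -
      mixedDiff n (fun x => G (Fin.cons (l 0) x)) fun i => l i.succ

/-- The boundary condition under which summing a mixed difference over interlacing strict rows
telescopes. -/
def Telescopes : ∀ n : ℕ, ((Fin n → ℤ) → ℤ) → Prop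
  | 0, _ => True
  | 1, _ => True
  | n + 2, G => (∀ (a : ℤ) (l : Fin n → ℤ),
      G (Fin.cons a (Fin.cons a l : Fin (n + 1) → ℤ)) -
        G (Fin.cons a (Fin.cons (a + 1) l : Fin (n + 1) → ℤ)) +
        G (Fin.cons (a + 1) (Fin.cons (a + 1) l : Fin (n + 1) → ℤ)) = 0) ∧
      ∀ a : ℤ, Telescopes (n + 1) fun l => G (Fin.cons a l)

theorem Telescopes.cons {n : ℕ} {G : (Fin (n + 1) → ℤ) → ℤ} (hG : Telescopes (n + 1) G) (a : ℤ) :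
    Telescopes n fun l => G (Fin.cons a l) := by
  cases n with
  | zero => trivial
  | succ n => exact hG.2 a

theorem Telescopes.neg {n : ℕ} {G : (Fin n → ℤ) → ℤ} (hG : Telescopes n G) :
    Telescopes n fun l => -G l := by
  induction n with
  | zero => trivial
  | succ n ih =>
    cases n with
    | zero => trivial
    | succ n => exact ⟨fun a l => by linarith [hG.1 a l], fun a => ih (hG.2 a)⟩

theorem mixedDiff_sub {n : ℕ} (G H : (Fin n → ℤ) → ℤ) (l : Fin n → ℤ) :
    mixedDiff n (fun x => G x - H x) l = mixedDiff n G l - mixedDiff n H l := by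
  induction n with
  | zero => rfl
  | succ n ih =>
    simp only [mixedDiff, ih]
    ring

/-- The row `k` with the entry `m` deleted and all later entries raised by one. -/
def deleteRaise {n : ℕ} (k : Fin (n + 1) → ℤ) (m : Fin (n + 1)) (i : Fin n) : ℤ :=
  if i.castSucc < m then k i.castSucc else k i.succ + 1

theorem deleteRaise_cons_zero {n : ℕ} (a : ℤ) (k : Fin n → ℤ) :
    deleteRaise (Fin.cons a k : Fin (n + 1) → ℤ) 0 = fun i => k i + 1 := by
  funext i
  simp [deleteRaise]

theorem deleteRaise_cons_succ {n : ℕ} (a : ℤ) (k : Fin (n + 1) → ℤ) (m : Fin (n + 1)) :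
    deleteRaise (Fin.cons a k : Fin (n + 2) → ℤ) m.succ = Fin.cons a (deleteRaise k m) := by
  funext i
  refine Fin.cases ?_ (fun i => ?_) i
  · simp [deleteRaise]
  · simp [deleteRaise]

theorem sum_Icc_int_sub (f : ℤ → ℤ) {b c : ℤ} (h : b ≤ c) :
    ∑ a ∈ Finset.Icc b c, (f (a + 1) - f a) = f (c + 1) - f b := by
  induction c, h using Int.leInduction with
  | base => simp
  | succ c hc ih =>
    have h1 : Finset.Icc b (c + 1) = insert (c + 1) (Finset.Icc b c) := by
      ext x
      simp only [Finset.mem_Icc, Finset.mem_insert]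
      omega
    rw [h1, Finset.sum_insert (by simp), ih]
    ring

theorem sum_rowsBelow_mixedDiff {n : ℕ} {k : Fin (n + 1) → ℤ} (hk : StrictMono k)
    {G : (Fin n → ℤ) → ℤ} (hG : Telescopes n G) :
    ∑ l ∈ rowsBelow k, mixedDiff n G l =
      ∑ m : Fin (n + 1), (-1) ^ (m : ℕ) * G (deleteRaise k m) := by
  induction n using Nat.strong_induction_on with
  | _ n ih =>
  match n with
  | 0 =>
    have h : rowsBelow k = {default} := by
      ext l
      simp only [mem_rowsBelow, Finset.mem_singleton, Subsingleton.elim l default, iff_true]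
      exact ⟨fun i => i.elim0, fun i => i.elim0⟩
    rw [h]
    simp [mixedDiff]
    congr 1
    exact Subsingleton.elim _ _
  | 1 =>
    have h : ∑ l ∈ rowsBelow k, mixedDiff 1 G l =
        ∑ a ∈ Finset.Icc (k 0) (k 1), (G (fun _ => a + 1) - G fun _ => a) := by
      refine Finset.sum_bij' (fun l _ => l 0) (fun a _ _ => a) ?_ ?_ ?_ ?_ ?_
      · intro l hl
        exact Finset.mem_Icc.2 ((mem_rowsBelow.1 hl).2 0)
      · intro a ha
        refine mem_rowsBelow.2 ⟨Subsingleton.strictMono _, fun i => ?_⟩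
        obtain rfl := Subsingleton.elim i 0
        exact Finset.mem_Icc.1 ha
      · intro l _
        funext i
        rw [Subsingleton.elim i 0]
      · intro a _
        rfl
      · intro l _
        simp only [mixedDiff]
        congr 2 <;>
        · funext i
          match i with
          | 0 => rfl
    rw [h, sum_Icc_int_sub (fun a => G fun _ => a) (hk.monotone (by simp)), Fin.sum_univ_two]
    have h0 : deleteRaise k 0 = fun _ => k 1 + 1 := by
      funext i
      rw [Subsingleton.elim i 0]
      rfl
    have h1 : deleteRaise k 1 = fun _ => k 0 := by
      funext i
      rw [Subsingleton.elim i 0]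
      rfl
    rw [h0, h1]
    simp
    ring
  | n + 2 =>
    obtain ⟨b, c, k, rfl⟩ : ∃ b c k', k = Fin.cons b (Fin.cons c k' : Fin (n + 2) → ℤ) :=
      ⟨k 0, k 1, fun i => k i.succ.succ, by
        funext i
        refine Fin.cases rfl (fun i => ?_) i
        refine Fin.cases rfl (fun i => rfl) i⟩
    obtain ⟨hbc, hk'⟩ := (strictMono_cons _ _).1 hk
    obtain ⟨hck, hk''⟩ := (strictMono_cons _ _).1 hk'
    rw [Fin.cons_zero] at hbc
    have e1 : ∀ l : Fin (n + 1) → ℤ,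
        ∑ a ∈ Finset.Icc b c, mixedDiff (n + 2) G (Fin.cons a l) =
          mixedDiff (n + 1) (fun x => G (Fin.cons (c + 1) x)) l -
            mixedDiff (n + 1) (fun x => G (Fin.cons b x)) l := fun l => by
      rw [← sum_Icc_int_sub (fun a => mixedDiff (n + 1) (fun x => G (Fin.cons a x)) l) hbc.le]
      refine Finset.sum_congr rfl fun a _ => ?_
      rw [mixedDiff]
      simp only [Fin.cons_zero, Fin.cons_succ]
    have e2 : ∀ l : Fin n → ℤ,
        mixedDiff (n + 2) G (Fin.cons c (Fin.cons c l : Fin (n + 1) → ℤ)) =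
          mixedDiff n (fun x => -G (Fin.cons (c + 1) (Fin.cons c x : Fin (n + 1) → ℤ))) l :=
      fun l => by
      simp only [mixedDiff, Fin.cons_zero, Fin.cons_succ, ← mixedDiff_sub]
      congr 1
      funext x
      linarith [hG.1 c x]
    rw [sum_rowsBelow_cons_cons hk, Finset.sum_congr rfl fun l _ => e1 l,
      Finset.sum_congr rfl fun l _ => e2 l, Finset.sum_sub_distrib,
      ih (n + 1) (by omega) hk' (hG.cons _), ih (n + 1) (by omega) hk' (hG.cons _),
      ih n (by omega) hk'' ((hG.cons _).cons _).neg, Fin.sum_univ_succ (n := n + 2),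
      Fin.sum_univ_succ (n := n + 1) (f := fun m => (-1) ^ (m : ℕ) *
        G (Fin.cons (c + 1) (deleteRaise (Fin.cons c k : Fin (n + 2) → ℤ) m)))]
    simp only [deleteRaise_cons_succ, deleteRaise_cons_zero, Fin.val_zero, pow_zero, one_mul,
      Fin.val_succ, pow_succ, mul_neg, mul_one, neg_mul, Finset.sum_neg_distrib]
    have e3 : (fun i => (Fin.cons c k : Fin (n + 2) → ℤ) i + 1) =
        Fin.cons (c + 1) fun i => k i + 1 := by
      funext i
      refine Fin.cases rfl (fun i => rfl) i
    rw [e3]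
    ring

theorem mixedDiff_prod_zpow {R : Type*} [CommRing R] (φ : R →+ ℤ) {n : ℕ} (u : Fin n → Rˣ)
    (f : R) (l : Fin n → ℤ) :
    mixedDiff n (fun k => φ (↑(∏ i, u i ^ k i) * f)) l =
      φ (↑(∏ i, u i ^ l i) * ((∏ i, ((u i : R) - 1)) * f)) := by
  induction n generalizing f with
  | zero => simp [mixedDiff]
  | succ n ih =>
    have h : ∀ (a : ℤ) (x : Fin n → ℤ),
        ((∏ i, u i ^ (Fin.cons a x : Fin (n + 1) → ℤ) i : Rˣ) : R) * f =
          ↑(∏ i : Fin n, u i.succ ^ x i) * (↑(u 0 ^ a) * f) := fun a x => by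
      rw [Fin.prod_univ_succ]
      simp only [Fin.cons_zero, Fin.cons_succ, Units.val_mul]
      ring
    simp only [mixedDiff, h]
    rw [ih, ih, ← map_sub, Fin.prod_univ_succ, Fin.prod_univ_succ, zpow_add_one]
    congr 1
    push_cast
    ring

theorem telescopes_prod_zpow {R : Type*} [CommRing R] (φ : R →+ ℤ) {n : ℕ} (u : Fin n → Rˣ)
    (f : R) (h : ∀ (k : Fin n → ℤ) (i j : Fin n), (i : ℕ) + 1 = j → k i = k j →
      φ (↑(∏ i, u i ^ k i) * ((1 - (u j : R) + u i * u j) * f)) = 0) :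
    Telescopes n fun k => φ (↑(∏ i, u i ^ k i) * f) := by
  induction n generalizing f with
  | zero => trivial
  | succ n ih =>
    have hc : ∀ (a : ℤ) (x : Fin n → ℤ),
        ((∏ i, u i ^ (Fin.cons a x : Fin (n + 1) → ℤ) i : Rˣ) : R) =
          ↑(∏ i : Fin n, u i.succ ^ x i) * ↑(u 0 ^ a) := fun a x => by
      rw [Fin.prod_univ_succ]
      simp only [Fin.cons_zero, Fin.cons_succ, Units.val_mul]
      ring
    cases n with
    | zero => trivial
    | succ n =>
      refine ⟨fun a l => ?_, fun a => ?_⟩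
      · rw [← h (Fin.cons a (Fin.cons a l : Fin (n + 1) → ℤ)) 0 1 (by simp) rfl, ← map_sub,
          ← map_add]
        congr 1
        simp only [hc]
        rw [Fin.prod_univ_succ, Fin.prod_univ_succ]
        simp only [Fin.cons_zero, Fin.cons_succ, Fin.succ_zero_eq_one, zpow_add_one]
        push_cast
        ring
      · simp only [hc, mul_assoc]
        refine ih (fun i => u i.succ) _ fun k i j hij hk => ?_
        rw [← h (Fin.cons a k) i.succ j.succ (by simpa using hij) (by simpa using hk)]
        congr 1
        rw [hc]
        ring

section

open MvPowerSeries Equiv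

/-- The unit `1 + X i`. -/
noncomputable def onePlusX {n : ℕ} (i : Fin n) : (MvPowerSeries (Fin n) ℤ)ˣ :=
  IsUnit.unit (a := 1 + X i) (isUnit_iff_constantCoeff.2 (by simp))

theorem val_onePlusX {n : ℕ} (i : Fin n) :
    (onePlusX i : MvPowerSeries (Fin n) ℤ) = 1 + X i := rfl

theorem rename_onePlusX {n : ℕ} (τ : Perm (Fin n)) (i : Fin n) :
    renameEquiv ℤ τ (onePlusX i : MvPowerSeries (Fin n) ℤ) = onePlusX (τ i) := by
  rw [val_onePlusX, val_onePlusX, map_add, map_one]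
  exact congrArg _ (rename_X _ _)

theorem map_onePlusX {n : ℕ} (τ : Perm (Fin n)) (i : Fin n) :
    Units.map (renameEquiv ℤ τ : MvPowerSeries (Fin n) ℤ →* MvPowerSeries (Fin n) ℤ)
      (onePlusX i) = onePlusX (τ i) :=
  Units.ext (rename_onePlusX τ i)

/-- The monomial with exponents `k` in the units `1 + X i`. -/
noncomputable def shiftedMonomial {n : ℕ} (k : Fin n → ℤ) : MvPowerSeries (Fin n) ℤ :=
  ↑(∏ i, onePlusX i ^ k i : (MvPowerSeries (Fin n) ℤ)ˣ)

theorem shiftedMonomial_add {n : ℕ} (k l : Fin n → ℤ) :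
    shiftedMonomial (k + l) = shiftedMonomial k * shiftedMonomial l := by
  rw [shiftedMonomial, shiftedMonomial, shiftedMonomial, ← Units.val_mul, ← Finset.prod_mul_distrib]
  simp only [Pi.add_apply, zpow_add]

theorem rename_shiftedMonomial {n : ℕ} (τ : Perm (Fin n)) (k : Fin n → ℤ) :
    renameEquiv ℤ τ (shiftedMonomial fun i => k (τ i)) = shiftedMonomial k := by
  have h : Units.map (renameEquiv ℤ τ : MvPowerSeries (Fin n) ℤ →* MvPowerSeries (Fin n) ℤ)
      (∏ i, onePlusX i ^ k (τ i)) = ∏ i, onePlusX i ^ k i := by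
    rw [map_prod, ← Equiv.prod_comp τ fun i => onePlusX i ^ k i]
    simp only [map_zpow, map_onePlusX]
  exact congrArg Units.val h

/-- The antisymmetrised coefficient that counts patterns with top row `k`
(for `s = 0`) and its one-step telescoping potential (for `s = 1`). -/
noncomputable def countCoeff (n s : ℕ) (k : Fin n → ℤ) : ℤ :=
  AltCoeff.altCoeff n s (shiftedMonomial k *
    pairProd fun i : Fin n => (onePlusX i : MvPowerSeries (Fin n) ℤ))

theorem mixedDiff_countCoeff {n : ℕ} (l : Fin n → ℤ) :
    mixedDiff n (countCoeff n 1) l = countCoeff n 0 l := by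
  refine (mixedDiff_prod_zpow _ _ _ l).trans ?_
  rw [countCoeff, ← AltCoeff.altCoeff_succ_prod_X_mul (s := 0)]
  congr 1
  simp only [shiftedMonomial, val_onePlusX, add_sub_cancel_left]
  ring

theorem telescopes_countCoeff (n s : ℕ) : Telescopes n (countCoeff n s) := by
  refine telescopes_prod_zpow _ _ _ fun k i j hij hk => ?_
  refine AltCoeff.altCoeff_eq_zero_of_swap (i := i) (j := j) (by rintro rfl; omega) ?_
  cases n with
  | zero => exact i.elim0
  | succ n =>
    obtain ⟨i, rfl⟩ : ∃ i' : Fin n, i = i'.castSucc := ⟨⟨i, by omega⟩, rfl⟩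
    obtain rfl : j = i.succ := Fin.ext (by simpa using hij.symm)
    have h1 := rename_shiftedMonomial (swap i.castSucc i.succ) k
    have h2 : (fun m => k (swap i.castSucc i.succ m)) = k := by
      funext m
      rw [swap_apply_def]
      split_ifs with h h
      · rw [h, hk]
      · rw [h, hk]
      · rfl
    rw [h2] at h1
    have h3 := pairProd_swap i fun m => (onePlusX m : MvPowerSeries (Fin (n + 1)) ℤ)
    rw [map_mul]
    refine congrArg₂ _ h1 ?_
    refine Eq.trans ?_ (show (1 - (onePlusX i.castSucc : MvPowerSeries (Fin (n + 1)) ℤ) +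
      (onePlusX i.succ : MvPowerSeries (Fin (n + 1)) ℤ) * onePlusX i.castSucc) * (pairProd fun m =>
        (onePlusX (swap i.castSucc i.succ m) : MvPowerSeries (Fin (n + 1)) ℤ)) = _ by
      linear_combination -h3)
    have h4 := (map_pairProd (renameEquiv ℤ (swap i.castSucc i.succ) :
      MvPowerSeries (Fin (n + 1)) ℤ →+* MvPowerSeries (Fin (n + 1)) ℤ)
        fun m : Fin (n + 1) => (onePlusX m : MvPowerSeries (Fin (n + 1)) ℤ))
    simp only [RingHom.coe_coe, rename_onePlusX] at h4
    simp only [map_mul, map_add, map_sub, map_one, rename_onePlusX, swap_apply_left,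
      swap_apply_right]
    exact congrArg _ h4

theorem killCompl_X_self {n : ℕ} (m : Fin (n + 1)) :
    killCompl m.succAboveEmb (X m : MvPowerSeries (Fin (n + 1)) ℤ) = 0 := by
  refine killCompl_monomial_eq_zero _ ?_
  rintro ⟨x, hx⟩
  have h := DFunLike.congr_fun hx m
  rw [Finsupp.single_eq_same, Finsupp.embDomain_of_notMem_range] at h
  · exact zero_ne_one h
  · simp

theorem killCompl_X_succAbove {n : ℕ} (m : Fin (n + 1)) (j : Fin n) :
    killCompl m.succAboveEmb (X (m.succAbove j) : MvPowerSeries (Fin (n + 1)) ℤ) = X j := by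
  refine Eq.trans ?_ (killCompl_monomial_embDomain (e := m.succAboveEmb) (Finsupp.single j 1) 1)
  rw [Finsupp.embDomain_single]
  rfl

theorem countCoeff_succ {n : ℕ} (k : Fin (n + 1) → ℤ) :
    countCoeff (n + 1) 0 k =
      ∑ m : Fin (n + 1), (-1) ^ (m : ℕ) * countCoeff n 1 (deleteRaise k m) := by
  rw [countCoeff, AltCoeff.altCoeff_succ_expand]
  refine Finset.sum_congr rfl fun m _ => ?_
  rw [countCoeff]
  congr 2
  have h1 : killCompl m.succAboveEmb (onePlusX m : MvPowerSeries (Fin (n + 1)) ℤ) = 1 := by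
    rw [val_onePlusX, map_add, map_one, killCompl_X_self, add_zero]
  have h2 : ∀ j, killCompl m.succAboveEmb
      (onePlusX (m.succAbove j) : MvPowerSeries (Fin (n + 1)) ℤ) = onePlusX j := fun j => by
    rw [val_onePlusX, map_add, map_one, killCompl_X_succAbove, val_onePlusX]
  have h3 : killCompl m.succAboveEmb (shiftedMonomial k : MvPowerSeries (Fin (n + 1)) ℤ) =
      ↑(∏ j, onePlusX j ^ k (m.succAbove j) : (MvPowerSeries (Fin n) ℤ)ˣ) := by
    set φ := Units.map (killCompl (R := ℤ) m.succAboveEmb :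
        MvPowerSeries (Fin (n + 1)) ℤ →* MvPowerSeries (Fin n) ℤ)
    have e1 : φ (onePlusX m) = 1 := Units.ext h1
    have e2 : ∀ j, φ (onePlusX (m.succAbove j)) = onePlusX j := fun j => Units.ext (h2 j)
    have : φ (∏ i, onePlusX i ^ k i) = ∏ j, onePlusX j ^ k (m.succAbove j) := by
      rw [map_prod, Fin.prod_univ_succAbove _ m]
      simp only [map_zpow, e1, e2, one_zpow, one_mul]
    exact congrArg Units.val this
  have h4 := (map_pairProd (killCompl (R := ℤ) m.succAboveEmb : MvPowerSeries (Fin (n + 1)) ℤ →+*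
    MvPowerSeries (Fin n) ℤ) fun i : Fin (n + 1) => (onePlusX i : MvPowerSeries (Fin (n + 1)) ℤ))
  rw [map_mul, h3]
  refine (congrArg (_ * ·) (h4.trans (pairProd_of_eq_one m _ h1))).trans ?_
  simp only [RingHom.coe_coe, h2]
  rw [← mul_assoc]
  congr 1
  rw [shiftedMonomial]
  push_cast
  rw [← Finset.prod_mul_distrib]
  refine Finset.prod_congr rfl fun j _ => ?_
  unfold deleteRaise Fin.succAbove
  split_ifs
  · rw [mul_one]
  · rw [zpow_add_one, Units.val_mul]

/-- The weighted number of arrays of strict interlacing rows below the top row. -/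
noncomputable def patternSum (w : ∀ n : ℕ, (Fin n → ℤ) → ℤ) : ∀ n : ℕ, (Fin n → ℤ) → ℤ
  | 0, _ => 1
  | n + 1, k => ∑ l ∈ rowsBelow k, w n l * patternSum w n l

theorem patternSum_one {n : ℕ} {k : Fin n → ℤ} (hk : StrictMono k) :
    patternSum (fun _ _ => 1) n k = countCoeff n 0 k := by
  induction n with
  | zero =>
    rw [countCoeff, shiftedMonomial, pairProd]
    simp [patternSum, AltCoeff.altCoeff_zero_one]
  | succ n ih =>
    rw [countCoeff_succ, ← sum_rowsBelow_mixedDiff hk (telescopes_countCoeff n 1), patternSum]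
    refine Finset.sum_congr rfl fun l hl => ?_
    rw [mixedDiff_countCoeff, one_mul, ih (mem_rowsBelow.1 hl).1]

end

section

open MvPowerSeries Equiv

theorem renameEquiv_coe_esymm {n : ℕ} (j : ℕ) (τ : Perm (Fin n)) :
    renameEquiv ℤ τ (MvPolynomial.esymm (Fin n) ℤ j : MvPowerSeries (Fin n) ℤ) =
      MvPolynomial.esymm (Fin n) ℤ j :=
  (rename_coe _ _).trans (congrArg _ (MvPolynomial.rename_esymm _ _ _ _))

theorem coe_esymm {n : ℕ} (j : ℕ) :
    (MvPolynomial.esymm (Fin n) ℤ j : MvPowerSeries (Fin n) ℤ) =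
      ∑ t ∈ Finset.powersetCard j Finset.univ, ∏ i ∈ t, X i := by
  rw [← MvPolynomial.coeToMvPowerSeries.ringHom_apply, MvPolynomial.esymm, map_sum]
  simp only [map_prod, MvPolynomial.coeToMvPowerSeries.ringHom_apply, MvPolynomial.coe_X]

theorem altCoeff_prod_add_mul {n : ℕ} (A B f : MvPowerSeries (Fin n) ℤ) :
    AltCoeff.altCoeff n 0 ((∏ q : Fin n, (A + B * onePlusX q)) * f) =
      AltCoeff.altCoeff n 0 ((A + B) ^ n * f) := by
  have h : ∏ q : Fin n, (A + B * (onePlusX q : MvPowerSeries (Fin n) ℤ)) =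
      ∑ j ∈ Finset.range (n + 1),
        (MvPolynomial.esymm (Fin n) ℤ j : MvPowerSeries (Fin n) ℤ) *
          (B ^ j * (A + B) ^ (n - j)) := by
    have h1 : ∀ q : Fin n, A + B * (onePlusX q : MvPowerSeries (Fin n) ℤ) =
        B * X q + (A + B) := fun q => by
      rw [val_onePlusX]
      ring
    simp only [h1]
    rw [Finset.prod_add, Finset.sum_powerset, Finset.card_univ, Fintype.card_fin]
    refine Finset.sum_congr rfl fun j _ => ?_
    rw [coe_esymm, Finset.sum_mul]
    refine Finset.sum_congr rfl fun t ht => ?_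
    rw [Finset.mem_powersetCard] at ht
    rw [Finset.prod_mul_distrib, Finset.prod_const, Finset.prod_const,
      Finset.card_sdiff_of_subset ht.1, ht.2, Finset.card_univ, Fintype.card_fin]
    ring
  rw [h, Finset.sum_mul, map_sum, Finset.sum_range_succ']
  have h0 : ∀ j ∈ Finset.range n, AltCoeff.altCoeff n 0
      ((MvPolynomial.esymm (Fin n) ℤ (j + 1) : MvPowerSeries (Fin n) ℤ) *
          (B ^ (j + 1) * (A + B) ^ (n - (j + 1))) * f) = 0 := fun j _ => by
    rw [mul_assoc, AltCoeff.altCoeff_symm_mul (renameEquiv_coe_esymm _), coe_esymm, map_sum,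
      Finset.sum_eq_zero, zero_mul]
    intro t ht
    rw [Finset.mem_powersetCard] at ht
    obtain ⟨i, hi⟩ := Finset.card_pos.1 (show 0 < t.card by omega)
    rw [map_prod]
    exact Finset.prod_eq_zero hi (constantCoeff_X i)
  rw [Finset.sum_eq_zero h0]
  simp

theorem countCoeff_add_const {n : ℕ} (k : Fin n → ℤ) (c : ℤ) :
    countCoeff n 0 (fun i => k i + c) = countCoeff n 0 k := by
  have h : (fun i => k i + c) = (fun _ => c) + k := by
    funext i
    exact add_comm _ _
  have h1 : constantCoeff (shiftedMonomial fun _ : Fin n => c) = 1 := by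
    have : Units.map (constantCoeff (σ := Fin n) (R := ℤ)).toMonoidHom
        (∏ i, onePlusX i ^ c) = 1 := by
      rw [map_prod]
      refine Finset.prod_eq_one fun i _ => ?_
      rw [map_zpow, show Units.map _ (onePlusX i) = 1 from
        Units.ext (show constantCoeff (1 + X i : MvPowerSeries (Fin n) ℤ) = 1 by simp), one_zpow]
    exact congrArg Units.val this
  rw [countCoeff, h, shiftedMonomial_add, mul_assoc, AltCoeff.altCoeff_symm_mul
    fun τ => rename_shiftedMonomial τ fun _ => c, h1, one_mul, countCoeff]

theorem countCoeff_snoc {m : ℕ} (a : ℤ) (l : Fin m → ℤ) :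
    countCoeff (m + 1) 0 (Fin.snoc l (a - (m + 1)) : Fin (m + 1) → ℤ) =
      (-1) ^ m * countCoeff (m + 1) 0 (Fin.cons a l) := by
  set x : Fin (m + 1) → MvPowerSeries (Fin (m + 1)) ℤ := fun i => onePlusX i with hx
  obtain ⟨U, hU⟩ : IsUnit (1 - x 0 + x 0 * x 0) :=
    isUnit_iff_constantCoeff.2 (by simp [hx, val_onePlusX])
  set M : (MvPowerSeries (Fin (m + 1)) ℤ)ˣ := ∏ i : Fin m, onePlusX i.succ ^ l i
  set g : MvPowerSeries (Fin (m + 1)) ℤ := M * (pairProd fun i : Fin m => x i.succ) * ↑U⁻¹ with hg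
  have hgU : g * U = M * pairProd fun i : Fin m => x i.succ := by
    rw [hg, Units.inv_mul_cancel_right]
  clear_value g
  have hmon : ∀ b : ℤ, (shiftedMonomial (Fin.cons b l : Fin (m + 1) → ℤ)) =
      ↑(onePlusX (0 : Fin (m + 1)) ^ b) * (M : MvPowerSeries (Fin (m + 1)) ℤ) := fun b => by
    rw [shiftedMonomial, Fin.prod_univ_succ]
    simp only [Fin.cons_zero, Fin.cons_succ, Units.val_mul, M]
  have h1 : countCoeff (m + 1) 0 (Fin.cons a l) =
      AltCoeff.altCoeff (m + 1) 0 (↑(onePlusX (0 : Fin (m + 1)) ^ a) * g) := by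
    have := altCoeff_prod_add_mul (1 - x 0) (x 0) (↑(onePlusX (0 : Fin (m + 1)) ^ a) * g)
    rw [show 1 - x 0 + x 0 = 1 by ring, one_pow, one_mul] at this
    rw [← this, countCoeff, hmon, pairProd, Fin.prod_univ_succ]
    congr 1
    linear_combination (-(onePlusX (0 : Fin (m + 1)) ^ a :
      (MvPowerSeries (Fin (m + 1)) ℤ)ˣ).val * (∏ q : Fin m, (1 - x 0 + x 0 * x q.succ))) * hgU +
      (onePlusX (0 : Fin (m + 1)) ^ a : (MvPowerSeries (Fin (m + 1)) ℤ)ˣ).val *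
        (∏ q : Fin m, (1 - x 0 + x 0 * x q.succ)) * g * hU
  have h2 : (-1) ^ m * countCoeff (m + 1) 0 (Fin.snoc l (a - (m + 1)) : Fin (m + 1) → ℤ) =
      AltCoeff.altCoeff (m + 1) 0 (↑(onePlusX (0 : Fin (m + 1)) ^ a) * g) := by
    have hr := AltCoeff.altCoeff_renameEquiv (s := 0) (finRotate (m + 1))
      (shiftedMonomial (Fin.snoc l (a - (m + 1)) : Fin (m + 1) → ℤ) *
        pairProd fun i : Fin (m + 1) => x i)
    rw [sign_finRotate, Nat.add_sub_cancel] at hr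
    push_cast at hr
    have e1 : renameEquiv ℤ (finRotate (m + 1))
        (shiftedMonomial (Fin.snoc l (a - (m + 1)) : Fin (m + 1) → ℤ)) =
        shiftedMonomial (Fin.cons (a - (m + 1)) l : Fin (m + 1) → ℤ) := by
      refine (congrArg (fun k => renameEquiv ℤ (finRotate (m + 1)) (shiftedMonomial k))
        (funext fun i : Fin (m + 1) => ?_)).trans (rename_shiftedMonomial _ _)
      refine Fin.lastCases ?_ (fun i => ?_) i
      · rw [Fin.snoc_last, finRotate_last, Fin.cons_zero]
      · rw [Fin.snoc_castSucc, finRotate_apply, Fin.coeSucc_eq_succ, Fin.cons_succ]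
    have e2 : renameEquiv ℤ (finRotate (m + 1)) (pairProd fun i : Fin (m + 1) => x i) =
        (pairProd fun i : Fin m => x i.succ) * ∏ p : Fin m, (1 - x p.succ + x p.succ * x 0) := by
      have h4 := map_pairProd (renameEquiv ℤ (finRotate (m + 1)) :
        MvPowerSeries (Fin (m + 1)) ℤ →+* MvPowerSeries (Fin (m + 1)) ℤ) x
      refine h4.trans ?_
      simp only [RingHom.coe_coe, hx, rename_onePlusX]
      rw [pairProd_snoc]
      rw [finRotate_last]
      simp only [finRotate_apply, Fin.coeSucc_eq_succ]
    rw [map_mul, e1, e2, hmon] at hr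
    set z : MvPowerSeries (Fin (m + 1)) ℤ :=
      ((onePlusX (0 : Fin (m + 1)) ^ (a - (m + 1)) : (MvPowerSeries (Fin (m + 1)) ℤ)ˣ) :
        MvPowerSeries (Fin (m + 1)) ℤ) with hz
    have h5 := altCoeff_prod_add_mul 1 (x 0 - 1) (z * g)
    rw [show 1 + (x 0 - 1) = x 0 by ring, Fin.prod_univ_succ] at h5
    rw [countCoeff, ← hr]
    refine Eq.trans ?_ (h5.trans ?_)
    · congr 1
      have e3 : ∀ p : Fin m, 1 + (x 0 - 1) * (onePlusX p.succ : MvPowerSeries (Fin (m + 1)) ℤ) =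
          1 - x p.succ + x p.succ * x 0 := fun p => by
        rw [hx]
        ring
      simp only [e3]
      linear_combination (-z * ∏ p : Fin m, (1 - x p.succ + x p.succ * x 0)) * hgU +
        z * (∏ p : Fin m, (1 - x p.succ + x p.succ * x 0)) * g * hU
    · rw [← mul_assoc, hz, show x 0 = (onePlusX (0 : Fin (m + 1)) : MvPowerSeries _ ℤ) from rfl,
        ← Units.val_pow_eq_pow_val, ← Units.val_mul, ← zpow_natCast, ← zpow_add]
      push_cast
      rw [add_sub_cancel]
  rw [← h1] at h2
  rw [← h2, ← mul_assoc, ← mul_pow]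
  simp

end

theorem eq_zero_of_fwdDiff_iter_eq_zero {n : ℕ} {f : ℤ → ℤ} (h : (fwdDiff 1)^[n] f = 0)
    (h1 : ∀ y, 1 ≤ y → f y = 0) : f = 0 := by
  induction n generalizing f with
  | zero => exact h
  | succ n ih =>
    have h2 := ih (f := fwdDiff 1 f) h fun y hy => by
      rw [fwdDiff, h1 y hy, h1 _ (by omega), sub_zero]
    have h3 : ∀ y, f (y + 1) = f y := fun y => sub_eq_zero.1 (congrFun h2 y)
    funext y
    rcases le_total 1 y with hy | hy
    · exact h1 y hy
    · induction y, hy using Int.leInductionDown with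
      | base => exact h1 1 le_rfl
      | pred y hy ihy => rwa [← h3, sub_add_cancel]

theorem fwdDiff_iter_ringChoose {n a : ℕ} (h : a < n) (c : ℤ) :
    (fwdDiff 1)^[n] (fun y : ℤ => Ring.choose (y + c) a) = 0 := by
  induction n generalizing a with
  | zero => omega
  | succ n ih =>
    rw [Function.iterate_succ_apply]
    have h0 : ∀ m, (fwdDiff (1 : ℤ))^[m] (fun _ => (0 : ℤ)) = fun _ => 0 := fun m => by
      induction m with
      | zero => rfl
      | succ m ihm => rw [Function.iterate_succ_apply, fwdDiff_const, ihm]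
    cases a with
    | zero =>
      simp only [Ring.choose_zero_right, fwdDiff_const, h0]
      rfl
    | succ a =>
      have : fwdDiff 1 (fun y : ℤ => Ring.choose (y + c) (a + 1)) =
          fun y => Ring.choose (y + c) a := by
        funext y
        rw [fwdDiff, add_right_comm, Ring.choose_succ_succ, add_sub_cancel_right]
      rw [this, ih (by omega)]

theorem fwdDiff_iter_countCoeff {m : ℕ} (l : Fin m → ℤ) (c : ℤ) :
    (fwdDiff 1)^[m + 1] (fun y => countCoeff (m + 1) 0 (Fin.snoc l (y + c) : Fin (m + 1) → ℤ)) =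
      0 := by
  have key : ∀ (n : ℕ) (f : MvPowerSeries (Fin (m + 1)) ℤ) (y : ℤ),
      (fwdDiff 1)^[n] (fun y : ℤ => AltCoeff.altCoeff (m + 1) 0
        (↑(onePlusX (Fin.last m) ^ y) * f)) y = AltCoeff.altCoeff (m + 1) 0
          (((onePlusX (Fin.last m) ^ y : (MvPowerSeries (Fin (m + 1)) ℤ)ˣ) :
            MvPowerSeries (Fin (m + 1)) ℤ) * (MvPowerSeries.X (Fin.last m) ^ n * f)) := by
    intro n
    induction n with
    | zero => simp
    | succ n ih =>
      intro f y
      rw [Function.iterate_succ_apply', fwdDiff, ih, ih, ← map_sub, zpow_add_one]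
      congr 1
      rw [Units.val_mul, val_onePlusX]
      ring
  funext y
  have h : (fun y => countCoeff (m + 1) 0 (Fin.snoc l (y + c) : Fin (m + 1) → ℤ)) = fun y : ℤ =>
      AltCoeff.altCoeff (m + 1) 0 (↑(onePlusX (Fin.last m) ^ y) *
        (shiftedMonomial (Fin.snoc l c : Fin (m + 1) → ℤ) * pairProd fun i : Fin (m + 1) =>
          (onePlusX i : MvPowerSeries (Fin (m + 1)) ℤ))) := by
    funext y
    rw [countCoeff, ← mul_assoc]
    congr 2
    simp only [shiftedMonomial, Fin.prod_univ_castSucc, Fin.snoc_castSucc, Fin.snoc_last, zpow_add,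
      Units.val_mul]
    ring
  rw [h, key, mul_left_comm, AltCoeff.altCoeff_X_pow_mul]
  rfl

theorem sum_alternating_choose {d : ℕ} {α : ℕ → ℤ}
    (hα : ∀ x : ℕ, 1 ≤ x → countCoeff (d + 1) 0 (Fin.cons (2 - x) fun i : Fin d => (i : ℤ) + 2) =
      ∑ a ∈ Finset.range (d + 1), α a * ((x + a - 1).choose a : ℤ))
    (hrefl : ∀ x : ℕ, 1 ≤ x →
      countCoeff (d + 1) 0 (Fin.snoc (fun i : Fin d => (i : ℤ) + 1) (x + d) : Fin (d + 1) → ℤ) =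
        countCoeff (d + 1) 0 (Fin.cons (2 - x) fun i : Fin d => (i : ℤ) + 2)) {x : ℕ} (hx : 1 ≤ x) :
    ∑ a ∈ Finset.range (d + 1), α a * (-1) ^ a * ((2 * d + x).choose a : ℤ) =
      (-1) ^ d * ∑ a ∈ Finset.range (d + 1), α a * ((x + a - 1).choose a : ℤ) := by
  set p : ℤ → ℤ := fun y =>
    countCoeff (d + 1) 0 (Fin.snoc (fun i : Fin d => (i : ℤ) + 1) (y + d) : Fin (d + 1) → ℤ) with hp
  set q : ℤ → ℤ := ∑ a ∈ Finset.range (d + 1), (-α a) • fun y : ℤ =>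
    Ring.choose (y + ((a : ℤ) - 1)) a with hq
  have hpq : p + q = 0 := by
    refine eq_zero_of_fwdDiff_iter_eq_zero (n := d + 1) ?_ fun y hy => ?_
    · rw [fwdDiff_iter_add, fwdDiff_iter_countCoeff, zero_add, fwdDiff_iter_finsetSum]
      refine Finset.sum_eq_zero fun a ha => ?_
      rw [fwdDiff_iter_const_smul, fwdDiff_iter_ringChoose (Finset.mem_range.1 ha), smul_zero]
    · obtain ⟨z, rfl⟩ : ∃ z : ℕ, y = z := ⟨y.toNat, by omega⟩
      have hz : 1 ≤ z := by exact_mod_cast hy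
      rw [Pi.add_apply, show p z = _ from hrefl z hz, hα z hz, hq, Finset.sum_apply,
        ← Finset.sum_add_distrib]
      refine Finset.sum_eq_zero fun a _ => ?_
      rw [Pi.smul_apply, show (z : ℤ) + ((a : ℤ) - 1) = ((z + a - 1 : ℕ) : ℤ) by omega,
        Ring.choose_natCast]
      simp
  have h1 := congrFun hpq (-(2 * d + x : ℕ))
  have h2 : p (-(2 * d + x : ℕ)) =
      (-1) ^ d * countCoeff (d + 1) 0 (Fin.cons (2 - x) fun i : Fin d => (i : ℤ) + 2) := by
    rw [← countCoeff_snoc, ← countCoeff_add_const _ (-1), hp]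
    refine congrArg (countCoeff (d + 1) 0) (funext fun i => ?_)
    refine Fin.lastCases ?_ (fun i => ?_) i
    · simp only [Fin.snoc_last]
      push_cast
      ring
    · simp only [Fin.snoc_castSucc]
      ring
  rw [Pi.add_apply, h2, hα x hx, hq, Finset.sum_apply, Pi.zero_apply, add_comm,
    ← eq_neg_iff_add_eq_zero] at h1
  rw [← neg_inj, ← h1, ← Finset.sum_neg_distrib]
  refine Finset.sum_congr rfl fun a _ => ?_
  rw [Pi.smul_apply, show (-((2 * d + x : ℕ) : ℤ) + ((a : ℤ) - 1)) =
    -(((2 * d + x : ℕ) : ℤ) + 1 - a) by ring, Ring.choose_neg,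
    show ((2 * d + x : ℕ) : ℤ) + 1 - a + a - 1 = ((2 * d + x : ℕ) : ℤ) by ring, Ring.choose_natCast,
    Int.negOnePow_def, Units.smul_def, zpow_natCast]
  push_cast
  simp only [smul_eq_mul]
  ring

theorem Interlaces.reflect (c : ℤ) {n : ℕ} {l : Fin n → ℤ} {k : Fin (n + 1) → ℤ}
    (h : Interlaces l k) : Interlaces (fun i => c - l i.rev) fun i => c - k i.rev := by
  intro i
  simp only [Fin.rev_castSucc, Fin.rev_succ]
  have := h i.rev
  constructor <;> linarith

theorem StrictMono.reflect (c : ℤ) {n : ℕ} {l : Fin n → ℤ} (h : StrictMono l) :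
    StrictMono fun i : Fin n => c - l i.rev :=
  fun _ _ hij => sub_lt_sub_left (h (Fin.rev_lt_rev.2 hij)) c

theorem patternSum_reflect (c : ℤ) (w : ∀ n, (Fin n → ℤ) → ℤ) {n : ℕ} (k : Fin n → ℤ) :
    patternSum w n (fun i => c - k i.rev) =
      patternSum (fun r m => w r fun i => c - m i.rev) n k := by
  induction n with
  | zero => rfl
  | succ n ih =>
    have hmem : ∀ {k : Fin (n + 1) → ℤ} {l : Fin n → ℤ}, l ∈ rowsBelow k →
        (fun i => c - l i.rev) ∈ rowsBelow fun i => c - k i.rev := by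
      intro k l hl
      rw [mem_rowsBelow] at hl ⊢
      exact ⟨hl.1.reflect c, hl.2.reflect c⟩
    rw [patternSum, patternSum]
    refine Finset.sum_bij' (fun l _ i => c - l i.rev) (fun l _ i => c - l i.rev)
      (fun l hl => by simpa using hmem hl) (fun l hl => hmem hl) (by simp) (by simp)
      fun l _ => ?_
    rw [← ih]
    simp

/-- The indicator that the first entry of a row of length `r` is `1` exactly when `s ≤ r`. -/
noncomputable def headWeight (s r : ℕ) (m : Fin r → ℤ) : ℤ :=
  open Classical in if s ≤ r ↔ ∃ h : 0 < r, m ⟨0, h⟩ = 1 then 1 else 0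

open Classical in
theorem headWeight_succ (s n : ℕ) (m : Fin (n + 1) → ℤ) :
    headWeight s (n + 1) m = if s ≤ n + 1 ↔ m 0 = 1 then 1 else 0 := by
  rw [headWeight]
  simp

theorem patternSum_headWeight_of_one_lt {s n : ℕ} (hs : n ≤ s) (_ : 0 < s) {k : Fin n → ℤ}
    (hk : ∀ i, 1 < k i) : patternSum (headWeight s) n k = patternSum (fun _ _ => 1) n k := by
  induction n with
  | zero => rfl
  | succ n ih =>
    rw [patternSum, patternSum]
    refine Finset.sum_congr rfl fun l hl => ?_
    have hl' : ∀ i, 1 < l i := fun i => (hk _).trans_le ((mem_rowsBelow.1 hl).2 i).1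
    rw [ih (by omega) hl', headWeight, if_pos]
    refine iff_of_false (by omega) ?_
    rintro ⟨h, h1⟩
    exact (hl' ⟨0, h⟩).ne' h1

theorem sum_rowsBelow_head_le_one {n x : ℕ} {l : Fin (n + 1) → ℤ}
    (hl : StrictMono (Fin.cons 1 l : Fin (n + 2) → ℤ)) (F : (Fin (n + 1) → ℤ) → ℤ) :
    ∑ m ∈ (rowsBelow (Fin.cons (2 - x) l : Fin (n + 2) → ℤ)).filter (fun m => m 0 ≤ 1), F m =
      ∑ m ∈ (rowsBelow (Fin.cons 1 l : Fin (n + 2) → ℤ)).filter (fun m => m 0 = 1),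
        ∑ y ∈ Finset.Icc 1 x, F (Fin.cons (2 - (y : ℤ)) (Fin.tail m)) := by
  obtain ⟨hl0, hl'⟩ := (strictMono_cons _ _).1 hl
  have hcons : ∀ (a : ℤ) (m : Fin n → ℤ), a ≤ 1 → Interlaces m l → StrictMono m →
      StrictMono (Fin.cons a m : Fin (n + 1) → ℤ) := fun a m ha hm hm' =>
    Fin.strictMono_cons.2 ⟨fun j => ha.trans_lt (hl0.trans_le
      ((hl'.monotone (Fin.zero_le _)).trans (hm j).1)), hm'⟩
  rw [Finset.sum_sigma']
  refine Finset.sum_bij' (fun m _ => ⟨Fin.cons 1 (Fin.tail m), (2 - m 0).toNat⟩)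
    (fun p _ => Fin.cons (2 - (p.2 : ℤ)) (Fin.tail p.1)) ?_ ?_ ?_ ?_ ?_
  · intro m hm
    rw [← Fin.cons_self_tail m] at hm
    simp only [Finset.mem_filter, mem_rowsBelow, interlaces_cons, Fin.cons_zero] at hm
    simp only [Finset.mem_sigma, Finset.mem_filter, mem_rowsBelow, interlaces_cons, Fin.cons_zero,
      Finset.mem_Icc]
    obtain ⟨⟨h1, h2, h3⟩, h4⟩ := hm
    exact ⟨⟨⟨hcons _ _ le_rfl h3 (Fin.strictMono_cons.1 h1).2, ⟨le_rfl, hl0.le⟩, h3⟩, trivial⟩,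
      by omega, by omega⟩
  · rintro ⟨m, y⟩ hp
    simp only [Finset.mem_sigma, Finset.mem_filter, Finset.mem_Icc] at hp
    rw [← Fin.cons_self_tail m] at hp
    simp only [mem_rowsBelow, interlaces_cons, Fin.cons_zero] at hp
    obtain ⟨⟨⟨h1, h2, h3⟩, h4⟩, h5, h6⟩ := hp
    simp only [Finset.mem_filter, mem_rowsBelow, interlaces_cons, Fin.cons_zero]
    exact ⟨⟨hcons _ _ (by omega) h3 (Fin.strictMono_cons.1 h1).2, ⟨by omega, by omega⟩, h3⟩,
      by omega⟩
  · intro m hm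
    have h := (Finset.mem_filter.1 hm).2
    simp only [Fin.tail_cons]
    rw [Int.toNat_of_nonneg (by omega), sub_sub_cancel, Fin.cons_self_tail]
  · rintro ⟨m, y⟩ hp
    simp only [Finset.mem_sigma, Finset.mem_filter, Finset.mem_Icc] at hp
    have h2 : Fin.cons 1 (Fin.tail m) = m := by
      conv_rhs => rw [← Fin.cons_self_tail m, hp.1.2]
    simp [h2]
  · intro m hm
    have h := (Finset.mem_filter.1 hm).2
    simp only [Fin.tail_cons]
    rw [Int.toNat_of_nonneg (by omega), sub_sub_cancel, Fin.cons_self_tail]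

theorem sum_Icc_choose_add_sub_one (x a : ℕ) :
    ∑ y ∈ Finset.Icc 1 x, (y + a - 1).choose a = (x + a).choose (a + 1) := by
  induction x with
  | zero => simp
  | succ x ih =>
    rw [Finset.sum_Icc_succ_top (by omega), ih, add_right_comm, Nat.choose_succ_succ,
      Nat.add_sub_cancel, add_comm]

theorem patternSum_cons_two_sub {n : ℕ} {l : Fin n → ℤ}
    (hl : StrictMono (Fin.cons 1 l : Fin (n + 1) → ℤ)) {x : ℕ} (hx : 1 ≤ x) :
    patternSum (fun _ _ => 1) (n + 1) (Fin.cons (2 - x) l) = ∑ a ∈ Finset.range (n + 1),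
      patternSum (headWeight (n + 1 - a)) (n + 1) (Fin.cons 1 l) * ((x + a - 1).choose a : ℤ) := by
  induction n generalizing x with
  | zero =>
    have : ∀ k : Fin 1 → ℤ, rowsBelow k = Finset.univ := fun k => by
      ext m
      simp only [mem_rowsBelow, Subsingleton.strictMono, Interlaces, IsEmpty.forall_iff,
        Finset.mem_univ, and_self]
    simp [patternSum, headWeight, this]
  | succ n ih =>
    obtain ⟨hl0, hl'⟩ := (strictMono_cons _ _).1 hl
    rw [patternSum, ← Finset.sum_filter_add_sum_filter_not _ (fun m => m 0 ≤ 1),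
      sum_rowsBelow_head_le_one hl, Finset.sum_range_succ']
    simp only [one_mul]
    congr 1
    · have : ∀ m ∈ (rowsBelow (Fin.cons 1 l : Fin (n + 2) → ℤ)).filter (fun m => m 0 = 1),
          ∑ y ∈ Finset.Icc 1 x,
            patternSum (fun _ _ => 1) (n + 1) (Fin.cons (2 - (y : ℤ)) (Fin.tail m)) =
          ∑ a ∈ Finset.range (n + 1), patternSum (headWeight (n + 1 - a)) (n + 1) m *
            ((x + a).choose (a + 1) : ℤ) := by
        intro m hm
        rw [Finset.mem_filter, mem_rowsBelow] at hm
        have h2 : Fin.cons 1 (Fin.tail m) = m := by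
          conv_rhs => rw [← Fin.cons_self_tail m, hm.2]
        rw [Finset.sum_congr rfl fun y hy => ih (h2.symm ▸ hm.1.1) (Finset.mem_Icc.1 hy).1,
          Finset.sum_comm, h2]
        refine Finset.sum_congr rfl fun a _ => ?_
        rw [← Finset.mul_sum, ← sum_Icc_choose_add_sub_one]
        push_cast
        rfl
      rw [Finset.sum_congr rfl this, Finset.sum_comm]
      refine Finset.sum_congr rfl fun a _ => ?_
      rw [patternSum, ← Finset.sum_mul, Finset.sum_filter]
      refine congrArg₂ _ (Finset.sum_congr rfl fun m _ => ?_) rfl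
      rw [headWeight_succ, Nat.add_sub_add_right]
      by_cases hm : m 0 = 1 <;> simp [hm]
    · rw [patternSum, Nat.choose_zero_right, Nat.cast_one, mul_one, Nat.sub_zero]
      have : (rowsBelow (Fin.cons (2 - x) l : Fin (n + 2) → ℤ)).filter (fun m => ¬ m 0 ≤ 1) =
          (rowsBelow (Fin.cons 1 l : Fin (n + 2) → ℤ)).filter (fun m => ¬ m 0 ≤ 1) := by
        ext m
        rw [← Fin.cons_self_tail m]
        simp only [Finset.mem_filter, mem_rowsBelow, interlaces_cons, Fin.cons_zero]
        grind
      rw [this, Finset.sum_filter]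
      refine Finset.sum_congr rfl fun m hm => ?_
      have hm0 : 1 ≤ m 0 := ((mem_rowsBelow.1 hm).2 0).1
      split_ifs with h
      · have h1 : m 0 = 1 := by omega
        rw [headWeight_succ]
        simp [h1]
      · have h1 : ∀ i, 1 < m i := fun i =>
          (not_le.1 h).trans_le ((mem_rowsBelow.1 hm).1.monotone (Fin.zero_le i))
        rw [patternSum_headWeight_of_one_lt (by omega) (by omega) h1, headWeight_succ]
        simp [(h1 0).ne']

/-- The number of entries of `l` that are at most `c`. -/
def countLE {n : ℕ} (l : Fin n → ℤ) (c : ℤ) : ℕ := ∑ i, if l i ≤ c then 1 else 0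

theorem countLE_eq_card {n : ℕ} (l : Fin n → ℤ) (c : ℤ) :
    countLE l c = (Finset.univ.filter fun i => l i ≤ c).card :=
  (Finset.card_filter _ _).symm

theorem countLE_le {n : ℕ} (l : Fin n → ℤ) (c : ℤ) : countLE l c ≤ n := by
  rw [countLE_eq_card]
  exact (Finset.card_filter_le _ _).trans (by simp)

theorem le_iff_lt_countLE {n : ℕ} {l : Fin n → ℤ} (hl : Monotone l) (i : Fin n) (c : ℤ) :
    l i ≤ c ↔ (i : ℕ) < countLE l c := by
  rw [countLE_eq_card]
  constructor
  · intro h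
    rw [← Nat.add_one_le_iff, ← Fin.card_Iic]
    exact Finset.card_le_card fun j hj => by
      simpa using (hl (Finset.mem_Iic.1 hj)).trans h
  · contrapose!
    intro h
    rw [← Fin.card_Iio]
    refine Finset.card_le_card fun j hj => Finset.mem_Iio.2 (lt_of_not_ge fun hij => ?_)
    exact absurd ((hl hij).trans (Finset.mem_filter.1 hj).2) h.not_ge

theorem countLE_eq_of_bounds {n : ℕ} {l l' : Fin n → ℤ} (hl : Monotone l) (hl' : Monotone l')
    {N : ℕ} (h1 : ∀ i, 1 ≤ l i ∧ l i ≤ N) (h2 : ∀ i, 1 ≤ l' i ∧ l' i ≤ N)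
    (h : ∀ c : ℕ, c ≤ N → countLE l c = countLE l' c) : l = l' := by
  have key : ∀ i (c : ℕ), c ≤ N → (l i ≤ c ↔ l' i ≤ c) := fun i c hc => by
    rw [le_iff_lt_countLE hl, le_iff_lt_countLE hl', h c hc]
  funext i
  have a := h1 i
  have b := h2 i
  have c := key i (l i).toNat (by omega)
  have d := key i (l' i).toNat (by omega)
  omega

theorem Interlaces.countLE_le {n : ℕ} {l : Fin n → ℤ} {k : Fin (n + 1) → ℤ} (hl : Monotone l)
    (hk : Monotone k) (h : Interlaces l k) (c : ℤ) :
    countLE l c ≤ countLE k c ∧ countLE k c ≤ countLE l c + 1 := by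
  constructor
  · by_contra! hc
    have hn := _root_.countLE_le l c
    have h1 := (le_iff_lt_countLE hl ⟨countLE k c, by omega⟩ c).2 hc
    have h2 := (le_iff_lt_countLE hk _ c).1 ((h _).1.trans h1)
    exact lt_irrefl _ h2
  · by_contra! hc
    have hn := _root_.countLE_le k c
    have h1 := (le_iff_lt_countLE hk (Fin.succ ⟨countLE l c, by omega⟩) c).2 hc
    have h2 := (le_iff_lt_countLE hl _ c).1 ((h _).2.trans h1)
    exact lt_irrefl _ h2

theorem interlaces_of_countLE_le {n : ℕ} {l : Fin n → ℤ} {k : Fin (n + 1) → ℤ} (hl : Monotone l)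
    (hk : Monotone k) {N : ℕ} (h1 : ∀ i, 1 ≤ l i ∧ l i ≤ N) (h2 : ∀ i, 1 ≤ k i ∧ k i ≤ N)
    (h : ∀ c : ℕ, c ≤ N → countLE l c ≤ countLE k c ∧ countLE k c ≤ countLE l c + 1) :
    Interlaces l k := by
  intro i
  constructor
  · obtain ⟨a, ha⟩ : ∃ a : ℕ, l i = a := ⟨(l i).toNat, by have := h1 i; omega⟩
    have := (le_iff_lt_countLE hl i a).1 ha.le
    rw [ha, le_iff_lt_countLE hk]
    exact this.trans_le (h a (by have := h1 i; omega)).1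
  · obtain ⟨a, ha⟩ : ∃ a : ℕ, k i.succ = a := ⟨(k i.succ).toNat, by have := h2 i.succ; omega⟩
    have h3 := (le_iff_lt_countLE hk i.succ a).1 ha.le
    have h4 := (h a (by have := h2 i.succ; omega)).2
    rw [ha, le_iff_lt_countLE hl]
    rw [Fin.val_succ] at h3
    omega

theorem countLE_add_one {n : ℕ} {l : Fin n → ℤ} (hl : StrictMono l) (c : ℤ) :
    countLE l c ≤ countLE l (c + 1) ∧ countLE l (c + 1) ≤ countLE l c + 1 := by
  constructor
  · simp only [countLE_eq_card]
    exact Finset.card_le_card (Finset.monotone_filter_right _ fun i _ (h : l i ≤ c) =>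
      h.trans (Int.le_add_one le_rfl))
  · by_contra! hc
    have hn := countLE_le l (c + 1)
    have h1 := (le_iff_lt_countLE hl.monotone ⟨countLE l c + 1, by omega⟩ _).2 hc
    have h2 : l ⟨countLE l c, by omega⟩ < l ⟨countLE l c + 1, by omega⟩ :=
      hl (Fin.mk_lt_mk.2 (Nat.lt_succ_self _))
    have h3 := (le_iff_lt_countLE hl.monotone _ c).1 (Int.lt_add_one_iff.1 (h2.trans_le h1))
    exact lt_irrefl _ h3

theorem exists_countLE_eq {N : ℕ} {f : ℕ → ℕ} (h0 : f 0 = 0)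
    (hf : ∀ r < N, f r ≤ f (r + 1) ∧ f (r + 1) ≤ f r + 1) {m : ℕ} (hm : f N = m) :
    ∃ l : Fin m → ℤ, StrictMono l ∧ (∀ i, 1 ≤ l i ∧ l i ≤ N) ∧
      ∀ r : ℕ, r ≤ N → countLE l r = f r := by
  induction N generalizing m with
  | zero =>
    obtain rfl : m = 0 := hm.symm.trans h0
    refine ⟨Fin.elim0, Subsingleton.strictMono _, fun i => i.elim0, fun r hr => ?_⟩
    obtain rfl : r = 0 := by omega
    rw [h0]
    rfl
  | succ N ih =>
    obtain ⟨l, hl, hlN, hlf⟩ := ih (fun r hr => hf r (by omega)) rfl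
    have hN := hf N (by omega)
    have hbig : countLE l (N + 1 : ℕ) = f N := by
      rw [countLE, Finset.sum_congr rfl fun i _ => if_pos (by have := hlN i; push_cast; omega)]
      simp
    rcases Nat.lt_or_ge (f N) m with h | h
    · obtain rfl : m = f N + 1 := by omega
      refine ⟨Fin.snoc l (N + 1 : ℤ), ?_, ?_, ?_⟩
      · intro i j
        refine Fin.lastCases (fun h => ?_) (fun j h => ?_) j
        · obtain ⟨i, rfl⟩ := Fin.exists_castSucc_eq.2 h.ne
          simp only [Fin.snoc_last, Fin.snoc_castSucc]
          have := hlN i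
          omega
        · obtain ⟨i, rfl⟩ := Fin.exists_castSucc_eq.2 (h.trans_le (Fin.le_last _)).ne
          simpa only [Fin.snoc_castSucc] using hl (Fin.castSucc_lt_castSucc_iff.1 h)
      · intro i
        refine Fin.lastCases ?_ (fun i => ?_) i
        · simp only [Fin.snoc_last]
          omega
        · simp only [Fin.snoc_castSucc]
          have := hlN i
          omega
      · intro r hr
        rw [countLE, Fin.sum_univ_castSucc]
        simp only [Fin.snoc_last, Fin.snoc_castSucc]
        rw [← countLE]
        rcases Nat.lt_or_ge N r with hr' | hr'
        · obtain rfl : r = N + 1 := by omega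
          rw [hbig, hm, if_pos (by push_cast; omega)]
        · rw [hlf r hr', if_neg (by omega), add_zero]
    · obtain rfl : m = f N := by omega
      refine ⟨l, hl, fun i => ⟨(hlN i).1, by have := hlN i; push_cast; omega⟩, fun r hr => ?_⟩
      rcases Nat.lt_or_ge N r with hr' | hr'
      · obtain rfl : r = N + 1 := by omega
        rw [hbig, hm]
      · exact hlf r hr'

/-- Patterns with top row `1, 2, …, n + 1`. -/
def IsStaircasePattern {n : ℕ} (μ : ∀ i : Fin (n + 1), Fin ((i : ℕ) + 1) → ℤ) : Prop :=
  IsGTPattern μ ∧ ∀ b : Fin (n + 1), μ (Fin.last n) b = ((b : ℕ) + 1 : ℤ)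

theorem IsStaircasePattern.bounds {n : ℕ} {μ : ∀ i : Fin (n + 1), Fin ((i : ℕ) + 1) → ℤ}
    (h : IsStaircasePattern μ) (i : Fin (n + 1)) (b : Fin ((i : ℕ) + 1)) :
    1 ≤ μ i b ∧ μ i b ≤ (n + 1 : ℕ) := by
  obtain ⟨i, hi⟩ := i
  obtain ⟨m, hm⟩ : ∃ m, i + m = n := ⟨n - i, by omega⟩
  induction m generalizing i with
  | zero =>
    obtain rfl : i = n := hm
    have := h.2 b
    have hb := b.2
    change μ ⟨i, hi⟩ b = _ at this
    simp only at hb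
    omega
  | succ m ih =>
    have h1 := h.1.2 ⟨i, hi⟩ (by simp only; omega) b
    have h2 := ih (i + 1) (by omega) b.castSucc (by omega)
    have h3 := ih (i + 1) (by omega) b.succ (by omega)
    exact ⟨h2.1.trans h1.1, h1.2.trans h3.2⟩

/-- The number of entries at most `c` in the row of length `r`. -/
def rowCount {n : ℕ} (μ : ∀ i : Fin (n + 1), Fin ((i : ℕ) + 1) → ℤ) (r : ℕ) (c : ℤ) : ℕ :=
  match r with
  | 0 => 0
  | r + 1 => if h : r < n + 1 then countLE (μ ⟨r, h⟩) c else 0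

theorem rowCount_succ {n : ℕ} (μ : ∀ i : Fin (n + 1), Fin ((i : ℕ) + 1) → ℤ) (i : Fin (n + 1))
    (c : ℤ) : rowCount μ (i + 1) c = countLE (μ i) c :=
  dif_pos i.2

theorem IsStaircasePattern.rowCount_add_one_left {n : ℕ}
    {μ : ∀ i : Fin (n + 1), Fin ((i : ℕ) + 1) → ℤ} (h : IsStaircasePattern μ) {r : ℕ}
    (hr : r < n + 1) (c : ℤ) :
    rowCount μ r c ≤ rowCount μ (r + 1) c ∧ rowCount μ (r + 1) c ≤ rowCount μ r c + 1 := by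
  rw [rowCount_succ μ ⟨r, hr⟩]
  cases r with
  | zero => exact ⟨Nat.zero_le _, countLE_le _ _⟩
  | succ r =>
    rw [rowCount_succ μ ⟨r, by omega⟩]
    exact (h.1.2 ⟨r, by omega⟩ hr).countLE_le (h.1.1 _).monotone (h.1.1 _).monotone c

theorem IsStaircasePattern.rowCount_add_one_right {n : ℕ}
    {μ : ∀ i : Fin (n + 1), Fin ((i : ℕ) + 1) → ℤ} (h : IsStaircasePattern μ) (r : ℕ) (c : ℤ) :
    rowCount μ r c ≤ rowCount μ r (c + 1) ∧ rowCount μ r (c + 1) ≤ rowCount μ r c + 1 := by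
  cases r with
  | zero => exact ⟨le_rfl, Nat.zero_le _⟩
  | succ r =>
    rw [rowCount, rowCount]
    split_ifs
    · exact countLE_add_one (h.1.1 _) c
    · exact ⟨le_rfl, Nat.zero_le _⟩

theorem IsStaircasePattern.rowCount_zero {n : ℕ} {μ : ∀ i : Fin (n + 1), Fin ((i : ℕ) + 1) → ℤ}
    (h : IsStaircasePattern μ) (r : ℕ) : rowCount μ r 0 = 0 := by
  cases r with
  | zero => rfl
  | succ r =>
    rw [rowCount]
    split_ifs
    · exact Finset.sum_eq_zero fun b _ => if_neg (by have := h.bounds _ b; omega)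
    · rfl

theorem IsStaircasePattern.rowCount_right {n : ℕ} {μ : ∀ i : Fin (n + 1), Fin ((i : ℕ) + 1) → ℤ}
    (h : IsStaircasePattern μ) {r : ℕ} (hr : r ≤ n + 1) : rowCount μ r (n + 1 : ℕ) = r := by
  cases r with
  | zero => rfl
  | succ r =>
    rw [rowCount_succ μ ⟨r, hr⟩, countLE, Finset.sum_congr rfl fun b _ => if_pos (h.bounds _ b).2]
    simp

theorem IsStaircasePattern.rowCount_top {n : ℕ} {μ : ∀ i : Fin (n + 1), Fin ((i : ℕ) + 1) → ℤ}
    (h : IsStaircasePattern μ) {c : ℕ} (hc : c ≤ n + 1) : rowCount μ (n + 1) c = c := by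
  refine (rowCount_succ μ (Fin.last n) c).trans (eq_of_forall_lt_iff fun b => ?_)
  have h1 : countLE (μ (Fin.last n)) c ≤ n + 1 := countLE_le (μ (Fin.last n)) c
  by_cases hb : b < n + 1
  · have h2 := le_iff_lt_countLE (h.1.1 (Fin.last n)).monotone (⟨b, hb⟩ : Fin (n + 1)) c
    rw [h.2] at h2
    simp only at h2
    omega
  · omega

theorem IsStaircasePattern.ext_rowCount {n : ℕ} {μ ν : ∀ i : Fin (n + 1), Fin ((i : ℕ) + 1) → ℤ}
    (hμ : IsStaircasePattern μ) (hν : IsStaircasePattern ν)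
    (h : ∀ r c : ℕ, r ≤ n + 1 → c ≤ n + 1 → rowCount μ r c = rowCount ν r c) : μ = ν := by
  funext i
  refine countLE_eq_of_bounds (hμ.1.1 i).monotone (hν.1.1 i).monotone (hμ.bounds i) (hν.bounds i)
    fun c hc => ?_
  rw [← rowCount_succ, ← rowCount_succ, h _ _ i.2 hc]

theorem IsStaircasePattern.exists_transpose {n : ℕ}
    {μ : ∀ i : Fin (n + 1), Fin ((i : ℕ) + 1) → ℤ} (h : IsStaircasePattern μ) :
    ∃ ν : ∀ i : Fin (n + 1), Fin ((i : ℕ) + 1) → ℤ, IsStaircasePattern ν ∧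
      ∀ r c : ℕ, r ≤ n + 1 → c ≤ n + 1 → rowCount ν r c = rowCount μ c r := by
  have key : ∀ i : Fin (n + 1), ∃ l : Fin ((i : ℕ) + 1) → ℤ, StrictMono l ∧
      (∀ b, 1 ≤ l b ∧ l b ≤ (n + 1 : ℕ)) ∧
      ∀ r : ℕ, r ≤ n + 1 → countLE l r = rowCount μ r ((i + 1 : ℕ) : ℤ) := fun i =>
    exists_countLE_eq (f := fun r => rowCount μ r ((i + 1 : ℕ) : ℤ)) rfl
      (fun r hr => h.rowCount_add_one_left hr _) (h.rowCount_top i.2)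
  choose ν hν hb hc using key
  have hrow : ∀ r c : ℕ, r ≤ n + 1 → c ≤ n + 1 → rowCount ν r c = rowCount μ c r := by
    intro r c hr hc'
    cases r with
    | zero => exact (h.rowCount_zero c).symm
    | succ r => rw [rowCount_succ ν ⟨r, hr⟩, hc _ _ hc']
  refine ⟨ν, ⟨⟨hν, fun i hi => ?_⟩, fun b => ?_⟩, hrow⟩
  · refine interlaces_of_countLE_le (hν _).monotone (hν _).monotone (hb _)
      (hb ⟨i + 1, hi⟩) fun c hc' => ?_
    rw [← rowCount_succ, ← rowCount_succ, hrow _ _ i.2 hc', hrow _ _ hi hc']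
    exact_mod_cast h.rowCount_add_one_right c (i + 1 : ℕ)
  · have h1 : ∀ c : ℕ, c ≤ n + 1 → countLE (ν (Fin.last n)) c = c := fun c hc' => by
      rw [← rowCount_succ]
      exact (hrow _ _ le_rfl hc').trans (h.rowCount_right hc')
    have h2 := le_iff_lt_countLE (hν (Fin.last n)).monotone b (b : ℕ)
    have h3 := le_iff_lt_countLE (hν (Fin.last n)).monotone b (b + 1 : ℕ)
    have hb : (b : ℕ) < n + 1 := b.2
    rw [h1 _ (by omega)] at h2 h3
    omega

theorem IsStaircasePattern.head_le_iff {n : ℕ} {μ : ∀ i : Fin (n + 1), Fin ((i : ℕ) + 1) → ℤ}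
    (h : IsStaircasePattern μ) (i : Fin (n + 1)) (c : ℤ) :
    μ i 0 ≤ c ↔ 0 < rowCount μ (i + 1) c := by
  rw [rowCount_succ, le_iff_lt_countLE (h.1.1 i).monotone]
  rfl

/-- The patterns with top row `k` whose other rows satisfy `Q`. -/
def patternsBelow (Q : ∀ r : ℕ, (Fin r → ℤ) → Prop) {n : ℕ} (k : Fin (n + 1) → ℤ) :
    Set (∀ i : Fin (n + 1), Fin ((i : ℕ) + 1) → ℤ) :=
  {μ | IsGTPattern μ ∧ μ (Fin.last n) = k ∧ ∀ i : Fin n, Q (i + 1) (μ i.castSucc)}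

/-- Add a new top row to a pattern. -/
def addTopRow {n : ℕ} (ν : ∀ i : Fin (n + 1), Fin ((i : ℕ) + 1) → ℤ) (k : Fin (n + 2) → ℤ) :
    ∀ i : Fin (n + 2), Fin ((i : ℕ) + 1) → ℤ :=
  Fin.snoc (α := fun i : Fin (n + 2) => Fin ((i : ℕ) + 1) → ℤ) ν k

theorem addTopRow_castSucc {n : ℕ} (ν : ∀ i : Fin (n + 1), Fin ((i : ℕ) + 1) → ℤ)
    (k : Fin (n + 2) → ℤ) (i : Fin (n + 1)) : addTopRow ν k i.castSucc = ν i :=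
  Fin.snoc_castSucc (α := fun i : Fin (n + 2) => Fin ((i : ℕ) + 1) → ℤ) k ν i

theorem addTopRow_last {n : ℕ} (ν : ∀ i : Fin (n + 1), Fin ((i : ℕ) + 1) → ℤ)
    (k : Fin (n + 2) → ℤ) : addTopRow ν k (Fin.last (n + 1)) = k :=
  Fin.snoc_last (α := fun i : Fin (n + 2) => Fin ((i : ℕ) + 1) → ℤ) k ν

theorem isGTPattern_iff {n : ℕ} {μ : ∀ i : Fin (n + 1), Fin ((i : ℕ) + 1) → ℤ} :
    IsGTPattern μ ↔ (∀ i, StrictMono (μ i)) ∧ ∀ i : Fin n, Interlaces (μ i.castSucc) (μ i.succ) :=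
  and_congr_right fun _ => ⟨fun h i => h i.castSucc (Nat.succ_lt_succ i.2),
    fun h i hi => h ⟨i, Nat.lt_of_succ_lt_succ hi⟩⟩

theorem isGTPattern_addTopRow {n : ℕ} {ν : ∀ i : Fin (n + 1), Fin ((i : ℕ) + 1) → ℤ}
    {k : Fin (n + 2) → ℤ} : IsGTPattern (addTopRow ν k) ↔
      IsGTPattern ν ∧ StrictMono k ∧ Interlaces (ν (Fin.last n)) k := by
  have h1 : (∀ i, StrictMono (addTopRow ν k i)) ↔ (∀ i, StrictMono (ν i)) ∧ StrictMono k := by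
    rw [Fin.forall_fin_succ', addTopRow_last]
    simp only [addTopRow_castSucc]
  have h2 : (∀ i : Fin (n + 1), Interlaces (addTopRow ν k i.castSucc) (addTopRow ν k i.succ)) ↔
      (∀ i : Fin n, Interlaces (ν i.castSucc) (ν i.succ)) ∧ Interlaces (ν (Fin.last n)) k := by
    rw [Fin.forall_fin_succ']
    refine and_congr (forall_congr' fun i => ?_) ?_
    · rw [addTopRow_castSucc, show addTopRow ν k i.castSucc.succ = ν i.succ from
        addTopRow_castSucc ν k i.succ]
    · rw [addTopRow_castSucc, show addTopRow ν k (Fin.last n).succ = k from addTopRow_last ν k]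
  rw [isGTPattern_iff, isGTPattern_iff, h1, h2]
  tauto

theorem addTopRow_mem_patternsBelow {Q : ∀ r : ℕ, (Fin r → ℤ) → Prop} {n : ℕ}
    {ν : ∀ i : Fin (n + 1), Fin ((i : ℕ) + 1) → ℤ} {k : Fin (n + 2) → ℤ} {l : Fin (n + 1) → ℤ}
    (hk : StrictMono k) (hl : l ∈ rowsBelow k) (hQ : Q (n + 1) l) (hν : ν ∈ patternsBelow Q l) :
    addTopRow ν k ∈ patternsBelow Q k := by
  obtain ⟨h1, rfl, h3⟩ := hν
  refine ⟨isGTPattern_addTopRow.2 ⟨h1, hk, (mem_rowsBelow.1 hl).2⟩, addTopRow_last _ _, ?_⟩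
  rw [Fin.forall_fin_succ']
  refine ⟨fun i => ?_, ?_⟩
  · rw [addTopRow_castSucc]
    exact h3 i
  · rw [addTopRow_castSucc]
    exact hQ

theorem exists_addTopRow {Q : ∀ r : ℕ, (Fin r → ℤ) → Prop} {n : ℕ} {k : Fin (n + 2) → ℤ}
    {μ : ∀ i : Fin (n + 2), Fin ((i : ℕ) + 1) → ℤ} (hμ : μ ∈ patternsBelow Q k) :
    ∃ l : Fin (n + 1) → ℤ, (l ∈ rowsBelow k ∧ Q (n + 1) l) ∧ ∃ ν ∈ patternsBelow Q l,
      addTopRow ν k = μ := by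
  obtain ⟨h1, rfl, h3⟩ := hμ
  have h : addTopRow (fun i => μ i.castSucc) (μ (Fin.last (n + 1))) = μ :=
    Fin.snoc_init_self (α := fun i : Fin (n + 2) => Fin ((i : ℕ) + 1) → ℤ) μ
  rw [← h] at h1
  obtain ⟨h4, -, h5⟩ := isGTPattern_addTopRow.1 h1
  exact ⟨μ (Fin.last n).castSucc, ⟨mem_rowsBelow.2 ⟨h4.1 (Fin.last n), h5⟩, h3 (Fin.last n)⟩,
    _, ⟨h4, rfl, fun i => h3 i.castSucc⟩, h⟩

theorem addTopRow_injective {n : ℕ} (k : Fin (n + 2) → ℤ) :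
    Function.Injective fun ν : ∀ i : Fin (n + 1), Fin ((i : ℕ) + 1) → ℤ => addTopRow ν k :=
  fun ν ν' h => funext fun i => by
    rw [← addTopRow_castSucc ν k i, ← addTopRow_castSucc ν' k i]
    exact congrFun h i.castSucc

open Classical in
theorem card_patternsBelow (Q : ∀ r : ℕ, (Fin r → ℤ) → Prop) (hQ : ∀ m, Q 0 m) {n : ℕ}
    {k : Fin (n + 1) → ℤ} (hk : StrictMono k) : (patternsBelow Q k).Finite ∧
      ((patternsBelow Q k).ncard : ℤ) =
        patternSum (fun r m => if Q r m then 1 else 0) (n + 1) k := by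
  induction n with
  | zero =>
    have h1 : patternsBelow Q k = {fun i => (Fin.eq_zero i).symm ▸ k} := by
      ext μ
      rw [Set.mem_singleton_iff]
      constructor
      · rintro ⟨-, h, -⟩
        funext i
        obtain rfl := Fin.eq_zero i
        exact h
      · rintro rfl
        refine ⟨isGTPattern_iff.2 ⟨fun i => ?_, fun i => i.elim0⟩, rfl, fun i => i.elim0⟩
        obtain rfl := Fin.eq_zero i
        exact hk
    have h2 : rowsBelow k = Finset.univ := by
      ext m
      simp only [mem_rowsBelow, Subsingleton.strictMono, Interlaces, IsEmpty.forall_iff,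
        Finset.mem_univ, and_self]
    rw [h1]
    simp [patternSum, h2, hQ]
  | succ n ih =>
    have h1 : patternsBelow Q k = ⋃ l ∈ (rowsBelow k).filter (Q (n + 1)),
        (addTopRow · k) '' patternsBelow Q l := by
      ext μ
      simp only [Set.mem_iUnion, Finset.mem_filter, exists_prop, Set.mem_image]
      constructor
      · exact exists_addTopRow
      · rintro ⟨l, ⟨hl, hQl⟩, ν, hν, rfl⟩
        exact addTopRow_mem_patternsBelow hk hl hQl hν
    have hfin : ∀ l ∈ (rowsBelow k).filter (Q (n + 1)),
        ((addTopRow · k) '' patternsBelow Q l).Finite := fun l hl =>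
      (ih (mem_rowsBelow.1 (Finset.mem_filter.1 hl).1).1).1.image _
    rw [h1]
    refine ⟨Set.Finite.biUnion (Finset.finite_toSet _) hfin, ?_⟩
    rw [← Finset.set_biUnion_coe, (Finset.finite_toSet _).ncard_biUnion hfin, patternSum,
      finsum_mem_coe_finset, Finset.sum_filter]
    · push_cast
      refine Finset.sum_congr rfl fun l hl => ?_
      split_ifs with h
      · rw [Set.ncard_image_of_injective _ (addTopRow_injective k),
          (ih (mem_rowsBelow.1 hl).1).2, one_mul]
      · rw [zero_mul]
    · intro l _ l' _ hll'
      refine Set.disjoint_left.2 ?_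
      rintro _ ⟨ν, hν, rfl⟩ ⟨ν', hν', h⟩
      obtain rfl := addTopRow_injective k h
      exact hll' (hν.2.1.symm.trans hν'.2.1)

/-- The row `1, 2, …, n`. -/
def stairs (n : ℕ) (b : Fin n) : ℤ := (b : ℕ) + 1

theorem strictMono_stairs (n : ℕ) : StrictMono (stairs n) := fun i j h => by
  have : (i : ℕ) < j := h
  simp only [stairs]
  omega

theorem setOf_isStaircasePattern (n : ℕ) :
    {μ : ∀ i : Fin (n + 1), Fin ((i : ℕ) + 1) → ℤ | IsStaircasePattern μ} =
      patternsBelow (fun _ _ => True) (stairs (n + 1)) := by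
  ext μ
  simp only [patternsBelow, Set.mem_ofPred_eq, implies_true, and_true, IsStaircasePattern,
    funext_iff]
  rfl

theorem finite_isStaircasePattern (n : ℕ) :
    {μ : ∀ i : Fin (n + 1), Fin ((i : ℕ) + 1) → ℤ | IsStaircasePattern μ}.Finite := by
  rw [setOf_isStaircasePattern]
  exact (card_patternsBelow _ (fun _ => trivial) (strictMono_stairs _)).1

/-- The finite set of patterns with top row `1, 2, …, n + 1`. -/
noncomputable def staircasePatterns (n : ℕ) :
    Finset (∀ i : Fin (n + 1), Fin ((i : ℕ) + 1) → ℤ) :=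
  (finite_isStaircasePattern n).toFinset

theorem mem_staircasePatterns {n : ℕ} {μ : ∀ i : Fin (n + 1), Fin ((i : ℕ) + 1) → ℤ} :
    μ ∈ staircasePatterns n ↔ IsStaircasePattern μ := by
  simp [staircasePatterns]

theorem IsStaircasePattern.reflect {n : ℕ} {μ : ∀ i : Fin (n + 1), Fin ((i : ℕ) + 1) → ℤ}
    (h : IsStaircasePattern μ) : IsStaircasePattern fun i b => (n + 2 : ℤ) - μ i b.rev := by
  refine ⟨⟨fun i => (h.1.1 i).reflect _, fun i hi => (h.1.2 i hi).reflect _⟩, fun b => ?_⟩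
  have hb : (b : ℕ) < n + 1 := b.2
  have h1 := h.2 b.rev
  rw [Fin.val_rev] at h1
  change (n + 2 : ℤ) - μ (Fin.last n) b.rev = _
  omega

/-- The number of patterns with top row `1, 2, …, n + 1` and bottom entry `j`. -/
noncomputable def bottomCount (n : ℕ) (j : ℤ) : ℕ :=
  ((staircasePatterns n).filter fun μ => μ 0 0 = j).card

theorem bottomCount_reflect_le (n : ℕ) (j : ℤ) :
    bottomCount n j ≤ bottomCount n (n + 2 - j) := by
  refine Finset.card_le_card_of_injOn (fun μ i b => (n + 2 : ℤ) - μ i b.rev) (fun μ hμ => ?_)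
    fun μ _ ν _ h => ?_
  · rw [Finset.mem_coe, Finset.mem_filter, mem_staircasePatterns] at hμ ⊢
    exact ⟨hμ.1.reflect, by rw [← hμ.2]; rfl⟩
  · funext i b
    have := congrFun (congrFun h i) b.rev
    simpa using this

theorem bottomCount_reflect (n : ℕ) (j : ℤ) : bottomCount n (n + 2 - j) = bottomCount n j :=
  le_antisymm (by simpa using bottomCount_reflect_le n (n + 2 - j)) (bottomCount_reflect_le n j)

open Classical in
theorem bottomCount_eq_card_heads {n j : ℕ} (hj : 1 ≤ j) (hjn : j ≤ n + 1) :
    bottomCount n j =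
      ((staircasePatterns n).filter fun μ => ∀ i : Fin (n + 1), j ≤ i + 1 ↔ μ i 0 = 1).card := by
  have hbot : ∀ {μ : ∀ i : Fin (n + 1), Fin ((i : ℕ) + 1) → ℤ}, IsStaircasePattern μ →
      (μ 0 0 = j ↔ ∀ c : ℕ, c ≤ n + 1 → (j ≤ c ↔ 0 < rowCount μ 1 c)) := by
    intro μ hμ
    have hb := hμ.bounds 0 0
    have h1 : ∀ c : ℕ, μ 0 0 ≤ c ↔ 0 < rowCount μ 1 c := fun c => hμ.head_le_iff 0 c
    constructor
    · intro h c _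
      rw [← h1, h]
      omega
    · intro h
      have h2 := (h j hjn).1 le_rfl
      rw [← h1] at h2
      have h3 := h (μ 0 0).toNat (by omega)
      rw [← h1] at h3
      omega
  have hhead : ∀ {μ : ∀ i : Fin (n + 1), Fin ((i : ℕ) + 1) → ℤ}, IsStaircasePattern μ →
      ((∀ i : Fin (n + 1), j ≤ i + 1 ↔ μ i 0 = 1) ↔
        ∀ r : ℕ, r ≤ n + 1 → (j ≤ r ↔ 0 < rowCount μ r 1)) := by
    intro μ hμ
    have h1 : ∀ i : Fin (n + 1), μ i 0 = 1 ↔ 0 < rowCount μ (i + 1) 1 := fun i => by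
      rw [← hμ.head_le_iff i 1]
      have := hμ.bounds i 0
      omega
    simp only [h1]
    constructor
    · intro h r hr
      cases r with
      | zero => exact iff_of_false (by omega) (lt_irrefl _)
      | succ r => exact h ⟨r, hr⟩
    · exact fun h i => h _ i.2
  choose! T hT hTc using fun (μ : ∀ i : Fin (n + 1), Fin ((i : ℕ) + 1) → ℤ)
    (hμ : IsStaircasePattern μ) => hμ.exists_transpose
  have hTinj : Set.InjOn T {μ | IsStaircasePattern μ} := fun μ hμ ν hν h =>
    IsStaircasePattern.ext_rowCount hμ hν fun r c hr hc => by
      rw [← hTc μ hμ c r hc hr, ← hTc ν hν c r hc hr, h]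
  refine le_antisymm ?_ ?_
  · refine Finset.card_le_card_of_injOn T (fun μ hμ => ?_) (hTinj.mono fun μ hμ => ?_)
    · simp only [Finset.mem_coe, Finset.mem_filter, mem_staircasePatterns] at hμ ⊢
      refine ⟨hT μ hμ.1, (hhead (hT μ hμ.1)).2 fun r hr => ?_⟩
      have := hTc μ hμ.1 r 1 hr (by omega)
      rw [Nat.cast_one] at this
      rw [this]
      exact (hbot hμ.1).1 hμ.2 r hr
    · simp only [Finset.mem_coe, Finset.mem_filter, mem_staircasePatterns] at hμ
      exact hμ.1
  · refine Finset.card_le_card_of_injOn T (fun μ hμ => ?_) (hTinj.mono fun μ hμ => ?_)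
    · simp only [Finset.mem_coe, Finset.mem_filter, mem_staircasePatterns] at hμ ⊢
      refine ⟨hT μ hμ.1, (hbot (hT μ hμ.1)).2 fun c hc => ?_⟩
      have := hTc μ hμ.1 1 c (by omega) hc
      rw [Nat.cast_one] at this
      rw [this]
      exact (hhead hμ.1).1 hμ.2 c hc
    · simp only [Finset.mem_coe, Finset.mem_filter, mem_staircasePatterns] at hμ
      exact hμ.1

theorem patternSum_headWeight_stairs {n j : ℕ} (hj : 1 ≤ j) (hjn : j ≤ n + 1) :
    patternSum (headWeight j) (n + 1) (stairs (n + 1)) = bottomCount n j := by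
  classical
  rw [bottomCount_eq_card_heads hj hjn]
  have h := (card_patternsBelow (fun r m => j ≤ r ↔ ∃ h : 0 < r, m ⟨0, h⟩ = 1)
    (fun m => iff_of_false (by omega) (by simp)) (strictMono_stairs (n + 1))).2
  have hw : headWeight j = fun r m =>
      @ite ℤ (j ≤ r ↔ ∃ h : 0 < r, m ⟨0, h⟩ = 1) (Classical.propDecidable _) 1 0 := by
    funext r m
    unfold headWeight
    congr
  rw [hw]
  refine h.symm.trans ?_
  rw [← Set.ncard_coe_finset]
  congr 2
  ext μ
  simp only [patternsBelow, Set.mem_ofPred_eq, Finset.coe_filter, mem_staircasePatterns,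
    IsStaircasePattern, and_assoc, funext_iff]
  refine and_congr_right fun _ => and_congr_right fun htop => ?_
  rw [Fin.forall_fin_succ']
  have h1 : j ≤ ((Fin.last n : Fin (n + 1)) : ℕ) + 1 ↔ μ (Fin.last n) 0 = 1 :=
    iff_of_true hjn (htop 0)
  simp only [h1, and_true]
  refine forall_congr' fun i => iff_congr Iff.rfl ?_
  simp

theorem cons_two_eq_stairs_reflect (d x : ℕ) :
    (Fin.cons (2 - x) (fun i : Fin d => (i : ℤ) + 2) : Fin (d + 1) → ℤ) = fun i : Fin (d + 1) =>
      (d + 2 : ℤ) - (Fin.snoc (fun i : Fin d => (i : ℤ) + 1) (x + d : ℤ) :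
        Fin (d + 1) → ℤ) i.rev := by
  funext i
  refine Fin.cases ?_ (fun i => ?_) i
  · rw [Fin.rev_zero, Fin.snoc_last, Fin.cons_zero]
    ring
  · rw [Fin.rev_succ, Fin.snoc_castSucc, Fin.cons_succ, Fin.val_rev]
    omega

theorem cons_one_eq_stairs (d : ℕ) :
    (Fin.cons 1 (fun i : Fin d => (i : ℤ) + 2) : Fin (d + 1) → ℤ) = stairs (d + 1) := by
  funext i
  refine Fin.cases ?_ (fun i => ?_) i
  · rfl
  · simp only [Fin.cons_succ, stairs, Fin.val_succ]
    push_cast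
    ring

theorem countCoeff_cons_two (d : ℕ) {x : ℕ} (hx : 1 ≤ x) :
    countCoeff (d + 1) 0 (Fin.cons (2 - x) fun i : Fin d => (i : ℤ) + 2) =
      ∑ a ∈ Finset.range (d + 1), (bottomCount d (a + 1) : ℤ) * ((x + a - 1).choose a : ℤ) := by
  have hs := strictMono_stairs (d + 1)
  rw [← cons_one_eq_stairs] at hs
  have hs2 : StrictMono (Fin.cons (2 - x) fun i : Fin d => (i : ℤ) + 2 : Fin (d + 1) → ℤ) :=
    Fin.strictMono_cons.2 ⟨fun j => by omega, (Fin.strictMono_cons.1 hs).2⟩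
  rw [← patternSum_one hs2, patternSum_cons_two_sub hs hx]
  refine Finset.sum_congr rfl fun a ha => ?_
  have had := Finset.mem_range.1 ha
  rw [cons_one_eq_stairs, patternSum_headWeight_stairs (by omega) (by omega),
    ← bottomCount_reflect]
  congr 3
  omega

theorem countCoeff_snoc_eq_cons (d : ℕ) {x : ℕ} (hx : 1 ≤ x) :
    countCoeff (d + 1) 0 (Fin.snoc (fun i : Fin d => (i : ℤ) + 1) (x + d : ℤ) : Fin (d + 1) → ℤ) =
      countCoeff (d + 1) 0 (Fin.cons (2 - x) fun i : Fin d => (i : ℤ) + 2) := by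
  have hs : StrictMono
      (Fin.snoc (fun i : Fin d => (i : ℤ) + 1) (x + d : ℤ) : Fin (d + 1) → ℤ) := by
    intro i j
    refine Fin.lastCases (fun h => ?_) (fun j h => ?_) j
    · obtain ⟨i, rfl⟩ := Fin.exists_castSucc_eq.2 h.ne
      simp only [Fin.snoc_last, Fin.snoc_castSucc]
      omega
    · obtain ⟨i, rfl⟩ := Fin.exists_castSucc_eq.2 (h.trans_le (Fin.le_last _)).ne
      simp only [Fin.snoc_castSucc]
      have : (i : ℕ) < j := h
      omega
  rw [cons_two_eq_stairs_reflect, ← patternSum_one hs, ← patternSum_one (hs.reflect _),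
    patternSum_reflect]

theorem sum_bottomCount_mul_sq_le (d : ℕ) :
    ∑ a ∈ Finset.range (d + 1), (bottomCount d (a + 1) : ℝ) * (2 * a - d) ^ 2 ≤
      (6 * d + 1) * ∑ a ∈ Finset.range (d + 1), (bottomCount d (a + 1) : ℝ) := by
  refine second_moment_le (α := fun a : ℕ => (bottomCount d (a + 1) : ℝ))
    (fun a => Nat.cast_nonneg _) (fun a ha => ?_) fun x hx => ?_
  · rw [← bottomCount_reflect]
    congr 2
    omega
  · exact_mod_cast sum_alternating_choose (α := fun a : ℕ => (bottomCount d (a + 1) : ℤ))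
      (fun x hx => countCoeff_cons_two d hx) (fun x hx => countCoeff_snoc_eq_cons d hx) hx

theorem sum_staircasePatterns_bottom {d : ℕ} (F : ℤ → ℝ) :
    ∑ μ ∈ staircasePatterns d, F (μ 0 0) =
      ∑ a ∈ Finset.range (d + 1), (bottomCount d (a + 1) : ℝ) * F (a + 1) := by
  rw [← Finset.sum_fiberwise_of_maps_to (s := staircasePatterns d) (t := Finset.range (d + 1))
    (g := fun μ => (μ 0 0 - 1).toNat)]
  · refine Finset.sum_congr rfl fun a _ => ?_
    rw [bottomCount, ← nsmul_eq_mul, ← Finset.sum_const]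
    refine Finset.sum_congr (Finset.filter_congr fun μ hμ => ?_) fun μ hμ => ?_
    · have := (mem_staircasePatterns.1 hμ).bounds 0 0
      omega
    · rw [(Finset.mem_filter.1 hμ).2]
  · intro μ hμ
    have := (mem_staircasePatterns.1 hμ).bounds 0 0
    rw [Finset.mem_range]
    omega

theorem sum_bottom_sq_le (d : ℕ) :
    ∑ μ ∈ staircasePatterns d, (2 * (μ 0 0 : ℝ) - (d + 2)) ^ 2 ≤
      (6 * d + 1) * ((staircasePatterns d).card : ℝ) := by
  have h := sum_staircasePatterns_bottom (d := d) fun _ => (1 : ℝ)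
  simp only [mul_one, Finset.sum_const, nsmul_eq_mul] at h
  rw [h, sum_staircasePatterns_bottom fun z : ℤ => (2 * (z : ℝ) - (d + 2)) ^ 2]
  refine le_of_eq_of_le (Finset.sum_congr rfl fun a _ => ?_) (sum_bottomCount_mul_sq_le d)
  push_cast
  ring

/-- Replace the last entry of row `i` by `y`. -/
def replaceLast {n : ℕ} (i : Fin (n + 1)) (y : ℤ) (μ : ∀ i : Fin (n + 1), Fin ((i : ℕ) + 1) → ℤ) :
    ∀ i : Fin (n + 1), Fin ((i : ℕ) + 1) → ℤ :=
  Function.update μ i (Function.update (μ i) (Fin.last i) y)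

theorem replaceLast_last {n : ℕ} (i : Fin (n + 1)) (y : ℤ)
    (μ : ∀ i : Fin (n + 1), Fin ((i : ℕ) + 1) → ℤ) : replaceLast i y μ i (Fin.last i) = y := by
  rw [replaceLast, Function.update_self, Function.update_self]

theorem replaceLast_of_ne {n : ℕ} {i : Fin (n + 1)} {y : ℤ}
    {μ : ∀ i : Fin (n + 1), Fin ((i : ℕ) + 1) → ℤ} {j : Fin (n + 1)} {b : Fin ((j : ℕ) + 1)}
    (h : (j : ℕ) ≠ i ∨ (b : ℕ) ≠ i) : replaceLast i y μ j b = μ j b := by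
  rw [replaceLast]
  by_cases hj : j = i
  · subst hj
    have hb : b ≠ Fin.last j := fun hb => by simp [hb] at h
    rw [Function.update_self, Function.update_of_ne hb]
  · rw [Function.update_of_ne hj]

theorem le_replaceLast {n : ℕ} {i : Fin (n + 1)} {y : ℤ}
    {μ : ∀ i : Fin (n + 1), Fin ((i : ℕ) + 1) → ℤ} (hy : μ i (Fin.last i) ≤ y) (j : Fin (n + 1))
    (b : Fin ((j : ℕ) + 1)) : μ j b ≤ replaceLast i y μ j b := by
  by_cases h : (j : ℕ) ≠ i ∨ (b : ℕ) ≠ i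
  · rw [replaceLast_of_ne h]
  · push Not at h
    obtain rfl := Fin.ext h.1
    obtain rfl : b = Fin.last j := Fin.ext h.2
    rwa [replaceLast_last]

theorem IsStaircasePattern.replaceLast {n : ℕ} {μ : ∀ i : Fin (n + 1), Fin ((i : ℕ) + 1) → ℤ}
    (h : IsStaircasePattern μ) {i : Fin (n + 1)} (hi : (i : ℕ) + 1 < n + 1) {y : ℤ}
    (hy : μ i (Fin.last i) ≤ y) (hy' : y ≤ μ ⟨i + 1, hi⟩ (Fin.last (i + 1))) :
    IsStaircasePattern (replaceLast i y μ) := by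
  refine ⟨⟨fun j a b hab => ?_, fun j hj b => ⟨?_, ?_⟩⟩, fun b => ?_⟩
  · rw [replaceLast_of_ne (by have : (a : ℕ) < b := hab; omega)]
    exact (h.1.1 j hab).trans_le (le_replaceLast hy j b)
  · rw [replaceLast_of_ne (by simp only [Fin.val_castSucc]; omega)]
    exact (h.1.2 j hj b).1.trans (le_replaceLast hy j b)
  · refine le_trans ?_ (le_replaceLast hy _ _)
    by_cases hjb : (j : ℕ) ≠ i ∨ (b : ℕ) ≠ i
    · rw [replaceLast_of_ne hjb]
      exact (h.1.2 j hj b).2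
    · push Not at hjb
      obtain rfl := Fin.ext hjb.1
      obtain rfl : b = Fin.last j := Fin.ext hjb.2
      rwa [replaceLast_last]
  · rw [replaceLast_of_ne (Or.inl (by simp only [Fin.val_last]; omega))]
    exact h.2 b

open Classical in
/-- The patterns whose row `i` has an entry at distance at least `E / 2` from the centre. -/
noncomputable def deviatingPatterns (n : ℕ) (i : Fin (n + 1)) (E : ℝ) :
    Finset (∀ i : Fin (n + 1), Fin ((i : ℕ) + 1) → ℤ) :=
  (staircasePatterns n).filter fun μ => ∃ b, E ≤ |2 * (μ i b : ℝ) - (n + 2)|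

theorem mem_deviatingPatterns {n : ℕ} {i : Fin (n + 1)} {E : ℝ}
    {μ : ∀ i : Fin (n + 1), Fin ((i : ℕ) + 1) → ℤ} : μ ∈ deviatingPatterns n i E ↔
      IsStaircasePattern μ ∧ ∃ b, E ≤ |2 * (μ i b : ℝ) - (n + 2)| := by
  rw [deviatingPatterns, Finset.mem_filter, mem_staircasePatterns]

theorem card_deviatingPatterns_le_two_mul {n : ℕ} (i : Fin (n + 1)) (E : ℝ) :
    (deviatingPatterns n i E).card ≤ 2 * ((deviatingPatterns n i E).filter fun μ =>
      (n + 2 : ℤ) ≤ μ i (Fin.last i) + μ i 0).card := by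
  rw [← Finset.card_filter_add_card_filter_not
    (fun μ : ∀ i : Fin (n + 1), Fin ((i : ℕ) + 1) → ℤ =>
      (n + 2 : ℤ) ≤ μ i (Fin.last i) + μ i 0), two_mul]
  refine Nat.add_le_add_left (Finset.card_le_card_of_injOn (fun μ i b => (n + 2 : ℤ) - μ i b.rev)
    (fun μ hμ => ?_) fun μ _ ν _ h => ?_) _
  · rw [Finset.mem_coe, Finset.mem_filter, mem_deviatingPatterns] at hμ ⊢
    obtain ⟨⟨h1, b, hb⟩, h2⟩ := hμ
    refine ⟨⟨h1.reflect, b.rev, ?_⟩, ?_⟩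
    · rw [Fin.rev_rev, ← abs_neg]
      push_cast
      convert hb using 2
      ring
    · simp only [Fin.rev_last, Fin.rev_zero]
      omega
  · funext i b
    have := congrFun (congrFun h i) b.rev
    simpa using this

theorem card_filter_deviatingPatterns_le {n i : ℕ} (hi : i + 1 < n + 1) (E : ℝ) :
    ((deviatingPatterns n ⟨i + 1, hi⟩ E).filter fun μ =>
      (n + 2 : ℤ) ≤ μ ⟨i + 1, hi⟩ (Fin.last (i + 1)) + μ ⟨i + 1, hi⟩ 0).card ≤
      4 * (deviatingPatterns n ⟨i, by omega⟩ (E / 2)).card := by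
  set j : Fin (n + 1) := ⟨i, by omega⟩ with hj
  set gap : (∀ i : Fin (n + 1), Fin ((i : ℕ) + 1) → ℤ) → ℤ := fun μ =>
    μ ⟨i + 1, hi⟩ (Fin.last (i + 1)) - μ j (Fin.last i) with hgap
  rw [mul_comm, ← Finset.card_range 4, ← Finset.card_product]
  refine Finset.card_le_card_of_injOn (fun μ => (replaceLast j
    (μ ⟨i + 1, hi⟩ (Fin.last (i + 1)) - gap μ / 4) μ, (gap μ % 4).toNat)) (fun μ hμ => ?_)
    fun μ hμ ν hν h => ?_
  · rw [Finset.mem_coe, Finset.mem_filter, mem_deviatingPatterns] at hμ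
    obtain ⟨⟨h1, b, hb⟩, h2⟩ := hμ
    have h3 := h1.1.2 j hi (Fin.last i)
    have h4 : μ ⟨i + 1, hi⟩ 0 ≤ μ ⟨i + 1, hi⟩ (Fin.last i).castSucc :=
      (h1.1.1 _).monotone (Fin.zero_le _)
    have h5 : μ ⟨i + 1, hi⟩ b ≤ μ ⟨i + 1, hi⟩ (Fin.last (i + 1)) :=
      (h1.1.1 _).monotone (Fin.le_last _)
    have h6 : μ ⟨i + 1, hi⟩ 0 ≤ μ ⟨i + 1, hi⟩ b := (h1.1.1 _).monotone (Fin.zero_le _)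
    have h7 : gap μ = μ ⟨i + 1, hi⟩ (Fin.last (i + 1)) - μ j (Fin.last i) := rfl
    have h8 : μ j (Fin.last i) ≤ μ ⟨i + 1, hi⟩ (Fin.last (i + 1)) := h3.2
    have h9 : μ ⟨i + 1, hi⟩ (Fin.last i).castSucc ≤ μ j (Fin.last i) := h3.1
    generalize hy : μ ⟨i + 1, hi⟩ (Fin.last (i + 1)) - gap μ / 4 = y
    simp only [Finset.coe_product, Set.mem_prod, Finset.mem_coe, Finset.mem_range,
      mem_deviatingPatterns, hy]
    refine ⟨⟨h1.replaceLast hi (show μ j (Fin.last i) ≤ y by omega)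
      (show y ≤ μ ⟨i + 1, hi⟩ (Fin.last (i + 1)) by omega), Fin.last i, ?_⟩,
      by omega⟩
    rw [show replaceLast j y μ j (Fin.last i) = y from replaceLast_last j y μ]
    refine le_trans ?_ (le_abs_self _)
    have h10 : 2 * μ ⟨i + 1, hi⟩ (Fin.last (i + 1)) - (n + 2) ≤ 2 * (2 * y - (n + 2)) := by omega
    have h11 : (2 * μ ⟨i + 1, hi⟩ (Fin.last (i + 1)) - (n + 2) : ℝ) ≤ 2 * (2 * y - (n + 2)) := by
      exact_mod_cast h10
    have h12 : |2 * μ ⟨i + 1, hi⟩ b - (n + 2)| ≤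
        2 * μ ⟨i + 1, hi⟩ (Fin.last (i + 1)) - (n + 2) := abs_le.2 ⟨by omega, by omega⟩
    have h13 : |2 * (μ ⟨i + 1, hi⟩ b : ℝ) - (n + 2)| ≤
        2 * μ ⟨i + 1, hi⟩ (Fin.last (i + 1)) - (n + 2) := by exact_mod_cast h12
    linarith
  · obtain ⟨h1, h2⟩ := Prod.ext_iff.1 h
    have h3 : ∀ (l : Fin (n + 1)) (b : Fin ((l : ℕ) + 1)), (l : ℕ) ≠ j ∨ (b : ℕ) ≠ j →
        μ l b = ν l b := fun l b hb => by
      have := congrFun (congrFun h1 l) b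
      simpa only [replaceLast_of_ne hb] using this
    have h4 := h3 ⟨i + 1, hi⟩ (Fin.last (i + 1)) (Or.inl (Nat.succ_ne_self i))
    have h5 := congrFun (congrFun h1 j) (Fin.last i)
    have h6 : μ ⟨i + 1, hi⟩ (Fin.last (i + 1)) - gap μ / 4 =
        ν ⟨i + 1, hi⟩ (Fin.last (i + 1)) - gap ν / 4 :=
      (replaceLast_last j _ μ).symm.trans (h5.trans (replaceLast_last j _ ν))
    have h7 : (gap μ % 4).toNat = (gap ν % 4).toNat := h2
    have h8 : gap μ = μ ⟨i + 1, hi⟩ (Fin.last (i + 1)) - μ j (Fin.last i) := rfl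
    have h9 : gap ν = ν ⟨i + 1, hi⟩ (Fin.last (i + 1)) - ν j (Fin.last i) := rfl
    have h10 : μ j (Fin.last i) = ν j (Fin.last i) := by omega
    funext l b
    by_cases hb : (l : ℕ) ≠ j ∨ (b : ℕ) ≠ j
    · exact h3 l b hb
    · push Not at hb
      obtain rfl := Fin.ext hb.1
      obtain rfl : b = Fin.last _ := Fin.ext hb.2
      exact h10

theorem card_deviatingPatterns_le {n i : ℕ} (hi : i < n + 1) (E : ℝ) :
    (deviatingPatterns n ⟨i, hi⟩ E).card ≤
      8 ^ i * (deviatingPatterns n 0 (E / 2 ^ i)).card := by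
  induction i generalizing E with
  | zero => simp
  | succ i ih =>
    have h1 := card_deviatingPatterns_le_two_mul ⟨i + 1, hi⟩ E
    have h2 := card_filter_deviatingPatterns_le hi E
    have h3 := ih (by omega) (E / 2)
    rw [div_div, ← pow_succ'] at h3
    rw [pow_succ, mul_assoc, mul_left_comm]
    refine h1.trans ?_
    have h4 := Nat.mul_le_mul_left 2 (h2.trans (Nat.mul_le_mul_left 4 h3))
    refine h4.trans (le_of_eq ?_)
    ring

theorem card_deviatingPatterns_zero_mul_sq_le (n : ℕ) {E : ℝ} (hE : 0 ≤ E) :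
    ((deviatingPatterns n 0 E).card : ℝ) * E ^ 2 ≤
      (6 * n + 1) * ((staircasePatterns n).card : ℝ) := by
  rw [← nsmul_eq_mul, ← Finset.sum_const]
  refine le_trans ?_ (sum_bottom_sq_le n)
  refine (Finset.sum_le_sum fun μ hμ => ?_).trans (Finset.sum_le_sum_of_subset_of_nonneg
    (Finset.filter_subset _ _) fun _ _ _ => sq_nonneg _)
  obtain ⟨-, b, hb⟩ := mem_deviatingPatterns.1 hμ
  obtain rfl : b = 0 := Fin.ext (by have := b.2; simp only [Fin.val_zero] at this ⊢; omega)
  rw [← sq_abs (2 * (μ 0 0 : ℝ) - _)]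
  exact pow_le_pow_left₀ hE hb 2

theorem card_deviatingPatterns_mul_sq_le {n i : ℕ} (hi : i < n + 1) {E : ℝ} (hE : 0 ≤ E) :
    ((deviatingPatterns n ⟨i, hi⟩ E).card : ℝ) * E ^ 2 ≤
      32 ^ i * ((6 * n + 1) * ((staircasePatterns n).card : ℝ)) := by
  have h1 : ((deviatingPatterns n ⟨i, hi⟩ E).card : ℝ) ≤
      8 ^ i * ((deviatingPatterns n 0 (E / 2 ^ i)).card : ℝ) := by
    exact_mod_cast card_deviatingPatterns_le hi E
  have h2 := card_deviatingPatterns_zero_mul_sq_le n (E := E / 2 ^ i) (by positivity)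
  have h3 : (32 : ℝ) ^ i = 8 ^ i * (2 ^ i) ^ 2 := by
    rw [← pow_mul, mul_comm i, pow_mul, ← mul_pow]
    norm_num
  calc _ ≤ 8 ^ i * ((deviatingPatterns n 0 (E / 2 ^ i)).card : ℝ) * E ^ 2 := by gcongr
    _ = 32 ^ i * (((deviatingPatterns n 0 (E / 2 ^ i)).card : ℝ) * (E / 2 ^ i) ^ 2) := by
      rw [h3]
      field_simp
    _ ≤ _ := by gcongr

/-- Tightness: for `ξ(N)` uniformly random in `𝔾𝕋^{(N)}_{(1,2,…,N)}` and any fixed `k ≥ 1`,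
the laws of the vectors `N^{-1/2}(ξ(N)^k_b − N/2)_{b=1,…,k}`, `N ≥ k`, are tight: for every
`ε > 0` there is a compact `K ⊆ ℝ^k` containing the vector with probability at least `1 − ε`,
uniformly in `N ≥ k`.  (Probabilities are written as counting ratios.) -/
theorem gt_row_tightness (k : ℕ) (hk : 1 ≤ k) :
    ∀ ε : ℝ, 0 < ε → ∃ K : Set (Fin k → ℝ), IsCompact K ∧
      ∀ N : ℕ, ∀ hN : k ≤ N,
        (Nat.card {μ : ∀ i : Fin N, Fin ((i : ℕ) + 1) → ℤ //
            IsGTPattern μ ∧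
            (∀ b : Fin (N - 1 + 1), μ ⟨N - 1, by omega⟩ b = ((b : ℕ) + 1 : ℤ)) ∧
            (fun b : Fin k =>
              ((μ ⟨k - 1, by omega⟩ ⟨(b : ℕ), show (b : ℕ) < k - 1 + 1 by omega⟩ : ℤ) - (N : ℝ) / 2) /
                Real.sqrt (N : ℝ)) ∈ K} : ℝ) ≥
        (1 - ε) *
          (Nat.card {μ : ∀ i : Fin N, Fin ((i : ℕ) + 1) → ℤ //
            IsGTPattern μ ∧
            (∀ b : Fin (N - 1 + 1), μ ⟨N - 1, by omega⟩ b = ((b : ℕ) + 1 : ℤ))} : ℝ) := by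
  classical
  intro ε hε
  set M : ℝ := 1 + 6 * 32 ^ (k - 1) / ε with hM
  have hM1 : 1 ≤ M := le_add_of_nonneg_right (by positivity)
  refine ⟨Set.Icc (fun _ => -M) fun _ => M, isCompact_Icc, fun N hN => ?_⟩
  obtain ⟨n, rfl⟩ : ∃ n, N = n + 1 := ⟨N - 1, by omega⟩
  let P : (∀ i : Fin (n + 1), Fin ((i : ℕ) + 1) → ℤ) → Prop := fun μ => (fun b : Fin k =>
    ((μ ⟨k - 1, by omega⟩ ⟨(b : ℕ), show (b : ℕ) < k - 1 + 1 by omega⟩ : ℤ) -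
      ((n + 1 : ℕ) : ℝ) / 2) / √((n + 1 : ℕ) : ℝ)) ∈ Set.Icc (fun _ => -M) fun _ => M
  suffices h : (1 - ε) * ((staircasePatterns n).card : ℝ) ≤
      ((staircasePatterns n).filter P).card by
    refine le_of_eq_of_le (congrArg (fun m : ℕ => (1 - ε) * (m : ℝ)) (Nat.subtype_card
      (staircasePatterns n) fun μ => mem_staircasePatterns)) (h.trans_eq (congrArg Nat.cast
      (Nat.subtype_card ((staircasePatterns n).filter P) fun μ => ?_).symm))
    rw [Finset.mem_filter, mem_staircasePatterns]
    exact and_assoc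
  have hs : 1 ≤ √((n + 1 : ℕ) : ℝ) := Real.one_le_sqrt.2 (by simp)
  have hss : √((n + 1 : ℕ) : ℝ) ^ 2 = n + 1 := by
    rw [Real.sq_sqrt (by positivity)]
    push_cast
    rfl
  set s := √((n + 1 : ℕ) : ℝ)
  have hbad : (staircasePatterns n).filter (fun μ => ¬ P μ) ⊆
      deviatingPatterns n ⟨k - 1, by omega⟩ (M * s) := by
    intro μ hμ
    rw [Finset.mem_filter, mem_staircasePatterns] at hμ
    refine mem_deviatingPatterns.2 ⟨hμ.1, ?_⟩
    by_contra! h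
    refine hμ.2 (Set.mem_Icc.2 ⟨fun b => ?_, fun b => ?_⟩) <;>
    have hb := abs_lt.1 (h ⟨(b : ℕ), show (b : ℕ) < k - 1 + 1 by omega⟩) <;>
    have hMs : 1 ≤ M * s := one_le_mul_of_one_le_of_one_le hM1 hs
    · refine (le_div_iff₀ (c := s) (by positivity)).2 ?_
      push_cast
      linarith [hb.1]
    · refine (div_le_iff₀ (c := s) (by positivity)).2 ?_
      push_cast
      linarith [hb.2]
  have h1 := card_deviatingPatterns_mul_sq_le (n := n) (i := k - 1) (by omega)
    (E := M * s) (by positivity)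
  have h2 := Finset.card_filter_add_card_filter_not (s := staircasePatterns n) P
  have h3 := Finset.card_le_card hbad
  have h4 : ((deviatingPatterns n ⟨k - 1, by omega⟩ (M * s)).card : ℝ) ≤
      ε * ((staircasePatterns n).card : ℝ) := by
    have h5 : 6 * 32 ^ (k - 1) ≤ ε * M ^ 2 := by
      have : 6 * 32 ^ (k - 1) ≤ ε * M := by
        rw [hM, mul_add, mul_div_cancel₀ _ hε.ne']
        linarith
      refine this.trans ?_
      gcongr
      nlinarith
    have h6 : (0 : ℝ) < (M * s) ^ 2 := by positivity
    refine le_of_mul_le_mul_right (h1.trans ?_) h6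
    rw [mul_pow, hss]
    calc _ ≤ 32 ^ (k - 1) * ((6 * (n + 1)) * ((staircasePatterns n).card : ℝ)) := by
          gcongr
          linarith
      _ = 6 * 32 ^ (k - 1) * ((n + 1) * ((staircasePatterns n).card : ℝ)) := by ring
      _ ≤ ε * M ^ 2 * ((n + 1) * ((staircasePatterns n).card : ℝ)) := by gcongr
      _ = _ := by ring
  have h7 := (Nat.cast_le (α := ℝ)).2 h3
  have h8 := congrArg (Nat.cast (R := ℝ)) h2
  rw [Nat.cast_add] at h8
  linarith
end

section
/- Fix N ≥ 2 and integers A_1 < A_2 < … < A_{N−1} < B. Let (x_1, x_2, …, x_{N−1}) be a uniformly random element of the (finite, nonempty) set of integer tuples satisfying x_1 ≤ x_2 ≤ … ≤ x_{N−1} ≤ B and x_i ≥ A_i for all 1 ≤ i ≤ N−1. Then Prob( x_1 ≤ A_1 + (B − A_1)/2^N ) ≥ 2^{−N−1}. -/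
theorem Monotone.update_bot_of_le {ι α : Type*} [PartialOrder ι] [DecidableEq ι] [Preorder α]
    {x : ι → α} (hx : Monotone x) {i₀ : ι} (hi₀ : IsBot i₀) {a : α} (ha : a ≤ x i₀) :
    Monotone (Function.update x i₀ a) := by
  intro i j hij
  by_cases hj : j = i₀
  · have hi : i = i₀ := le_antisymm (hij.trans hj.le) (hi₀ i)
    simp [hi, hj]
  · by_cases hi : i = i₀
    · simpa [hi, hj] using ha.trans (hx (hi₀ j))
    · simpa [hi, hj] using hx hij


/-- For integers `A_1 < A_2 < … < A_{N−1} < B` and `(x_1,…,x_{N−1})` uniform on the set of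
integer tuples with `x_1 ≤ … ≤ x_{N−1} ≤ B` and `x_i ≥ A_i`, we have
`Prob(x_1 ≤ A_1 + (B − A_1)/2^N) ≥ 2^{−N−1}` (probabilities written as counting ratios). -/
theorem first_coordinate_lower_tail (N : ℕ) (hN : 2 ≤ N)
    (A : Fin (N - 1) → ℤ) (B : ℤ) (hA : StrictMono A)
    (hAB : A ⟨N - 2, by omega⟩ < B) :
    (Nat.card {x : Fin (N - 1) → ℤ //
        (Monotone x ∧ (∀ i, x i ≤ B) ∧ (∀ i, A i ≤ x i)) ∧
        ((x ⟨0, by omega⟩ : ℝ) ≤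
          (A ⟨0, by omega⟩ : ℝ) + ((B : ℝ) - (A ⟨0, by omega⟩ : ℝ)) / 2 ^ N)} : ℝ) ≥
    ((2 : ℝ) ^ (N + 1))⁻¹ *
      (Nat.card {x : Fin (N - 1) → ℤ //
        Monotone x ∧ (∀ i, x i ≤ B) ∧ (∀ i, A i ≤ x i)} : ℝ) := by
  set i₀ : Fin (N - 1) := ⟨0, by omega⟩
  have hi₀ : IsBot i₀ := fun i => Nat.zero_le i.val
  set m : ℤ := 2 ^ N with hm
  have hm0 : 0 < m := by positivity
  let P (x : Fin (N - 1) → ℤ) : Prop := Monotone x ∧ (∀ i, x i ≤ B) ∧ (∀ i, A i ≤ x i)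
  let Q (x : Fin (N - 1) → ℤ) : Prop :=
    P x ∧ (x i₀ : ℝ) ≤ (A i₀ : ℝ) + ((B : ℝ) - (A i₀ : ℝ)) / 2 ^ N
  have hfin : Finite {x // Q x} :=
    ((Set.finite_Icc A (fun _ => B)).subset fun x hx => ⟨hx.1.2.2, hx.1.2.1⟩).to_subtype
  have hQ (x : Fin (N - 1) → ℤ) (hx : P x) :
      Q (Function.update x i₀ (A i₀ + (x i₀ - A i₀) / m)) := by
    obtain ⟨hmono, hB, hAx⟩ := hx
    have hd : 0 ≤ x i₀ - A i₀ := sub_nonneg.2 (hAx i₀)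
    have hle : A i₀ + (x i₀ - A i₀) / m ≤ x i₀ := by
      have := Int.ediv_le_self m hd
      linarith
    refine ⟨⟨hmono.update_bot_of_le hi₀ hle, fun i => ?_, fun i => ?_⟩, ?_⟩
    · rcases eq_or_ne i i₀ with rfl | hi
      · simpa using hle.trans (hB _)
      · simpa [hi] using hB i
    · rcases eq_or_ne i i₀ with rfl | hi
      · simpa using Int.ediv_nonneg hd hm0.le
      · simpa [hi] using hAx i
    · have hq : (((x i₀ - A i₀) / m : ℤ) : ℝ) ≤ ((B : ℝ) - A i₀) / 2 ^ N := by
        rw [le_div_iff₀ (by positivity)]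
        have h : (x i₀ - A i₀) / m * m ≤ B - A i₀ :=
          (Int.ediv_mul_le _ hm0.ne').trans (sub_le_sub_right (hB i₀) _)
        rw [hm] at h ⊢
        exact_mod_cast h
      simpa using hq
  let f (x : {x // P x}) : {x // Q x} × Set.Ico (0 : ℤ) m :=
    (⟨_, hQ x.1 x.2⟩,
      ⟨(x.1 i₀ - A i₀) % m, Int.emod_nonneg _ hm0.ne', Int.emod_lt_of_pos _ hm0⟩)
  have hf : Function.Injective f := by
    rintro ⟨x, hx⟩ ⟨y, hy⟩ hxy
    simp only [f, Prod.mk.injEq, Subtype.mk.injEq] at hxy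
    obtain ⟨hu, hr⟩ := hxy
    replace hr : (x i₀ - A i₀) % m = (y i₀ - A i₀) % m := congrArg Subtype.val hr
    refine Subtype.ext (funext fun i => ?_)
    have hui := congrFun hu i
    rcases eq_or_ne i i₀ with rfl | hi
    · simp only [Function.update_self, add_right_inj] at hui
      have hx' := Int.emod_add_mul_ediv (x i₀ - A i₀) m
      rw [hui, hr, Int.emod_add_mul_ediv] at hx'
      exact (sub_left_inj.1 hx').symm
    · simpa [hi] using hui
  have hcard : Nat.card {x // P x} ≤ Nat.card {x // Q x} * 2 ^ N := by
    have h := Nat.card_le_card_of_injective f hf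
    rwa [Nat.card_prod, show Nat.card (Set.Ico (0 : ℤ) m) = 2 ^ N by
      simp [hm, Int.toNat_pow_of_nonneg]] at h
  have hreal : (Nat.card {x // P x} : ℝ) ≤ Nat.card {x // Q x} * 2 ^ N := by
    exact_mod_cast hcard
  change (Nat.card {x // Q x} : ℝ) ≥ ((2 : ℝ) ^ (N + 1))⁻¹ * (Nat.card {x // P x} : ℝ)
  rw [ge_iff_le, inv_mul_le_iff₀ (by positivity), pow_succ]
  have : (0 : ℝ) ≤ 2 ^ N * Nat.card {x // Q x} := by positivity
  linarith
end

section
/- Fix N ≥ 2 and integers A_1 < A_2 < … < A_{N−1} < B. Let (x_1, x_2, …, x_{N−1}) be a uniformly random element of the (finite, nonempty) set of integer tuples satisfying x_1 ≤ x_2 ≤ … ≤ x_{N−1} ≤ B and x_i ≥ A_i for all 1 ≤ i ≤ N−1. Then Prob( x_1 ≥ A_1 + (B − A_1)/2^{N−1} ) ≥ 2^{−N−1}; indeed the stronger bound Prob( x_1 ≥ ((2^{N−1} − 1)·A_1 + B)/2^{N−1} ) ≥ 2^{1−N} holds. -/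
/-- The weakly increasing integer tuples `x` with `A ≤ x` and all entries at most `B`. -/
noncomputable def boundedMonotoneTuples {n : ℕ} (A : Fin n → ℤ) (B : ℤ) :
    Finset (Fin n → ℤ) :=
  open Classical in (Finset.Icc A fun _ => B).filter Monotone

theorem mem_boundedMonotoneTuples {n : ℕ} {A : Fin n → ℤ} {B : ℤ} {x : Fin n → ℤ} :
    x ∈ boundedMonotoneTuples A B ↔ Monotone x ∧ (∀ i, x i ≤ B) ∧ ∀ i, A i ≤ x i := by
  simp only [boundedMonotoneTuples, Finset.mem_filter, Finset.mem_Icc, Pi.le_def]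
  tauto

theorem boundedMonotoneTuples_subset {n : ℕ} (A : Fin n → ℤ) {B C : ℤ} (h : B ≤ C) :
    boundedMonotoneTuples A B ⊆ boundedMonotoneTuples A C := by
  intro x hx
  rw [mem_boundedMonotoneTuples] at hx ⊢
  exact ⟨hx.1, fun i => (hx.2.1 i).trans h, hx.2.2⟩

theorem snoc_mem_boundedMonotoneTuples {n : ℕ} {A : Fin (n + 1) → ℤ} {B c : ℤ}
    {y : Fin n → ℤ} :
    (Fin.snoc y c : Fin (n + 1) → ℤ) ∈ boundedMonotoneTuples A B ↔
      c ∈ Finset.Icc (A (Fin.last n)) B ∧ y ∈ boundedMonotoneTuples (Fin.init A) c := by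
  simp only [mem_boundedMonotoneTuples, Finset.mem_Icc, Fin.forall_fin_succ', Fin.snoc_castSucc,
    Fin.snoc_last, Fin.init]
  constructor
  · rintro ⟨hm, ⟨-, hcB⟩, hA, hAc⟩
    refine ⟨⟨hAc, hcB⟩, fun i j hij => ?_, fun i => ?_, hA⟩
    · simpa using hm (Fin.castSucc_le_castSucc_iff.2 hij)
    · simpa using hm (Fin.le_last i.castSucc)
  · rintro ⟨⟨hAc, hcB⟩, hm, hyc, hA⟩
    refine ⟨fun i j hij => ?_, ⟨fun i => (hyc i).trans hcB, hcB⟩, hA, hAc⟩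
    induction j using Fin.lastCases with
    | last =>
      induction i using Fin.lastCases with
      | last => exact le_rfl
      | cast i => simpa using hyc i
    | cast j =>
      induction i using Fin.lastCases with
      | last => exact absurd hij (not_le.2 (Fin.castSucc_lt_last j))
      | cast i => simpa using hm (Fin.castSucc_le_castSucc_iff.1 hij)

/-- Counting bounded monotone tuples according to their last entry. -/
theorem card_filter_boundedMonotoneTuples {n : ℕ} (A : Fin (n + 1) → ℤ) (B : ℤ)
    (P : (Fin (n + 1) → ℤ) → Prop) [DecidablePred P] :
    ((boundedMonotoneTuples A B).filter P).card =
      ∑ c ∈ Finset.Icc (A (Fin.last n)) B,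
        ((boundedMonotoneTuples (Fin.init A) c).filter fun y => P (Fin.snoc y c)).card := by
  rw [← Finset.card_sigma]
  refine Finset.card_nbij' (fun x => ⟨x (Fin.last n), Fin.init x⟩)
    (fun p => Fin.snoc p.2 p.1) ?_ ?_ ?_ ?_
  · intro x hx
    rw [Finset.mem_coe, Finset.mem_filter, ← Fin.snoc_init_self x,
      snoc_mem_boundedMonotoneTuples] at hx
    simpa [and_assoc] using hx
  · rintro ⟨c, y⟩ hy
    simp only [Finset.mem_coe, Finset.mem_sigma, Finset.mem_filter] at hy
    simp only [Finset.mem_coe, Finset.mem_filter, snoc_mem_boundedMonotoneTuples]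
    tauto
  · intro x _
    exact Fin.snoc_init_self x
  · rintro ⟨c, y⟩ _
    simp

theorem card_boundedMonotoneTuples {n : ℕ} (A : Fin (n + 1) → ℤ) (B : ℤ) :
    (boundedMonotoneTuples A B).card =
      ∑ c ∈ Finset.Icc (A (Fin.last n)) B, (boundedMonotoneTuples (Fin.init A) c).card := by
  simpa using card_filter_boundedMonotoneTuples A B fun _ => True

/-- The upper half of an interval carries at least half of the mass of a monotone function. -/
theorem sum_Icc_le_two_mul_sum_upper_half {g : ℤ → ℕ} (hg : Monotone g) (a b : ℤ) :
    ∑ c ∈ Finset.Icc a b, g c ≤ 2 * ∑ c ∈ Finset.Icc a b with a + b ≤ 2 * c, g c := by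
  rw [← Finset.sum_filter_add_sum_filter_not (Finset.Icc a b) (fun c => a + b ≤ 2 * c), two_mul]
  refine Nat.add_le_add_left ?_ _
  calc ∑ c ∈ Finset.Icc a b with ¬ a + b ≤ 2 * c, g c
      ≤ ∑ c ∈ Finset.Icc a b with ¬ a + b ≤ 2 * c, g (a + b - c) := by
        refine Finset.sum_le_sum fun c hc => hg ?_
        have := (Finset.mem_filter.1 hc).2
        omega
    _ = ∑ c ∈ ((Finset.Icc a b).filter fun c => ¬ a + b ≤ 2 * c).image (a + b - ·), g c :=
        (Finset.sum_image fun _ _ _ _ h => sub_right_injective h).symm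
    _ ≤ _ := by
        refine Finset.sum_le_sum_of_subset fun c hc => ?_
        simp only [Finset.mem_image, Finset.mem_filter, Finset.mem_Icc] at hc ⊢
        omega

theorem card_boundedMonotoneTuples_le (n : ℕ) (A : Fin (n + 1) → ℤ) (B : ℤ) (hA : Monotone A) :
    (boundedMonotoneTuples A B).card ≤ 2 ^ (n + 1) *
      ((boundedMonotoneTuples A B).filter
        fun x => B - A 0 ≤ 2 ^ (n + 1) * (x 0 - A 0)).card := by
  induction n generalizing B with
  | zero =>
    rw [card_boundedMonotoneTuples, card_filter_boundedMonotoneTuples]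
    refine (sum_Icc_le_two_mul_sum_upper_half
      (fun _ _ h => Finset.card_le_card (boundedMonotoneTuples_subset _ h)) _ _).trans ?_
    rw [Finset.sum_filter]
    refine Nat.mul_le_mul le_rfl (Finset.sum_le_sum fun c _ => ?_)
    split_ifs with h
    · refine Finset.card_le_card fun y hy => Finset.mem_filter.2 ⟨hy, ?_⟩
      have h0 : (Fin.snoc y c : Fin 1 → ℤ) 0 = c := Fin.snoc_last (n := 0) (α := fun _ => ℤ) c y
      rw [h0]
      change A 0 + B ≤ 2 * c at h
      omega
    · exact Nat.zero_le _
  | succ n ih =>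
    rw [card_boundedMonotoneTuples, card_filter_boundedMonotoneTuples]
    refine (sum_Icc_le_two_mul_sum_upper_half
      (fun _ _ h => Finset.card_le_card (boundedMonotoneTuples_subset _ h)) _ _).trans ?_
    rw [pow_succ' 2 (n + 1), mul_assoc, Finset.sum_filter, Finset.mul_sum (a := 2 ^ (n + 1))]
    gcongr with c hc
    split_ifs with h
    · refine (ih (Fin.init A) c fun i j hij =>
        hA (Fin.castSucc_le_castSucc_iff.2 hij)).trans ?_
      refine Nat.mul_le_mul_left _ (Finset.card_le_card fun y hy => ?_)
      rw [Finset.mem_filter] at hy ⊢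
      refine ⟨hy.1, ?_⟩
      replace hy := hy.2
      have h0 : (Fin.snoc y c : Fin (n + 2) → ℤ) 0 = y 0 :=
        Fin.snoc_castSucc (α := fun _ => ℤ) c y 0
      have h1 : Fin.init A 0 = A 0 := rfl
      have h2 : A 0 ≤ A (Fin.last (n + 1)) := hA (Fin.zero_le _)
      rw [h1] at hy
      rw [h0, pow_succ' 2 (n + 1), mul_assoc]
      linarith
    · exact Nat.zero_le _


/-- For integers `A_1 < A_2 < … < A_{N−1} < B` and `(x_1,…,x_{N−1})` uniform on the set of
integer tuples with `x_1 ≤ … ≤ x_{N−1} ≤ B` and `x_i ≥ A_i`: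
`Prob(x_1 ≥ A_1 + (B − A_1)/2^{N−1}) ≥ 2^{−N−1}`, and indeed the stronger bound
`Prob(x_1 ≥ ((2^{N−1} − 1)·A_1 + B)/2^{N−1}) ≥ 2^{1−N}` holds
(probabilities written as counting ratios). -/
theorem first_coordinate_upper_tail (N : ℕ) (hN : 2 ≤ N)
    (A : Fin (N - 1) → ℤ) (B : ℤ) (hA : StrictMono A)
    (hAB : A ⟨N - 2, by omega⟩ < B) :
    ((Nat.card {x : Fin (N - 1) → ℤ //
        (Monotone x ∧ (∀ i, x i ≤ B) ∧ (∀ i, A i ≤ x i)) ∧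
        ((A ⟨0, by omega⟩ : ℝ) + ((B : ℝ) - (A ⟨0, by omega⟩ : ℝ)) / 2 ^ (N - 1) ≤
          (x ⟨0, by omega⟩ : ℝ))} : ℝ) ≥
      ((2 : ℝ) ^ (N + 1))⁻¹ *
        (Nat.card {x : Fin (N - 1) → ℤ //
          Monotone x ∧ (∀ i, x i ≤ B) ∧ (∀ i, A i ≤ x i)} : ℝ))
    ∧
    ((Nat.card {x : Fin (N - 1) → ℤ //
        (Monotone x ∧ (∀ i, x i ≤ B) ∧ (∀ i, A i ≤ x i)) ∧
        ((((2 : ℝ) ^ (N - 1) - 1) * (A ⟨0, by omega⟩ : ℝ) + (B : ℝ)) / 2 ^ (N - 1) ≤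
          (x ⟨0, by omega⟩ : ℝ))} : ℝ) ≥
      ((2 : ℝ) ^ (N - 1))⁻¹ *
        (Nat.card {x : Fin (N - 1) → ℤ //
          Monotone x ∧ (∀ i, x i ≤ B) ∧ (∀ i, A i ≤ x i)} : ℝ)) := by
  obtain ⟨n, rfl⟩ : ∃ n, N = n + 2 := ⟨N - 2, by omega⟩
  change Fin (n + 1) → ℤ at A
  classical
  have hcard (P : (Fin (n + 1) → ℤ) → Prop) :
      Nat.card {x : Fin (n + 1) → ℤ //
        (Monotone x ∧ (∀ i, x i ≤ B) ∧ (∀ i, A i ≤ x i)) ∧ P x} =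
      ((boundedMonotoneTuples A B).filter P).card :=
    Nat.subtype_card _ fun x => by rw [Finset.mem_filter, mem_boundedMonotoneTuples]
  have htotal : Nat.card {x : Fin (n + 1) → ℤ //
        Monotone x ∧ (∀ i, x i ≤ B) ∧ (∀ i, A i ≤ x i)} =
      (boundedMonotoneTuples A B).card :=
    Nat.subtype_card _ fun x => mem_boundedMonotoneTuples
  have hpow : (0 : ℝ) < 2 ^ (n + 1) := by positivity
  have hthreshold (x : Fin (n + 1) → ℤ) :
      (((2 : ℝ) ^ (n + 1) - 1) * (A 0 : ℝ) + (B : ℝ)) / 2 ^ (n + 1) ≤ (x 0 : ℝ) ↔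
        B - A 0 ≤ 2 ^ (n + 1) * (x 0 - A 0) := by
    rw [div_le_iff₀ hpow, ← Int.cast_le (R := ℝ)]
    push_cast
    constructor <;> intro h <;> linarith
  have hstrong : ((2 : ℝ) ^ (n + 1))⁻¹ * ((boundedMonotoneTuples A B).card : ℝ) ≤
      (((boundedMonotoneTuples A B).filter fun x =>
        (((2 : ℝ) ^ (n + 1) - 1) * (A 0 : ℝ) + (B : ℝ)) / 2 ^ (n + 1) ≤ (x 0 : ℝ)).card : ℝ) := by
    rw [inv_mul_le_iff₀ hpow]
    simp_rw [hthreshold]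
    exact_mod_cast card_boundedMonotoneTuples_le n A B hA.monotone
  have heq : (A 0 : ℝ) + ((B : ℝ) - (A 0 : ℝ)) / 2 ^ (n + 1) =
      (((2 : ℝ) ^ (n + 1) - 1) * (A 0 : ℝ) + (B : ℝ)) / 2 ^ (n + 1) := by
    field_simp
    ring
  change ((Nat.card {x : Fin (n + 1) → ℤ //
        (Monotone x ∧ (∀ i, x i ≤ B) ∧ (∀ i, A i ≤ x i)) ∧
        ((A 0 : ℝ) + ((B : ℝ) - (A 0 : ℝ)) / 2 ^ (n + 1) ≤ (x 0 : ℝ))} : ℝ) ≥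
      ((2 : ℝ) ^ (n + 3))⁻¹ *
        (Nat.card {x : Fin (n + 1) → ℤ //
          Monotone x ∧ (∀ i, x i ≤ B) ∧ (∀ i, A i ≤ x i)} : ℝ))
    ∧
    ((Nat.card {x : Fin (n + 1) → ℤ //
        (Monotone x ∧ (∀ i, x i ≤ B) ∧ (∀ i, A i ≤ x i)) ∧
        ((((2 : ℝ) ^ (n + 1) - 1) * (A 0 : ℝ) + (B : ℝ)) / 2 ^ (n + 1) ≤ (x 0 : ℝ))} : ℝ) ≥
      ((2 : ℝ) ^ (n + 1))⁻¹ *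
        (Nat.card {x : Fin (n + 1) → ℤ //
          Monotone x ∧ (∀ i, x i ≤ B) ∧ (∀ i, A i ≤ x i)} : ℝ))
  rw [heq, hcard, htotal]
  refine ⟨le_trans ?_ hstrong, hstrong⟩
  gcongr <;> norm_num
end

section
/- Fix N ≥ 2 and integers A_1 < A_2 < … < A_{N−1} < B. Let (x_1, x_2, …, x_{N−1}) be a uniformly random element of the (finite, nonempty) set of integer tuples satisfying x_1 ≤ x_2 ≤ … ≤ x_{N−1} ≤ B and x_i ≥ A_i for all 1 ≤ i ≤ N−1. Then the probability mass function k ↦ Prob( x_{N−1} = k ), k = A_{N−1}, A_{N−1}+1, …, B, is nondecreasing in k, and consequently Prob( x_{N−1} ≥ (A_{N−1} + B)/2 ) ≥ 1/2. -/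
/-- Moving the top coordinate of a monotone tuple upwards along an injective map `φ` compares the
numbers of bounded monotone tuples whose top coordinate satisfies `S`, respectively `T`. -/
theorem card_monotone_le_of_map_top {ι : Type*} [PartialOrder ι] [Finite ι] (A : ι → ℤ) (B : ℤ)
    {l : ι} (hl : IsTop l) (S T : ℤ → Prop) (φ : ℤ → ℤ) (hφ : Function.Injective φ)
    (h : ∀ k, A l ≤ k → k ≤ B → S k → k ≤ φ k ∧ φ k ≤ B ∧ T (φ k)) :
    Nat.card {x : ι → ℤ // (Monotone x ∧ (∀ i, x i ≤ B) ∧ (∀ i, A i ≤ x i)) ∧ S (x l)} ≤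
      Nat.card {x : ι → ℤ // (Monotone x ∧ (∀ i, x i ≤ B) ∧ (∀ i, A i ≤ x i)) ∧ T (x l)} := by
  classical
  have := Fintype.ofFinite ι
  have : Finite {x : ι → ℤ //
      (Monotone x ∧ (∀ i, x i ≤ B) ∧ (∀ i, A i ≤ x i)) ∧ T (x l)} :=
    ((Set.finite_Icc A fun _ => B).subset fun x hx => ⟨hx.1.2.2, hx.1.2.1⟩ :
      {x : ι → ℤ | (Monotone x ∧ (∀ i, x i ≤ B) ∧ (∀ i, A i ≤ x i)) ∧ T (x l)}.Finite)
  refine Nat.card_le_card_of_injective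
    (fun x => ⟨Function.update x.1 l (φ (x.1 l)), ?_⟩) ?_
  · obtain ⟨x, ⟨hm, hB, hA⟩, hS⟩ := x
    obtain ⟨hle, hφB, hT⟩ := h _ (hA l) (hB l) hS
    refine ⟨⟨fun i j hij => ?_, fun i => ?_, fun i => ?_⟩, by simpa using hT⟩
    · by_cases hj : j = l
      · subst hj
        by_cases hi : i = j
        · rw [hi]
        · simpa [hi] using (hm hij).trans hle
      · have hi : i ≠ l := by
          rintro rfl
          exact hj (le_antisymm (hl j) hij)
        simpa [hi, hj] using hm hij
    · by_cases hi : i = l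
      · subst hi
        simpa using hφB
      · simpa [hi] using hB i
    · by_cases hi : i = l
      · subst hi
        simpa using (hA i).trans hle
      · simpa [hi] using hA i
  · rintro ⟨x, hx⟩ ⟨y, hy⟩ hxy
    have hxy' : Function.update x l (φ (x l)) = Function.update y l (φ (y l)) :=
      congrArg Subtype.val hxy
    refine Subtype.ext (funext fun i => ?_)
    have hi := congrFun hxy' i
    by_cases hil : i = l
    · subst hil
      exact hφ (by simpa using hi)
    · simpa [hil] using hi

/-- The subtype of a finite predicate splits along a second predicate. -/
theorem Nat.card_subtype_eq_add_not {α : Type*} (P Q : α → Prop) [Finite {x // P x}] :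
    Nat.card {x // P x} = Nat.card {x // P x ∧ Q x} + Nat.card {x // P x ∧ ¬ Q x} := by
  have hP : {x | P x}.Finite := ‹Finite {x // P x}›
  exact (Set.ncard_inter_add_ncard_sdiff_eq_ncard {x | P x} {x | Q x} hP).symm


/-- For integers `A_1 < A_2 < … < A_{N−1} < B` and `(x_1,…,x_{N−1})` uniform on the set of
integer tuples with `x_1 ≤ … ≤ x_{N−1} ≤ B` and `x_i ≥ A_i`: the probability mass function
`k ↦ Prob(x_{N−1} = k)` is nondecreasing on `{A_{N−1},…,B}`, and consequently
`Prob(x_{N−1} ≥ (A_{N−1} + B)/2) ≥ 1/2` (probabilities written as counting ratios). -/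
theorem last_coordinate_pmf_monotone (N : ℕ) (hN : 2 ≤ N)
    (A : Fin (N - 1) → ℤ) (B : ℤ) (hA : StrictMono A)
    (hAB : A ⟨N - 2, by omega⟩ < B) :
    (∀ k₁ k₂ : ℤ, A ⟨N - 2, by omega⟩ ≤ k₁ → k₁ ≤ k₂ → k₂ ≤ B →
      Nat.card {x : Fin (N - 1) → ℤ //
          (Monotone x ∧ (∀ i, x i ≤ B) ∧ (∀ i, A i ≤ x i)) ∧ x ⟨N - 2, by omega⟩ = k₁} ≤
      Nat.card {x : Fin (N - 1) → ℤ //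
          (Monotone x ∧ (∀ i, x i ≤ B) ∧ (∀ i, A i ≤ x i)) ∧ x ⟨N - 2, by omega⟩ = k₂})
    ∧
    ((Nat.card {x : Fin (N - 1) → ℤ //
        (Monotone x ∧ (∀ i, x i ≤ B) ∧ (∀ i, A i ≤ x i)) ∧
        (((A ⟨N - 2, by omega⟩ : ℝ) + (B : ℝ)) / 2 ≤ (x ⟨N - 2, by omega⟩ : ℝ))} : ℝ) ≥
      (1 / 2) *
        (Nat.card {x : Fin (N - 1) → ℤ //
          Monotone x ∧ (∀ i, x i ≤ B) ∧ (∀ i, A i ≤ x i)} : ℝ)) := by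
  have hl : IsTop (⟨N - 2, by omega⟩ : Fin (N - 1)) := fun i => by
    rw [Fin.le_def]
    have := i.2
    simp only
    omega
  generalize (⟨N - 2, by omega⟩ : Fin (N - 1)) = l at *
  refine ⟨fun k₁ k₂ _ h₁₂ h₂ => ?_, ?_⟩
  · exact card_monotone_le_of_map_top A B hl (· = k₁) (· = k₂) (· + (k₂ - k₁))
      (add_left_injective _) fun k _ _ hk => by omega
  · have : Finite {x : Fin (N - 1) → ℤ // Monotone x ∧ (∀ i, x i ≤ B) ∧ (∀ i, A i ≤ x i)} :=
      ((Set.finite_Icc A fun _ => B).subset fun x hx => ⟨hx.2.2, hx.2.1⟩ :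
        {x : Fin (N - 1) → ℤ | Monotone x ∧ (∀ i, x i ≤ B) ∧ (∀ i, A i ≤ x i)}.Finite)
    have hsplit := Nat.card_subtype_eq_add_not
      (fun x : Fin (N - 1) → ℤ => Monotone x ∧ (∀ i, x i ≤ B) ∧ (∀ i, A i ≤ x i))
      (fun x => ((A l : ℝ) + (B : ℝ)) / 2 ≤ (x l : ℝ))
    have hle := card_monotone_le_of_map_top A B hl
      (fun k => ¬ ((A l : ℝ) + (B : ℝ)) / 2 ≤ (k : ℝ))
      (fun k => ((A l : ℝ) + (B : ℝ)) / 2 ≤ (k : ℝ)) (A l + B - ·)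
      sub_right_injective fun k hA hB hk => by
        have hlt : 2 * k < A l + B := by
          have : 2 * (k : ℝ) < A l + B := by linarith
          exact_mod_cast this
        refine ⟨by omega, by omega, ?_⟩
        push_cast
        linarith
    rw [hsplit]
    have hle' := (Nat.cast_le (α := ℝ)).2 hle
    push_cast
    linarith
end

section
/- Let M be a random N×N complex Hermitian matrix whose distribution is invariant under conjugation by every unitary matrix u ∈ U(N) (i.e., u M u^{−1} has the same law as M for every fixed unitary u) and whose diagonal entries M_{11}, …, M_{NN} are independent standard real Gaussian N(0,1) random variables. Then for every N×N complex Hermitian matrix A with eigenvalues a_1, …, a_N, the characteristic function satisfies E[ exp( i · Trace(AM) ) ] = ∏_{j=1}^N exp( −a_j²/2 ) = exp( −Trace(A²)/2 ). (Note that Trace(AM) is real since A and M are Hermitian.) -/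
open MeasureTheory ProbabilityTheory

/-- Matrices over a measurable space of entries, with the product σ-algebra. -/
noncomputable instance matrixMeasurableSpace {N : ℕ} :
    MeasurableSpace (Matrix (Fin N) (Fin N) ℂ) :=
  show MeasurableSpace (Fin N → Fin N → ℂ) from inferInstance

theorem measurable_matrix_of_entries {α : Type*} [MeasurableSpace α] {N : ℕ}
    {f : α → Matrix (Fin N) (Fin N) ℂ} (hf : ∀ i j, Measurable fun x => f x i j) :
    Measurable f :=
  measurable_pi_lambda _ fun i => measurable_pi_lambda _ fun j => hf i j

theorem measurable_matrix_entry {N : ℕ} (i j : Fin N) :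
    Measurable fun X : Matrix (Fin N) (Fin N) ℂ => X i j :=
  (measurable_pi_apply j).comp (measurable_pi_apply (X := fun _ : Fin N => Fin N → ℂ) i)

theorem measurable_matrix_const_mul {N : ℕ} (B : Matrix (Fin N) (Fin N) ℂ) :
    Measurable fun X : Matrix (Fin N) (Fin N) ℂ => B * X := by
  refine measurable_matrix_of_entries fun i j => ?_
  simp only [Matrix.mul_apply]
  exact Finset.measurable_sum _ fun k _ => (measurable_matrix_entry k j).const_mul _

theorem measurable_matrix_mul_const {N : ℕ} (B : Matrix (Fin N) (Fin N) ℂ) :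
    Measurable fun X : Matrix (Fin N) (Fin N) ℂ => X * B := by
  refine measurable_matrix_of_entries fun i j => ?_
  simp only [Matrix.mul_apply]
  exact Finset.measurable_sum _ fun k _ => (measurable_matrix_entry i k).mul_const _

theorem measurable_matrix_trace {N : ℕ} :
    Measurable fun X : Matrix (Fin N) (Fin N) ℂ => X.trace := by
  simp only [Matrix.trace, Matrix.diag]
  exact Finset.measurable_sum _ fun k _ => measurable_matrix_entry k k

/-- The characteristic function of the standard Gaussian measure on `Fin N → ℝ`. -/
theorem integral_exp_I_sum_pi_gaussianReal {N : ℕ} (a : Fin N → ℝ) :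
    ∫ x : Fin N → ℝ, Complex.exp (Complex.I * ∑ j, (a j : ℂ) * (x j : ℂ))
        ∂Measure.pi (fun _ : Fin N => gaussianReal 0 1) =
      ∏ j, Complex.exp (-(a j : ℂ) ^ 2 / 2) := by
  simp only [Finset.mul_sum, Complex.exp_sum]
  rw [integral_fintype_prod_eq_prod (𝕜 := ℂ)
    (fun j (t : ℝ) => Complex.exp (Complex.I * ((a j : ℂ) * (t : ℂ))))]
  refine Finset.prod_congr rfl fun j _ => ?_
  have h := charFun_gaussianReal (μ := 0) (v := 1) (a j)
  rw [charFun_apply_real] at h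
  calc ∫ t : ℝ, Complex.exp (Complex.I * ((a j : ℂ) * (t : ℂ))) ∂gaussianReal 0 1
      = ∫ t : ℝ, Complex.exp ((a j : ℂ) * (t : ℂ) * Complex.I) ∂gaussianReal 0 1 := by
        simp only [mul_comm Complex.I]
    _ = Complex.exp (-(a j : ℂ) ^ 2 / 2) := by
        rw [h]
        simp [neg_div]

theorem trace_diagonal_mul_eq_sum_re {N : ℕ} (a : Fin N → ℝ) {X : Matrix (Fin N) (Fin N) ℂ}
    (hX : X.IsHermitian) :
    (Matrix.diagonal (fun j => (a j : ℂ)) * X).trace = ∑ j, (a j : ℂ) * ((X j j).re : ℂ) := by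
  simp only [Matrix.trace, Matrix.diag, Matrix.diagonal_mul]
  refine Finset.sum_congr rfl fun j _ => ?_
  rw [show ((X j j).re : ℂ) = X j j from hX.coe_re_apply_self j]

theorem trace_conj_mul_conj {N : ℕ} (u : Matrix.unitaryGroup (Fin N) ℂ)
    (D X : Matrix (Fin N) (Fin N) ℂ) :
    (((u : Matrix (Fin N) (Fin N) ℂ) * D * star (u : Matrix (Fin N) (Fin N) ℂ)) *
      ((u : Matrix (Fin N) (Fin N) ℂ) * X * star (u : Matrix (Fin N) (Fin N) ℂ))).trace =
      (D * X).trace := by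
  have hu : star (u : Matrix (Fin N) (Fin N) ℂ) * (u : Matrix (Fin N) (Fin N) ℂ) = 1 :=
    Unitary.coe_star_mul_self u
  generalize (u : Matrix (Fin N) (Fin N) ℂ) = U at hu
  calc (U * D * star U * (U * X * star U)).trace
      = (U * (D * (star U * U) * X * star U)).trace := by simp only [Matrix.mul_assoc]
    _ = (D * X).trace := by
      rw [Matrix.trace_mul_comm, hu, Matrix.mul_one, Matrix.mul_assoc, hu, Matrix.mul_one]

/-- If a random Hermitian `N×N` matrix `M` has unitarily invariant law and independent
standard Gaussian `N(0,1)` diagonal entries, then its characteristic function is that of the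
GUE: for every Hermitian `A` with eigenvalues `a_1,…,a_N`,
`E[exp(i·Tr(AM))] = ∏_j exp(−a_j²/2) = exp(−Tr(A²)/2)`. -/
theorem characteristic_function_of_invariant_gaussian_diagonal
    {Ω : Type*} [MeasurableSpace Ω] (P : Measure Ω) [IsProbabilityMeasure P]
    (N : ℕ) (M : Ω → Matrix (Fin N) (Fin N) ℂ) (hMmeas : Measurable M)
    (hHerm : ∀ ω, (M ω).IsHermitian)
    (hinv : ∀ u : Matrix.unitaryGroup (Fin N) ℂ,
      Measure.map (fun ω => (u : Matrix (Fin N) (Fin N) ℂ) * M ω *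
        (star (u : Matrix (Fin N) (Fin N) ℂ))) P = Measure.map M P)
    (hdiag : Measure.map (fun ω (i : Fin N) => (M ω i i).re) P =
      Measure.pi (fun _ : Fin N => gaussianReal 0 1)) :
    ∀ (A : Matrix (Fin N) (Fin N) ℂ) (hA : A.IsHermitian),
      (∫ ω, Complex.exp (Complex.I * (A * M ω).trace) ∂P) =
        ∏ j : Fin N, Complex.exp (-(hA.eigenvalues j : ℂ) ^ 2 / 2) ∧
      (∫ ω, Complex.exp (Complex.I * (A * M ω).trace) ∂P) =
        Complex.exp (-(A * A).trace / 2) := by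
  intro A hA
  set D : Matrix (Fin N) (Fin N) ℂ := Matrix.diagonal (fun j => (hA.eigenvalues j : ℂ)) with hD
  obtain ⟨u, hu⟩ : ∃ u : Matrix.unitaryGroup (Fin N) ℂ,
      A = (u : Matrix (Fin N) (Fin N) ℂ) * D * star (u : Matrix (Fin N) (Fin N) ℂ) :=
    ⟨hA.eigenvectorUnitary, hA.spectral_theorem⟩
  have hf : Measurable fun X : Matrix (Fin N) (Fin N) ℂ =>
      Complex.exp (Complex.I * (A * X).trace) :=
    Complex.measurable_exp.comp
      ((measurable_matrix_trace.comp (measurable_matrix_const_mul A)).const_mul _)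
  have hconj : Measurable fun ω => (u : Matrix (Fin N) (Fin N) ℂ) * M ω *
      (star (u : Matrix (Fin N) (Fin N) ℂ)) :=
    (measurable_matrix_mul_const _).comp ((measurable_matrix_const_mul _).comp hMmeas)
  have hre : Measurable fun ω (i : Fin N) => (M ω i i).re :=
    measurable_pi_lambda _ fun i =>
      Complex.measurable_re.comp ((measurable_matrix_entry i i).comp hMmeas)
  have hg : Measurable fun x : Fin N → ℝ =>
      Complex.exp (Complex.I * ∑ j, (hA.eigenvalues j : ℂ) * (x j : ℂ)) := by
    fun_prop
  have key : (∫ ω, Complex.exp (Complex.I * (A * M ω).trace) ∂P) =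
      ∏ j : Fin N, Complex.exp (-(hA.eigenvalues j : ℂ) ^ 2 / 2) := by
    rw [← integral_map hMmeas.aemeasurable hf.aestronglyMeasurable, ← hinv u,
      integral_map hconj.aemeasurable hf.aestronglyMeasurable,
      ← integral_exp_I_sum_pi_gaussianReal, ← hdiag,
      integral_map hre.aemeasurable hg.aestronglyMeasurable]
    refine integral_congr_ae (Filter.Eventually.of_forall fun ω => ?_)
    dsimp only
    rw [← trace_diagonal_mul_eq_sum_re _ (hHerm ω), ← hD, ← trace_conj_mul_conj u D, ← hu]
  refine ⟨key, key.trans ?_⟩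
  have htr : (A * A).trace = ∑ j, (hA.eigenvalues j : ℂ) ^ 2 := by
    have h : (A * A).trace = (D * D).trace := by
      rw [← trace_conj_mul_conj u D, ← hu]
    rw [h, hD, Matrix.diagonal_mul_diagonal, Matrix.trace_diagonal]
    exact Finset.sum_congr rfl fun j _ => (sq _).symm
  rw [← Complex.exp_sum, htr, ← Finset.sum_div, Finset.sum_neg_distrib]
end
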